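/- Every MAD 𝔪 of the twisted affine Kac–Moody Lie algebra L̂(𝔤,σ) satisfies dim_k 𝔪 ≥ 3. -/

import Mathlib

open LaurentPolynomial TensorProduct

noncomputable section

/-- The weight space of a subalgebra `𝔪` of `M` attached to a linear functional
`α ∈ 𝔪*`: `M_α = {l ∈ M : ⁅z, l⁆ = α(z) • l for all z ∈ 𝔪}`. -/
def adWeightSpace {k M : Type} [Field k] [LieRing M] [LieAlgebra k M]
    (𝔪 : LieSubalgebra k M) (α : Module.Dual k ↥𝔪) : Submodule k M :=
  ⨅ z : ↥𝔪, LinearMap.ker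
    ((LieAlgebra.ad k M (z : M)) - α z • (1 : Module.End k M))

/-- A subalgebra `𝔪` of a Lie algebra `M` over `k` is diagonalizable if
`M = ⊕_{α ∈ 𝔪*} M_α`. -/
def IsDiagonalizableSubalgebra {k M : Type} [Field k] [LieRing M] [LieAlgebra k M]
    (𝔪 : LieSubalgebra k M) : Prop :=
  (⨆ α : Module.Dual k ↥𝔪, adWeightSpace 𝔪 α) = ⊤

/-- A MAD: a maximal (abelian) diagonalizable subalgebra. -/
def IsMAD {k M : Type} [Field k] [LieRing M] [LieAlgebra k M]
    (𝔪 : LieSubalgebra k M) : Prop :=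
  IsDiagonalizableSubalgebra 𝔪 ∧
    ∀ 𝔪' : LieSubalgebra k M, IsDiagonalizableSubalgebra 𝔪' → 𝔪 ≤ 𝔪' → 𝔪' = 𝔪

namespace LoopMAD

section Graded

variable {R M I : Type*} [CommRing R] [AddCommGroup M] [Module R M]

theorem hom_eq_of_iSup_eq_top {N : Type*} [AddCommGroup N] [Module R N] {A : I → Submodule R M}
    (ht : iSup A = ⊤) (f g : M →ₗ[R] N) (h : ∀ i, ∀ v ∈ A i, f v = g v) (v : M) : f v = g v := by
  have : v ∈ iSup A := ht ▸ Submodule.mem_top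
  induction this using Submodule.iSup_induction' with
  | mem i x hx => exact h i x hx
  | zero => simp
  | add x y _ _ hx hy => simp [hx, hy]

/-- An operator acting on the pieces of a direct sum decomposition by prescribed scalars. -/
theorem exists_scale {A : I → Submodule R M} (hi : iSupIndep A) (ht : iSup A = ⊤) (c : I → R) :
    ∃ E : Module.End R M, ∀ i, ∀ v ∈ A i, E v = c i • v := by
  classical
  have h := DirectSum.isInternal_submodule_of_iSupIndep_of_iSup_eq_top hi ht
  let e := LinearEquiv.ofBijective (DirectSum.coeLinearMap A) h
  refine ⟨(DirectSum.toModule R I M fun i => c i • (A i).subtype) ∘ₗ e.symm.toLinearMap, ?_⟩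
  intro i v hv
  have : e.symm v = DirectSum.lof R I (fun i => A i) i ⟨v, hv⟩ := by
    rw [LinearEquiv.symm_apply_eq]
    exact (DirectSum.coeLinearMap_lof A i ⟨v, hv⟩).symm
  simp only [LinearMap.comp_apply, LinearEquiv.coe_coe]
  rw [this, DirectSum.toModule_lof]
  simp

/-- The projections attached to a direct sum decomposition. -/
structure IsProj (A : I → Submodule R M) (P : I → Module.End R M) : Prop where
  mem : ∀ i v, P i v ∈ A i
  same : ∀ i, ∀ v ∈ A i, P i v = v
  ne : ∀ i j, i ≠ j → ∀ v ∈ A j, P i v = 0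
  sum : ∀ v, ∃ s : Finset I, (∀ i ∉ s, P i v = 0) ∧ ∑ i ∈ s, P i v = v

theorem exists_isProj {A : I → Submodule R M} (hi : iSupIndep A) (ht : iSup A = ⊤) :
    ∃ P : I → Module.End R M, IsProj A P := by
  classical
  have h (i : I) := exists_scale hi ht (fun j => if j = i then 1 else 0)
  choose P hP using h
  have hs : ∀ i, ∀ v ∈ A i, P i v = v := fun i v hv => by simp [hP i i v hv]
  have hn : ∀ i j, i ≠ j → ∀ v ∈ A j, P i v = 0 := fun i j hij v hv => by
    simp [hP i j v hv, hij.symm]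
  refine ⟨P, ?_, hs, hn, ?_⟩
  · intro i v
    have : v ∈ iSup A := ht ▸ Submodule.mem_top
    induction this using Submodule.iSup_induction' with
    | mem j x hx =>
      by_cases hij : i = j
      · subst hij; rwa [hs i x hx]
      · rw [hn i j hij x hx]; exact zero_mem _
    | zero => simp
    | add x y _ _ hx hy => rw [map_add]; exact add_mem hx hy
  · intro v
    have : v ∈ iSup A := ht ▸ Submodule.mem_top
    induction this using Submodule.iSup_induction' with
    | mem j x hx =>
      refine ⟨{j}, fun i hi => hn i j (by simpa using hi) x hx, by simp [hs j x hx]⟩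
    | zero => exact ⟨∅, by simp⟩
    | add x y _ _ hx hy =>
      obtain ⟨s, h1, h2⟩ := hx
      obtain ⟨t, h3, h4⟩ := hy
      refine ⟨s ∪ t, fun i hi => ?_, ?_⟩
      · rw [Finset.mem_union, not_or] at hi
        simp [h1 i hi.1, h3 i hi.2]
      · simp only [map_add, Finset.sum_add_distrib]
        rw [← Finset.sum_subset Finset.subset_union_left fun i _ hi => h1 i hi,
          ← Finset.sum_subset Finset.subset_union_right fun i _ hi => h3 i hi, h2, h4]

theorem IsProj.ext {A : I → Submodule R M} {P : I → Module.End R M} (h : IsProj A P) {v w : M}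
    (hvw : ∀ i, P i v = P i w) : v = w := by
  obtain ⟨s, h1, h2⟩ := h.sum (v - w)
  rw [← sub_eq_zero, ← h2]
  exact Finset.sum_eq_zero fun i _ => by simp [hvw i]

theorem IsProj.le_span {A : I → Submodule R M} {P : I → Module.End R M} (h : IsProj A P)
    {J : Type*} (x : J → M) (γ : J → I) (hx : ∀ j, x j ∈ A (γ j))
    (hspan : Submodule.span R (Set.range x) = ⊤) (i : I) :
    A i ≤ Submodule.span R (x '' {j | γ j = i}) := by
  intro v hv
  rw [← h.same i v hv]
  have : v ∈ Submodule.span R (Set.range x) := hspan ▸ Submodule.mem_top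
  clear hv
  induction this using Submodule.span_induction with
  | mem y hy =>
    obtain ⟨j, rfl⟩ := hy
    by_cases hj : γ j = i
    · rw [h.same i _ (hj ▸ hx j)]
      exact Submodule.subset_span ⟨j, hj, rfl⟩
    · rw [h.ne i _ (Ne.symm hj) _ (hx j)]
      exact zero_mem _
  | zero => simp
  | add y z _ _ hy hz => rw [map_add]; exact add_mem hy hz
  | smul a y _ hy => rw [map_smul]; exact Submodule.smul_mem _ _ hy

end Graded

section Eigen

variable {k M : Type*} [Field k] [AddCommGroup M] [Module k M]

theorem sum_eigen_mem (f : Module.End k M) (p : Submodule k M) (hp : ∀ v ∈ p, f v ∈ p)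
    (s : Finset k) (v : k → M) (hv : ∀ i ∈ s, f (v i) = i • v i) (hs : ∑ i ∈ s, v i ∈ p) :
    ∀ i ∈ s, v i ∈ p := by
  classical
  induction s using Finset.induction_on generalizing v with
  | empty => simp
  | insert a s ha ih =>
    have key : ∑ i ∈ s, (i - a) • v i ∈ p := by
      have h1 : f (∑ i ∈ insert a s, v i) - a • ∑ i ∈ insert a s, v i
          = ∑ i ∈ s, (i - a) • v i := by
        rw [map_sum, Finset.smul_sum, ← Finset.sum_sub_distrib, Finset.sum_insert ha,
          hv a (Finset.mem_insert_self _ _), sub_self, zero_add]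
        refine Finset.sum_congr rfl fun i hi => ?_
        rw [hv i (Finset.mem_insert_of_mem hi), sub_smul]
      rw [← h1]
      exact sub_mem (hp _ hs) (p.smul_mem _ hs)
    have h2 := ih (fun i => (i - a) • v i) (fun i hi => by
      rw [map_smul, hv i (Finset.mem_insert_of_mem hi), smul_comm]) key
    have h3 : ∀ i ∈ s, v i ∈ p := fun i hi => by
      have hne : i - a ≠ 0 := sub_ne_zero.2 fun h => ha (h ▸ hi)
      exact (p.smul_mem_iff hne).1 (h2 i hi)
    intro i hi
    rcases Finset.mem_insert.1 hi with rfl | hi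
    · rw [Finset.sum_insert ha] at hs
      exact (p.add_mem_iff_left (sum_mem h3)).1 hs
    · exact h3 i hi

/-- An invariant subspace of a diagonalizable operator is spanned by eigenvectors. -/
theorem le_iSup_inf_eigenspace (f : Module.End k M) (hf : ⨆ μ, f.eigenspace μ = ⊤)
    (p : Submodule k M) (hp : ∀ v ∈ p, f v ∈ p) : p ≤ ⨆ μ, p ⊓ f.eigenspace μ := by
  intro v hv
  obtain ⟨P, hP⟩ := exists_isProj f.eigenspaces_iSupIndep hf
  obtain ⟨s, -, hs⟩ := hP.sum v
  have := sum_eigen_mem f p hp s (fun i => P i v)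
    (fun i _ => Module.End.mem_eigenspace_iff.1 (hP.mem i v)) (hs.symm ▸ hv)
  rw [← hs]
  exact sum_mem fun i hi => Submodule.mem_iSup_of_mem i ⟨this i hi, hP.mem i v⟩

theorem commute_of_maps_eigenspace {N : Type*} [AddCommGroup N] [Module k N]
    {A : k → Submodule k M} (ht : iSup A = ⊤) (E : Module.End k M)
    (hE : ∀ μ, ∀ v ∈ A μ, E v = μ • v) {B : k → Submodule k N} (F : Module.End k N)
    (hF : ∀ μ, ∀ v ∈ B μ, F v = μ • v) (ε : k)
    (G : M →ₗ[k] N) (hG : ∀ μ, ∀ v ∈ A μ, G v ∈ B (μ + ε)) (v : M) :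
    F (G v) = G (E v) + ε • G v := by
  have := hom_eq_of_iSup_eq_top ht (F ∘ₗ G) (G ∘ₗ E + ε • G) (fun μ v hv => by
    simp [hE μ v hv, hF _ _ (hG μ v hv), add_smul]) v
  simpa using this

/-- Every vector lies in a finite-dimensional stable subspace. -/
def LocallyFinite (f : Module.End k M) : Prop :=
  ∀ v, ∃ W : Submodule k M, FiniteDimensional k W ∧ v ∈ W ∧ ∀ w ∈ W, f w ∈ W

theorem LocallyFinite.iSup_maxGenEigenspace [IsAlgClosed k] {f : Module.End k M}
    (hf : LocallyFinite f) : ⨆ μ, f.maxGenEigenspace μ = ⊤ := by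
  rw [eq_top_iff]
  intro v _
  obtain ⟨W, hW, hv, hs⟩ := hf v
  let g : Module.End k W := f.restrict hs
  have h1 : (⟨v, hv⟩ : W) ∈ ⨆ μ, g.maxGenEigenspace μ := by
    rw [Module.End.iSup_maxGenEigenspace_eq_top]; trivial
  have h2 : ∀ x : W, x ∈ ⨆ μ, g.maxGenEigenspace μ → (x : M) ∈ ⨆ μ, f.maxGenEigenspace μ := by
    intro x hx
    induction hx using Submodule.iSup_induction' with
    | mem μ x hx =>
      refine Submodule.mem_iSup_of_mem μ ?_
      rw [Module.End.mem_maxGenEigenspace] at hx ⊢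
      obtain ⟨n, hn⟩ := hx
      refine ⟨n, ?_⟩
      have h3 : ∀ (n : ℕ) (x : W), (((g - μ • 1) ^ n) x : M) = ((f - μ • 1) ^ n) (x : M) := by
        intro n
        induction n with
        | zero => simp
        | succ n ih =>
          intro x
          rw [pow_succ, pow_succ, Module.End.mul_apply, Module.End.mul_apply, ih]
          rfl
      rw [← h3, hn]; rfl
    | zero => simp
    | add x y _ _ hx hy => exact add_mem hx hy
  exact h2 _ h1

end Eigen

section Jordan

variable {k V : Type*} [Field k] [LieRing V] [LieAlgebra k V]

theorem pow_lie_eq_zero (f : Module.End k V) (hf : ∀ x y, f ⁅x, y⁆ = ⁅f x, y⁆ + ⁅x, f y⁆)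
    (α β : k) (n : ℕ) : ∀ (i j : ℕ), i + j ≤ n + 1 → ∀ x y : V, ((f - α • 1) ^ i) x = 0 →
      ((f - β • 1) ^ j) y = 0 → ((f - (α + β) • 1) ^ n) ⁅x, y⁆ = 0 := by
  have step : ∀ x y : V, (f - (α + β) • 1) ⁅x, y⁆
      = ⁅(f - α • 1) x, y⁆ + ⁅x, (f - β • 1) y⁆ := by
    intro x y
    simp [hf, add_smul]
    abel
  induction n with
  | zero =>
    intro i j hij x y hx hy
    have : i = 0 ∨ j = 0 := by omega
    rcases this with rfl | rfl
    · have : x = 0 := by simpa using hx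
      simp [this]
    · have : y = 0 := by simpa using hy
      simp [this]
  | succ n ih =>
    intro i j hij x y hx hy
    rw [pow_succ, Module.End.mul_apply, step, map_add]
    rcases i with _ | i
    · have : x = 0 := by simpa using hx
      simp [this]
    rcases j with _ | j
    · have : y = 0 := by simpa using hy
      simp [this]
    rw [ih i (j + 1) (by omega) _ y (by rwa [pow_succ, Module.End.mul_apply] at hx) hy,
      ih (i + 1) j (by omega) x _ hx (by rwa [pow_succ, Module.End.mul_apply] at hy), add_zero]

theorem lie_mem_maxGenEigenspace (f : Module.End k V)
    (hf : ∀ x y, f ⁅x, y⁆ = ⁅f x, y⁆ + ⁅x, f y⁆) {α β : k} {x y : V}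
    (hx : x ∈ f.maxGenEigenspace α) (hy : y ∈ f.maxGenEigenspace β) :
    ⁅x, y⁆ ∈ f.maxGenEigenspace (α + β) := by
  rw [Module.End.mem_maxGenEigenspace] at hx hy ⊢
  obtain ⟨i, hi⟩ := hx
  obtain ⟨j, hj⟩ := hy
  exact ⟨i + j, pow_lie_eq_zero f hf α β (i + j) i j (by omega) x y hi hj⟩

/-- The semisimple part of a locally finite derivation. -/
theorem exists_semisimple_part [IsAlgClosed k] (f : Module.End k V)
    (hf : ∀ x y, f ⁅x, y⁆ = ⁅f x, y⁆ + ⁅x, f y⁆) (hlf : LocallyFinite f) :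
    ∃ g : Module.End k V, (∀ x y, g ⁅x, y⁆ = ⁅g x, y⁆ + ⁅x, g y⁆) ∧ (⨆ μ, g.eigenspace μ = ⊤) ∧
      (∀ (G : Module.End k V) (ε : k), (∀ v, f (G v) = G (f v) + ε • G v) →
        ∀ v, g (G v) = G (g v) + ε • G v) ∧
      (∀ v, f v = 0 → g v = 0) ∧
      (g = 0 → ∀ v, ∃ n : ℕ, (f ^ n) v = 0) := by
  have ht := hlf.iSup_maxGenEigenspace
  have hi := f.independent_maxGenEigenspace
  obtain ⟨g, hg⟩ := exists_scale hi ht id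
  simp only [id] at hg
  have hder : ∀ x y, g ⁅x, y⁆ = ⁅g x, y⁆ + ⁅x, g y⁆ := by
    intro x y
    have hy : y ∈ ⨆ μ, f.maxGenEigenspace μ := ht ▸ Submodule.mem_top
    have hx : x ∈ ⨆ μ, f.maxGenEigenspace μ := ht ▸ Submodule.mem_top
    induction hx using Submodule.iSup_induction' with
    | mem α x hx =>
      induction hy using Submodule.iSup_induction' with
      | mem β y hy =>
        rw [hg _ _ (lie_mem_maxGenEigenspace f hf hx hy), hg _ _ hx, hg _ _ hy]
        simp [add_smul]
      | zero => simp
      | add y z _ _ hy hz => simp only [lie_add, map_add, hy, hz]; abel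
    | zero => simp
    | add x z _ _ hx hz => simp only [add_lie, map_add, hx, hz]; abel
  refine ⟨g, hder, ?_, ?_, ?_, ?_⟩
  · rw [eq_top_iff, ← ht]
    exact iSup_mono fun μ v hv => Module.End.mem_eigenspace_iff.2 (hg μ v hv)
  · intro G ε hG
    refine commute_of_maps_eigenspace ht g hg g hg ε G ?_
    intro μ v hv
    rw [Module.End.mem_maxGenEigenspace] at hv ⊢
    obtain ⟨n, hn⟩ := hv
    refine ⟨n, ?_⟩
    have : ∀ (n : ℕ) (v : V), ((f - (μ + ε) • 1) ^ n) (G v) = G (((f - μ • 1) ^ n) v) := by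
      intro n
      induction n with
      | zero => simp
      | succ n ih =>
        intro v
        rw [pow_succ, pow_succ, Module.End.mul_apply, Module.End.mul_apply, ← ih]
        congr 1
        simp [hG, add_smul]
    rw [this, hn, map_zero]
  · intro v hv
    rw [hg 0 v ?_, zero_smul]
    rw [Module.End.mem_maxGenEigenspace]
    exact ⟨1, by simpa using hv⟩
  · intro h0 v
    have h1 : ∀ μ ≠ 0, f.maxGenEigenspace μ = ⊥ := by
      intro μ hμ
      rw [eq_bot_iff]
      intro v hv
      have := hg μ v hv
      rw [h0, LinearMap.zero_apply] at this
      simpa [hμ] using this.symm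
    have h2 : f.maxGenEigenspace 0 = ⊤ := by
      rw [eq_top_iff, ← ht]
      refine iSup_le fun μ => ?_
      by_cases hμ : μ = 0
      · rw [hμ]
      · rw [h1 μ hμ]; exact bot_le
    have : v ∈ f.maxGenEigenspace 0 := h2 ▸ Submodule.mem_top
    rw [Module.End.mem_maxGenEigenspace] at this
    simpa using this

end Jordan

theorem exists_real_functional (k : Type*) [Field k] [CharZero k] (s : Finset k) :
    ∃ φ : k →ₗ[ℚ] ℝ, φ 1 = 1 ∧
      ∀ x ∈ Submodule.span ℚ (insert 1 (s : Set k)), φ x = 0 → x = 0 := by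
  classical
  set W := Submodule.span ℚ (insert 1 (s : Set k)) with hW
  have : FiniteDimensional ℚ W := by
    have : W = Submodule.span ℚ ((insert 1 s : Finset k) : Set k) := by simp [hW]
    rw [this]
    exact FiniteDimensional.span_finset ℚ _
  obtain ⟨g, hg⟩ : ∃ g : W →ₗ[ℚ] ℝ, Function.Injective g := by
    have h1 : Cardinal.lift.{0} (Module.rank ℚ W) ≤ Cardinal.lift (Module.rank ℚ ℝ) := by
      rw [Real.rank_rat_real]
      simp only [Cardinal.lift_continuum]
      exact (Cardinal.lift_lt_aleph0.2 (Module.rank_lt_aleph0 ℚ W)).le.trans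
        Cardinal.aleph0_le_continuum
    exact lift_rank_le_iff_exists_linearMap.1 h1
  obtain ⟨h, hh⟩ := LinearMap.exists_extend g
  have h1W : (1 : k) ∈ W := Submodule.subset_span (Set.mem_insert _ _)
  have hx : ∀ x (hx : x ∈ W), h x = g ⟨x, hx⟩ := fun x hx => by rw [← hh]; rfl
  have h1 : h 1 ≠ 0 := by
    rw [hx 1 h1W]
    intro h0
    have := hg (h0.trans (map_zero g).symm)
    exact one_ne_zero (congrArg Subtype.val this)
  refine ⟨(LinearMap.mulLeft ℚ (h 1)⁻¹) ∘ₗ h, ?_, ?_⟩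
  · simp [h1]
  · intro x hxW h0
    have : h x = 0 := by simpa [h1] using h0
    rw [hx x hxW] at this
    exact congrArg Subtype.val (hg (this.trans (map_zero g).symm))

section Kreknin

variable {k V : Type*} [Field k] [LieRing V] [LieAlgebra k V]

/-- A perfect graded Lie algebra whose pieces are suitably ordered has to vanish. -/
theorem graded_eq_bot_aux (A : k → Submodule k V) (hi : iSupIndep A)
    (hA : ∀ α β, ∀ x ∈ A α, ∀ y ∈ A β, ⁅x, y⁆ ∈ A (α + β))
    (hperf : iSup A ≤ Submodule.span k {z | ∃ x ∈ iSup A, ∃ y ∈ iSup A, ⁅x, y⁆ = z})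
    (r : k → ℝ) (R : Finset ℝ) (hR : ∀ α, A α ≠ ⊥ → r α ∈ R)
    (heq : ∀ α β, A α ≠ ⊥ → A β ≠ ⊥ → r α = r β → A (α - β) = ⊥)
    (hlt : ∀ α β, A α ≠ ⊥ → A β ≠ ⊥ → r α < r β → r α < r (α - β)) (U : Finset ℝ) :
    (∀ x ∈ U, ∀ y ∈ R, x ≤ y → y ∈ U) →
    iSup A ≤ (LieSubalgebra.lieSpan k V {v | ∃ α, r α ∈ U ∧ v ∈ A α}).toSubmodule →
    iSup A = ⊥ := by
  classical
  induction U using Finset.strongInduction with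
  | H U ih =>
  intro hup hU
  rcases U.eq_empty_or_nonempty with rfl | hne
  · rw [eq_bot_iff]
    refine hU.trans ?_
    have : {v : V | ∃ α, r α ∈ (∅ : Finset ℝ) ∧ v ∈ A α} = ∅ := by ext; simp
    rw [this, LieSubalgebra.span_empty]
    exact le_rfl
  set κ := U.min' hne with hκ
  have hκU : κ ∈ U := U.min'_mem hne
  have hmin : ∀ x ∈ U, κ ≤ x := fun x hx => U.min'_le x hx
  refine ih (U.erase κ) (Finset.erase_ssubset hκU) ?_ ?_
  · intro x hx y hy hxy
    obtain ⟨hx1, hx2⟩ := Finset.mem_erase.1 hx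
    have : κ < x := lt_of_le_of_ne (hmin x hx2) (Ne.symm hx1)
    exact Finset.mem_erase.2 ⟨(this.trans_le hxy).ne', hup x hx2 y hy hxy⟩
  set S' := LieSubalgebra.lieSpan k V {v | ∃ α, r α ∈ U.erase κ ∧ v ∈ A α} with hS'
  have hAS' : ∀ α, κ < r α → A α ≤ S'.toSubmodule := by
    intro α hα v hv
    by_cases h0 : A α = ⊥
    · rw [h0, Submodule.mem_bot] at hv; rw [hv]; exact zero_mem _
    · exact LieSubalgebra.subset_lieSpan
        ⟨α, Finset.mem_erase.2 ⟨hα.ne', hup κ hκU _ (hR α h0) hα.le⟩, hv⟩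
  -- the bracket of everything with the generators
  let N : Submodule k V := Submodule.span k {z | ∃ γ β, r β ∈ U ∧ ∃ x ∈ A γ, ∃ y ∈ A β, ⁅x, y⁆ = z}
  have hlie : ∀ x ∈ iSup A, ∀ y ∈ iSup A, ⁅x, y⁆ ∈ iSup A := by
    intro x hx y hy
    induction hx using Submodule.iSup_induction' with
    | mem α x hx =>
      induction hy using Submodule.iSup_induction' with
      | mem β y hy => exact Submodule.mem_iSup_of_mem _ (hA _ _ x hx y hy)
      | zero => simp
      | add y z _ _ hy hz => rw [lie_add]; exact add_mem hy hz
    | zero => simp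
    | add x z _ _ hx hz => rw [add_lie]; exact add_mem hx hz
  have hN : ∀ y ∈ LieSubalgebra.lieSpan k V {v | ∃ α, r α ∈ U ∧ v ∈ A α},
      y ∈ iSup A ∧ ∀ x ∈ iSup A, ⁅x, y⁆ ∈ N := by
    intro y hy
    induction hy using LieSubalgebra.lieSpan_induction with
    | mem y hy =>
      obtain ⟨β, hβ, hy⟩ := hy
      refine ⟨Submodule.mem_iSup_of_mem β hy, fun x hx => ?_⟩
      induction hx using Submodule.iSup_induction' with
      | mem γ x hx => exact Submodule.subset_span ⟨γ, β, hβ, x, hx, y, hy, rfl⟩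
      | zero => simp
      | add x z _ _ hx hz => rw [add_lie]; exact add_mem hx hz
    | zero => simp
    | add y z _ _ hy hz =>
      exact ⟨add_mem hy.1 hz.1, fun x hx => by rw [lie_add]; exact add_mem (hy.2 x hx) (hz.2 x hx)⟩
    | smul a y _ hy =>
      exact ⟨Submodule.smul_mem _ _ hy.1,
        fun x hx => by rw [lie_smul]; exact Submodule.smul_mem _ _ (hy.2 x hx)⟩
    | lie y z _ _ hy hz =>
      refine ⟨hlie _ hy.1 _ hz.1, fun x hx => ?_⟩
      rw [leibniz_lie, ← lie_skew y]
      exact add_mem (hz.2 _ (hlie _ hx _ hy.1)) (neg_mem (hy.2 _ (hlie _ hx _ hz.1)))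
  have hle : iSup A ≤ N := by
    refine hperf.trans (Submodule.span_le.2 ?_)
    rintro _ ⟨x, hx, y, hy, rfl⟩
    exact (hN y (hU hy)).2 x hx
  refine hU.trans (LieSubalgebra.lieSpan_le.2 ?_)
  rintro v ⟨α, hα, hv⟩
  by_cases h0 : A α = ⊥
  · rw [h0, Submodule.mem_bot] at hv; rw [hv]; exact zero_mem _
  rcases (hmin _ hα).lt_or_eq with hακ | hακ
  · exact hAS' α hακ hv
  have hvN : v ∈ N := hle (Submodule.mem_iSup_of_mem α hv)
  have hNA : N ≤ (A α ⊓ S'.toSubmodule) ⊔ ⨆ j, ⨆ (_ : j ≠ α), A j := by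
    refine Submodule.span_le.2 ?_
    rintro _ ⟨γ, β, hβ, x, hx, y, hy, rfl⟩
    by_cases hγ : γ + β = α
    · refine Submodule.mem_sup_left ⟨hγ ▸ hA γ β x hx y hy, ?_⟩
      have hγ' : γ = α - β := by rw [← hγ]; ring
      by_cases hβ0 : A β = ⊥
      · rw [hβ0, Submodule.mem_bot] at hy; rw [hy, lie_zero]; exact zero_mem _
      rcases (hmin _ hβ).lt_or_eq with hβκ | hβκ
      · have := hlt α β h0 hβ0 (hακ ▸ hβκ)
        rw [← hγ', ← hακ] at this
        exact S'.lie_mem (hAS' γ this hx) (hAS' β hβκ hy)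
      · have := heq α β h0 hβ0 (hακ ▸ hβκ)
        rw [← hγ'] at this
        rw [this, Submodule.mem_bot] at hx; rw [hx, zero_lie]; exact zero_mem _
    · exact Submodule.mem_sup_right
        (Submodule.mem_iSup_of_mem (γ + β) (Submodule.mem_iSup_of_mem hγ (hA γ β x hx y hy)))
  obtain ⟨a, ha, b, hb, hab⟩ := Submodule.mem_sup.1 (hNA hvN)
  have hb0 : b = 0 := by
    have h1 : b ∈ A α := by
      have : b = v - a := by rw [← hab]; abel
      rw [this]; exact sub_mem hv ha.1
    exact Submodule.disjoint_def.1 (hi α) b h1 hb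
  rw [← hab, hb0, add_zero]
  exact ha.2

theorem graded_eq_bot (A : k → Submodule k V) (hi : iSupIndep A)
    (hA : ∀ α β, ∀ x ∈ A α, ∀ y ∈ A β, ⁅x, y⁆ ∈ A (α + β))
    (hperf : iSup A ≤ Submodule.span k {z | ∃ x ∈ iSup A, ∃ y ∈ iSup A, ⁅x, y⁆ = z})
    (r : k → ℝ) (R : Finset ℝ) (hR : ∀ α, A α ≠ ⊥ → r α ∈ R)
    (heq : ∀ α β, A α ≠ ⊥ → A β ≠ ⊥ → r α = r β → A (α - β) = ⊥)
    (hlt : ∀ α β, A α ≠ ⊥ → A β ≠ ⊥ → r α < r β → r α < r (α - β)) : iSup A = ⊥ := by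
  refine graded_eq_bot_aux A hi hA hperf r R hR heq hlt R (fun _ _ y hy _ => hy) ?_
  refine iSup_le fun α v hv => ?_
  by_cases h0 : A α = ⊥
  · rw [h0, Submodule.mem_bot] at hv; rw [hv]; exact zero_mem _
  · exact LieSubalgebra.subset_lieSpan ⟨α, hR α h0, hv⟩

end Kreknin

section Laurent

variable {k : Type*} [Field k]

/-- The coefficient of `T n`. -/
def cf (n : ℤ) : k[T;T⁻¹] →ₗ[k] k where
  toFun f := f.coeff n
  map_add' _ _ := rfl
  map_smul' _ _ := rfl

theorem cf_T (n m : ℤ) : cf n (T m : k[T;T⁻¹]) = if m = n then 1 else 0 := T_apply _ _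

theorem laurent_ext {f g : k[T;T⁻¹]} (h : ∀ n, cf n f = cf n g) : f = g :=
  LaurentPolynomial.ext h

theorem laurent_ind {P : k[T;T⁻¹] → Prop} (f : k[T;T⁻¹]) (hT : ∀ (a : k) (n : ℤ), P (a • T n))
    (hadd : ∀ f g, P f → P g → P (f + g)) : P f :=
  LaurentPolynomial.induction_on' f hadd fun n a => by rw [← smul_eq_C_mul]; exact hT a n

/-- Linear maps out of the Laurent polynomials, prescribed on monomials. -/
def liftS {W : Type*} [AddCommGroup W] [Module k W] (g : ℤ → W) : k[T;T⁻¹] →ₗ[k] W where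
  toFun f := f.coeff.sum fun n a => a • g n
  map_add' f f' := Finsupp.sum_add_index' (M := k) (f := f.coeff) (g := f'.coeff)
    (h := fun n a => a • g n) (fun _ => zero_smul _ _) (fun _ _ _ => add_smul _ _ _)
  map_smul' a f := by
    have h : (a • f).coeff = a • f.coeff := rfl
    rw [h, RingHom.id_apply, Finsupp.sum_smul_index (h := fun n (a : k) => a • g n)
      (fun i => zero_smul _ _), Finsupp.smul_sum]
    simp only [mul_smul]

theorem liftS_T {W : Type*} [AddCommGroup W] [Module k W] (g : ℤ → W) (n : ℤ) :
    liftS (k := k) g (T n) = g n := by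
  change (Finsupp.single n (1 : k)).sum (fun n a => a • g n) = _
  simp

/-- The degree derivation. -/
def dS : k[T;T⁻¹] →ₗ[k] k[T;T⁻¹] := liftS fun n => (n : k) • T n

theorem dS_T (n : ℤ) : dS (T n : k[T;T⁻¹]) = (n : k) • T n := liftS_T _ _

theorem cf_dS (n : ℤ) (f : k[T;T⁻¹]) : cf n (dS f) = n * cf n f := by
  induction f using laurent_ind with
  | hT a p =>
    simp only [map_smul, dS_T, cf_T]
    by_cases h : p = n
    · simp [h]; ring
    · simp [h]
  | hadd f g hf hg => simp only [mul_add, map_add, hf, hg]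

end Laurent

/-- A model of the loop algebra `𝔤 ⊗ k[T;T⁻¹]`. -/
structure LoopModel (k 𝔤 V : Type*) [Field k] [LieRing 𝔤] [LieAlgebra k 𝔤] [LieRing V]
    [LieAlgebra k V] [LieAlgebra k[T;T⁻¹] V] [IsScalarTower k k[T;T⁻¹] V] where
  j : 𝔤 →ₗ[k] V
  j_lie : ∀ x y, j ⁅x, y⁆ = ⁅j x, j y⁆
  E : (ℤ →₀ 𝔤) ≃ₗ[k] V
  E_single : ∀ p y, E (Finsupp.single p y) = (T p : k[T;T⁻¹]) • j y
  I : Type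
  [fin : Fintype I]
  [dec : DecidableEq I]
  b : Module.Basis I k 𝔤
  b' : Module.Basis I k 𝔤
  dual : ∀ i i', killingForm k 𝔤 (b i) (b' i') = if i = i' then 1 else 0
  e : Module.Basis I k[T;T⁻¹] V
  he : ∀ i, e i = j (b i)
  killing : ∀ x y, killingForm k[T;T⁻¹] V (j x) (j y) = C (killingForm k 𝔤 x y)

attribute [instance] LoopModel.fin LoopModel.dec

namespace LoopModel

variable {k 𝔤 V : Type*} [Field k] [LieRing 𝔤] [LieAlgebra k 𝔤] [LieRing V]
    [LieAlgebra k V] [LieAlgebra k[T;T⁻¹] V] [IsScalarTower k k[T;T⁻¹] V] (M : LoopModel k 𝔤 V)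

/-- The monomial `y ⊗ sᵖ`. -/
def mon (p : ℤ) : 𝔤 →ₗ[k] V where
  toFun y := (T p : k[T;T⁻¹]) • M.j y
  map_add' := by simp
  map_smul' a y := by rw [map_smul, RingHom.id_apply, smul_comm]

theorem mon_apply (p : ℤ) (y : 𝔤) : M.mon p y = (T p : k[T;T⁻¹]) • M.j y := rfl

theorem ind {P : V → Prop} (v : V) (hmon : ∀ p y, P (M.mon p y))
    (hadd : ∀ v w, P v → P w → P (v + w)) : P v := by
  obtain ⟨f, rfl⟩ := M.E.surjective v
  induction f using Finsupp.induction_linear with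
  | zero => simpa using hmon 0 0
  | add f g hf hg => rw [map_add]; exact hadd _ _ hf hg
  | single p y => rw [M.E_single]; exact hmon p y

/-- Linear maps prescribed on monomials. -/
def lift {W : Type*} [AddCommGroup W] [Module k W] (g : ℤ → 𝔤 →ₗ[k] W) : V →ₗ[k] W :=
  (Finsupp.lsum k g) ∘ₗ M.E.symm.toLinearMap

theorem E_symm_mon (p : ℤ) (y : 𝔤) : M.E.symm (M.mon p y) = Finsupp.single p y := by
  rw [LinearEquiv.symm_apply_eq, M.E_single]; rfl

theorem lift_mon {W : Type*} [AddCommGroup W] [Module k W] (g : ℤ → 𝔤 →ₗ[k] W) (p : ℤ) (y : 𝔤) :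
    M.lift g (M.mon p y) = g p y := by
  simp [lift, M.E_symm_mon]

/-- The coefficient of `sᵖ`. -/
def coef (p : ℤ) : V →ₗ[k] 𝔤 := Finsupp.lapply p ∘ₗ M.E.symm.toLinearMap

theorem coef_mon (p q : ℤ) (y : 𝔤) : M.coef p (M.mon q y) = if q = p then y else 0 := by
  simp [coef, M.E_symm_mon, Finsupp.single_apply]

theorem coef_ext {v w : V} (h : ∀ p, M.coef p v = M.coef p w) : v = w :=
  M.E.symm.injective (Finsupp.ext h)

theorem coef_finite (v : V) : ∃ s : Finset ℤ, ∀ p ∉ s, M.coef p v = 0 :=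
  ⟨(M.E.symm v).support, fun p hp => by simpa [coef] using hp⟩

theorem T_smul_mon (n p : ℤ) (y : 𝔤) : (T n : k[T;T⁻¹]) • M.mon p y = M.mon (n + p) y := by
  rw [mon_apply, mon_apply, smul_smul, ← T_add]

theorem mon_lie (p q : ℤ) (x y : 𝔤) : ⁅M.mon p x, M.mon q y⁆ = M.mon (p + q) ⁅x, y⁆ := by
  simp only [mon_apply, smul_lie, lie_smul, smul_smul, T_add, M.j_lie, mul_comm]

/-- The degree derivation. -/
def d : Module.End k V := M.lift fun p => (p : k) • M.mon p

theorem d_mon (p : ℤ) (y : 𝔤) : M.d (M.mon p y) = (p : k) • M.mon p y := M.lift_mon _ _ _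

theorem d_lie (v w : V) : M.d ⁅v, w⁆ = ⁅M.d v, w⁆ + ⁅v, M.d w⁆ := by
  induction v using M.ind with
  | hmon p x =>
    induction w using M.ind with
    | hmon q y =>
      simp only [mon_lie, d_mon, smul_lie, lie_smul, ← add_smul]
      push_cast
      rfl
    | hadd v w hv hw => simp only [lie_add, map_add, hv, hw]; abel
  | hadd v w hv hw => simp only [add_lie, map_add, hv, hw]; abel

theorem d_smul (f : k[T;T⁻¹]) (v : V) : M.d (f • v) = dS f • v + f • M.d v := by
  induction f using laurent_ind with
  | hT a n =>
    induction v using M.ind with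
    | hmon p y =>
      simp only [smul_assoc, map_smul, dS_T, T_smul_mon, d_mon, ← smul_add, ← add_smul,
        smul_comm (T n : k[T;T⁻¹])]
      push_cast
      rfl
    | hadd v w hv hw => simp only [smul_add, map_add, hv, hw]; abel
  | hadd f g hf hg => simp only [add_smul, map_add, hf, hg]; abel

theorem d_T_smul (n : ℤ) (v : V) :
    M.d ((T n : k[T;T⁻¹]) • v) = (T n : k[T;T⁻¹]) • M.d v + (n : k) • (T n : k[T;T⁻¹]) • v := by
  rw [d_smul, dS_T, smul_assoc, add_comm]

theorem coef_d (p : ℤ) (v : V) : M.coef p (M.d v) = (p : k) • M.coef p v := by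
  induction v using M.ind with
  | hmon q y =>
    rw [d_mon, map_smul, coef_mon]
    split_ifs with h <;> simp [h]
  | hadd v w hv hw => simp only [smul_add, map_add, hv, hw]

/-- The Killing form over the Laurent polynomials. -/
abbrev κ (_ : LoopModel k 𝔤 V) : LinearMap.BilinForm k[T;T⁻¹] V := killingForm k[T;T⁻¹] V

theorem κ_mon (p q : ℤ) (x y : 𝔤) :
    M.κ (M.mon p x) (M.mon q y) = killingForm k 𝔤 x y • T (p + q) := by
  simp only [mon_apply, map_smul, LinearMap.smul_apply, M.killing, smul_eq_mul, T_add,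
    smul_eq_C_mul]
  ring

theorem κ_comm (v w : V) : M.κ v w = M.κ w v := LieModule.traceForm_comm _ _ _ _ _

theorem κ_lie (u v w : V) : M.κ ⁅u, v⁆ w = M.κ u ⁅v, w⁆ :=
  LieModule.traceForm_apply_lie_apply _ _ _ _ _ _

theorem κ_ksmul_left (a : k) (v w : V) : M.κ (a • v) w = a • M.κ v w := by
  rw [← algebraMap_smul k[T;T⁻¹] a v, map_smul, LinearMap.smul_apply, algebraMap_smul]

theorem κ_ksmul_right (a : k) (v w : V) : M.κ v (a • w) = a • M.κ v w := by
  rw [← algebraMap_smul k[T;T⁻¹] a w, map_smul, algebraMap_smul]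

theorem dS_κ (v w : V) : dS (M.κ v w) = M.κ (M.d v) w + M.κ v (M.d w) := by
  induction v using M.ind with
  | hmon p x =>
    induction w using M.ind with
    | hmon q y =>
      rw [d_mon, d_mon, κ_ksmul_left, κ_ksmul_right, κ_mon, map_smul, dS_T, ← add_smul, smul_comm]
      push_cast
      rfl
    | hadd v w hv hw => simp only [map_add, hv, hw]; abel
  | hadd v w hv hw => simp only [map_add, LinearMap.add_apply, hv, hw]; abel

theorem coord_eq (i : M.I) (v : V) : M.e.coord i v = M.κ v (M.j (M.b' i)) := by
  have : M.e.coord i = (M.κ).flip (M.j (M.b' i)) := by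
    refine M.e.ext fun i' => ?_
    change M.e.coord i (M.e i') = M.κ (M.e i') (M.j (M.b' i))
    rw [Module.Basis.coord_apply, Module.Basis.repr_self,
      Finsupp.single_apply, M.he, M.killing, M.dual]
    split_ifs <;> simp
  rw [this]; rfl

theorem sum_eq (v : V) : ∑ i, M.κ v (M.j (M.b' i)) • M.j (M.b i) = v := by
  simp_rw [← coord_eq, ← M.he]
  exact M.e.sum_repr v

theorem κ_nondeg {v : V} (h : ∀ w, M.κ v w = 0) : v = 0 := by
  rw [← M.sum_eq v]; simp [h]

theorem finite (M : LoopModel k 𝔤 V) : Module.Finite k[T;T⁻¹] V := Module.Finite.of_basis M.e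
/-- The trace of `S`-linear endomorphisms. -/
abbrev tr (_ : LoopModel k 𝔤 V) : Module.End k[T;T⁻¹] V →ₗ[k[T;T⁻¹]] k[T;T⁻¹] :=
  LinearMap.trace k[T;T⁻¹] V

/-- The inner derivations. -/
abbrev ad (_ : LoopModel k 𝔤 V) (v : V) : Module.End k[T;T⁻¹] V := LieAlgebra.ad k[T;T⁻¹] V v

theorem κ_eq (v w : V) : M.κ v w = M.tr (M.ad v * M.ad w) := killingForm_apply_apply ..

theorem tr_eq (ρ : Module.End k[T;T⁻¹] V) :
    M.tr ρ = ∑ i, M.κ (ρ (M.j (M.b i))) (M.j (M.b' i)) := by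
  rw [tr, LinearMap.trace_eq_matrix_trace _ M.e, Matrix.trace]
  refine Finset.sum_congr rfl fun i _ => ?_
  rw [Matrix.diag_apply, LinearMap.toMatrix_apply, ← M.coord_eq, M.he]
  rfl

/-- The orthogonal projection onto inner derivations. -/
def pr (ρ : Module.End k[T;T⁻¹] V) : V := ∑ i, M.tr (ρ * M.ad (M.j (M.b i))) • M.j (M.b' i)

theorem κ_pr (ρ : Module.End k[T;T⁻¹] V) (w : V) : M.κ (M.pr ρ) w = M.tr (ρ * M.ad w) := by
  conv_rhs => rw [← M.sum_eq w]
  simp only [pr, map_sum, map_smul, LinearMap.sum_apply, LinearMap.smul_apply, Finset.mul_sum,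
    mul_smul_comm, smul_eq_mul]
  refine Finset.sum_congr rfl fun i _ => ?_
  rw [M.κ_comm w, mul_comm]

theorem pr_add (ρ ρ' : Module.End k[T;T⁻¹] V) : M.pr (ρ + ρ') = M.pr ρ + M.pr ρ' := by
  simp only [pr, add_mul, map_add, add_smul, Finset.sum_add_distrib]

theorem eq_ad_pr (ρ : Module.End k[T;T⁻¹] V) (hρ : ∀ v w, ρ ⁅v, w⁆ = ⁅ρ v, w⁆ + ⁅v, ρ w⁆) (v : V) :
    ρ v = ⁅M.pr ρ, v⁆ := by
  set ρ' := ρ - M.ad (M.pr ρ) with hρ'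
  have h1 : ∀ w, M.tr (ρ' * M.ad w) = 0 := by
    intro w
    rw [hρ', sub_mul, map_sub, ← κ_pr, ← κ_eq, sub_self]
  have h2 : ∀ v, M.ad (ρ' v) = ρ' * M.ad v - M.ad v * ρ' := by
    intro v
    ext w
    simp only [hρ', LinearMap.sub_apply, LieAlgebra.ad_apply, Module.End.mul_apply, hρ, lie_sub,
      sub_lie, lie_lie]
    abel
  rw [← sub_eq_zero]
  refine M.κ_nondeg (v := ρ' v) fun w => ?_
  have h3 : M.ad ⁅v, w⁆ = M.ad v * M.ad w - M.ad w * M.ad v := by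
    ext u; simp
  have h4 := h1 ⁅v, w⁆
  rw [h3, mul_sub, map_sub, ← mul_assoc, ← mul_assoc] at h4
  rw [κ_eq, h2, sub_mul, map_sub, ← h4]
  congr 1
  rw [mul_assoc, LinearMap.trace_mul_comm]

theorem center_eq (M : LoopModel k 𝔤 V) {v : V} (h : ∀ w : V, ⁅v, w⁆ = 0) : v = 0 := by
  refine M.κ_nondeg fun w => ?_
  have : M.ad v = 0 := by ext w; exact h w
  rw [κ_eq, this, zero_mul, map_zero]

end LoopModel

theorem sum_primitiveRoot_zpow {k : Type*} [Field k] {ζ : k} {m : ℕ} (hζ : IsPrimitiveRoot ζ m)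
    (n : ℤ) : ∑ i ∈ Finset.range m, (ζ ^ n) ^ i = if (m : ℤ) ∣ n then (m : k) else 0 := by
  split_ifs with h
  · simp [(hζ.zpow_eq_one_iff_dvd n).2 h]
  · have h1 : ζ ^ n ≠ 1 := fun h' => h ((hζ.zpow_eq_one_iff_dvd n).1 h')
    have h2 : (ζ ^ n) ^ m = 1 := by
      rw [← zpow_natCast, ← zpow_mul, mul_comm, zpow_mul, zpow_natCast, hζ.pow_eq_one, one_zpow]
    have h3 := geom_sum_mul (ζ ^ n) m
    rw [h2, sub_self] at h3
    exact (mul_eq_zero.1 h3).resolve_right (sub_ne_zero.2 h1)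

/-- An automorphism of `𝔤` of period `m`, with a primitive `m`-th root of unity. -/
structure Twist (k 𝔤 : Type*) [Field k] [LieRing 𝔤] [LieAlgebra k 𝔤] where
  m : ℕ
  hm : 0 < m
  σ : 𝔤 ≃ₗ⁅k⁆ 𝔤
  hσ : ∀ y, (⇑σ)^[m] y = y
  ζ : k
  hζ : IsPrimitiveRoot ζ m

namespace Twist

variable {k 𝔤 V : Type*} [Field k] [LieRing 𝔤] [LieAlgebra k 𝔤] [LieRing V]
    [LieAlgebra k V] [LieAlgebra k[T;T⁻¹] V] [IsScalarTower k k[T;T⁻¹] V] (τ : Twist k 𝔤)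
    (M : LoopModel k 𝔤 V)

theorem ζ_ne : τ.ζ ≠ 0 := τ.hζ.ne_zero τ.hm.ne'

/-- The automorphism of the loop algebra whose fixed points form the twisted loop algebra. -/
def Sg : Module.End k V := M.lift fun p => (τ.ζ ^ (-p)) • (M.mon p ∘ₗ (τ.σ : 𝔤 →ₗ[k] 𝔤))

theorem Sg_mon (p : ℤ) (y : 𝔤) : τ.Sg M (M.mon p y) = τ.ζ ^ (-p) • M.mon p (τ.σ y) :=
  M.lift_mon _ _ _

theorem Sg_lie (v w : V) : τ.Sg M ⁅v, w⁆ = ⁅τ.Sg M v, τ.Sg M w⁆ := by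
  induction v using M.ind with
  | hmon p x =>
    induction w using M.ind with
    | hmon q y =>
      simp only [M.mon_lie, Sg_mon, smul_lie, lie_smul, smul_smul, LieEquiv.map_lie,
        ← zpow_add₀ τ.ζ_ne]
      congr 2; ring
    | hadd v w hv hw => simp only [lie_add, map_add, hv, hw]
  | hadd v w hv hw => simp only [add_lie, map_add, hv, hw]

theorem Sg_T (n : ℤ) (v : V) :
    τ.Sg M ((T n : k[T;T⁻¹]) • v) = τ.ζ ^ (-n) • (T n : k[T;T⁻¹]) • τ.Sg M v := by
  induction v using M.ind with
  | hmon p x =>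
    rw [M.T_smul_mon, Sg_mon, Sg_mon, smul_comm (T n : k[T;T⁻¹]), M.T_smul_mon, smul_smul,
      ← zpow_add₀ τ.ζ_ne]
    congr 2; ring
  | hadd v w hv hw => simp only [smul_add, map_add, hv, hw]

theorem Sg_d (v : V) : τ.Sg M (M.d v) = M.d (τ.Sg M v) := by
  induction v using M.ind with
  | hmon p x => simp only [M.d_mon, map_smul, Sg_mon]; rw [smul_comm]
  | hadd v w hv hw => simp only [map_add, hv, hw]

theorem Sg_pow_mon (i : ℕ) (p : ℤ) (y : 𝔤) :
    (τ.Sg M ^ i) (M.mon p y) = (τ.ζ ^ (-p)) ^ i • M.mon p ((⇑τ.σ)^[i] y) := by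
  induction i with
  | zero => simp
  | succ i ih =>
    rw [pow_succ', Module.End.mul_apply, ih, map_smul, Sg_mon, smul_smul, pow_succ,
      Function.iterate_succ_apply']

theorem Sg_pow_m (v : V) : (τ.Sg M ^ τ.m) v = v := by
  induction v using M.ind with
  | hmon p x =>
    rw [Sg_pow_mon, τ.hσ, ← zpow_natCast, ← zpow_mul, mul_comm, zpow_mul, zpow_natCast,
      τ.hζ.pow_eq_one, one_zpow, one_smul]
  | hadd v w hv hw => simp only [map_add, hv, hw]

theorem Sg_pow_T (i : ℕ) (n : ℤ) (v : V) :
    (τ.Sg M ^ i) ((T n : k[T;T⁻¹]) • v) =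
      (τ.ζ ^ (-n)) ^ i • (T n : k[T;T⁻¹]) • (τ.Sg M ^ i) v := by
  induction i with
  | zero => simp
  | succ i ih =>
    rw [pow_succ', Module.End.mul_apply, ih, map_smul, Sg_T, smul_smul, pow_succ,
      Module.End.mul_apply]

/-- The induced automorphism of the Laurent polynomials. -/
def SgS : k[T;T⁻¹] →ₗ[k] k[T;T⁻¹] := liftS fun n => τ.ζ ^ (-n) • T n

theorem cf_SgS (n : ℤ) (f : k[T;T⁻¹]) : cf n (τ.SgS f) = τ.ζ ^ (-n) * cf n f := by
  induction f using laurent_ind with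
  | hT a p =>
    simp only [map_smul, SgS, liftS_T, cf_T]
    by_cases h : p = n
    · simp [h]; ring
    · simp [h]
  | hadd f g hf hg => simp only [mul_add, map_add, hf, hg]

theorem κ_Sg (v w : V) : M.κ (τ.Sg M v) (τ.Sg M w) = τ.SgS (M.κ v w) := by
  induction v using M.ind with
  | hmon p x =>
    induction w using M.ind with
    | hmon q y =>
      rw [Sg_mon, Sg_mon, M.κ_ksmul_left, M.κ_ksmul_right, M.κ_mon, M.κ_mon, map_smul, SgS,
        liftS_T, LieAlgebra.killingForm_of_equiv_apply, smul_smul, smul_comm, smul_smul, smul_smul,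
        ← zpow_add₀ τ.ζ_ne]
      congr 3; ring
    | hadd v w hv hw => simp only [map_add, hv, hw]
  | hadd v w hv hw => simp only [map_add, LinearMap.add_apply, hv, hw]

/-- The twisted loop algebra. -/
def L : Submodule k V := LinearMap.eqLocus (τ.Sg M) LinearMap.id

theorem mem_L {v : V} : v ∈ τ.L M ↔ τ.Sg M v = v := Iff.rfl

theorem lie_mem_L {v w : V} (hv : v ∈ τ.L M) (hw : w ∈ τ.L M) : ⁅v, w⁆ ∈ τ.L M := by
  rw [mem_L, Sg_lie, hv, hw]; rfl

theorem d_mem_L {v : V} (hv : v ∈ τ.L M) : M.d v ∈ τ.L M := by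
  rw [mem_L, Sg_d, hv]; rfl

theorem T_mem_L {v : V} (hv : v ∈ τ.L M) (n : ℤ) (hn : (τ.m : ℤ) ∣ n) :
    (T n : k[T;T⁻¹]) • v ∈ τ.L M := by
  rw [mem_L, Sg_T, hv, (τ.hζ.zpow_eq_one_iff_dvd _).2 (by simpa using hn), one_smul]; rfl

theorem mon_mem_L {p : ℤ} {y : 𝔤} (h : τ.σ y = τ.ζ ^ p • y) : M.mon p y ∈ τ.L M := by
  rw [mem_L, Sg_mon, h, map_smul, smul_smul, ← zpow_add₀ τ.ζ_ne]; simp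

theorem σ_coef {v : V} (hv : v ∈ τ.L M) (p : ℤ) :
    τ.σ (M.coef p v) = τ.ζ ^ p • M.coef p v := by
  have h : ∀ v, M.coef p (τ.Sg M v) = τ.ζ ^ (-p) • τ.σ (M.coef p v) := by
    intro v
    induction v using M.ind with
    | hmon q x =>
      rw [Sg_mon, map_smul, M.coef_mon, M.coef_mon]
      by_cases h : q = p <;> simp [h]
    | hadd v w hv hw => simp only [map_add, hv, hw, smul_add]
  have := h v
  rw [τ.mem_L M |>.1 hv] at this
  conv_rhs => rw [this, smul_smul, ← zpow_add₀ τ.ζ_ne]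
  simp

/-- The projection onto the twisted loop algebra. -/
def av : Module.End k V := (τ.m : k)⁻¹ • ∑ i ∈ Finset.range τ.m, τ.Sg M ^ i

theorem av_apply (v : V) : τ.av M v = (τ.m : k)⁻¹ • ∑ i ∈ Finset.range τ.m, (τ.Sg M ^ i) v := by
  simp [av]

theorem av_mem (v : V) : τ.av M v ∈ τ.L M := by
  rw [mem_L, av_apply, map_smul, map_sum]
  congr 1
  have h1 := Finset.sum_range_succ (fun i => (τ.Sg M ^ i) v) τ.m
  have h2 := Finset.sum_range_succ' (fun i => (τ.Sg M ^ i) v) τ.m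
  rw [h1, Sg_pow_m, pow_zero, Module.End.one_apply, add_left_inj] at h2
  rw [h2]
  refine Finset.sum_congr rfl fun i _ => ?_
  rw [pow_succ', Module.End.mul_apply]

theorem Sg_pow_of_mem {v : V} (hv : v ∈ τ.L M) (i : ℕ) : (τ.Sg M ^ i) v = v := by
  induction i with
  | zero => rfl
  | succ i ih => rw [pow_succ', Module.End.mul_apply, ih, hv]; rfl

theorem av_commute {f : Module.End k V} (hf : ∀ v, f (τ.Sg M v) = τ.Sg M (f v)) (v : V) :
    f (τ.av M v) = τ.av M (f v) := by
  rw [av_apply, av_apply, map_smul, map_sum]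
  congr 1
  refine Finset.sum_congr rfl fun i hi => ?_
  clear hi
  induction i with
  | zero => rfl
  | succ i ih => rw [pow_succ', Module.End.mul_apply, Module.End.mul_apply, hf, ih]

variable [CharZero k]

theorem m_ne : (τ.m : k) ≠ 0 := Nat.cast_ne_zero.2 τ.hm.ne'

theorem av_T {v : V} (hv : v ∈ τ.L M) (n : ℤ) :
    τ.av M ((T n : k[T;T⁻¹]) • v) = if (τ.m : ℤ) ∣ n then (T n : k[T;T⁻¹]) • v else 0 := by
  rw [av_apply]
  simp only [Sg_pow_T, τ.Sg_pow_of_mem M hv]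
  rw [← Finset.sum_smul, sum_primitiveRoot_zpow τ.hζ, smul_smul]
  simp only [dvd_neg]
  split_ifs
  · rw [inv_mul_cancel₀ τ.m_ne, one_smul]
  · simp

theorem av_of_mem {v : V} (hv : v ∈ τ.L M) : τ.av M v = v := by
  simpa using τ.av_T M hv 0

theorem sum_T_av (v : V) :
    ∑ n ∈ Finset.range τ.m, (T (n : ℤ) : k[T;T⁻¹]) • τ.av M ((T (-n : ℤ) : k[T;T⁻¹]) • v) = v := by
  simp only [av_apply, Sg_pow_T, neg_neg]
  simp only [smul_comm _ ((τ.m : k)⁻¹), ← Finset.smul_sum]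
  simp only [Finset.smul_sum (r := (T _ : k[T;T⁻¹])), smul_comm (T _ : k[T;T⁻¹]) (_ : k), smul_smul,
    ← T_add]
  rw [Finset.sum_comm]
  simp only [add_neg_cancel, T_zero, one_smul, ← Finset.sum_smul]
  have : ∀ i ∈ Finset.range τ.m, ∑ n ∈ Finset.range τ.m, (τ.ζ ^ (n : ℤ)) ^ i =
      if i = 0 then (τ.m : k) else 0 := by
    intro i hi
    have h := sum_primitiveRoot_zpow τ.hζ i
    simp only [zpow_natCast, ← pow_mul, mul_comm i] at h ⊢
    rw [h]
    congr 1
    simp only [eq_iff_iff, Int.natCast_dvd_natCast]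
    refine ⟨fun h => ?_, fun h => h ▸ dvd_zero _⟩
    by_contra h0
    exact absurd (Nat.le_of_dvd (Nat.pos_of_ne_zero h0) h) (by simpa using hi)
  rw [Finset.sum_congr rfl fun i hi => by rw [this i hi]]
  simp [τ.hm.ne', τ.m_ne]

/-- Induction along the spanning family `T n • v`, `v` in the twisted loop algebra. -/
theorem ind_L {P : V → Prop} (v : V) (hT : ∀ (n : ℤ) (v : V), v ∈ τ.L M → P ((T n : k[T;T⁻¹]) • v))
    (hadd : ∀ v w, P v → P w → P (v + w)) : P v := by
  rw [← τ.sum_T_av M v]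
  refine Finset.sum_induction _ P hadd ?_ fun n _ => hT _ _ (τ.av_mem M _)
  simpa using hT 0 0 (Submodule.zero_mem _)

end Twist

theorem span_lie_eq_top (k : Type*) {𝔤 : Type*} [Field k] [LieRing 𝔤] [LieAlgebra k 𝔤]
    [LieAlgebra.IsSimple k 𝔤] : Submodule.span k {z : 𝔤 | ∃ x y : 𝔤, ⁅x, y⁆ = z} = ⊤ := by
  have h := LieSubmodule.lieIdeal_oper_eq_linear_span' (R := k) (⊤ : LieIdeal k 𝔤)
    (⊤ : LieIdeal k 𝔤)
  rcases LieAlgebra.IsSimple.eq_bot_or_eq_top (R := k) ⁅(⊤ : LieIdeal k 𝔤), (⊤ : LieIdeal k 𝔤)⁆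
    with h0 | h0
  · refine absurd ?_ (LieAlgebra.IsSimple.non_abelian (R := k) (L := 𝔤))
    refine ⟨fun x y => ?_⟩
    have : ⁅x, y⁆ ∈ ⁅(⊤ : LieIdeal k 𝔤), (⊤ : LieIdeal k 𝔤)⁆ :=
      LieSubmodule.lie_mem_lie trivial trivial
    rw [h0] at this
    simpa using this
  · rw [h0] at h
    simpa using h.symm

theorem nontrivial_of_isSimple (k : Type*) (𝔤 : Type*) [Field k] [LieRing 𝔤] [LieAlgebra k 𝔤]
    [LieAlgebra.IsSimple k 𝔤] : Nontrivial 𝔤 := by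
  by_contra h
  rw [not_nontrivial_iff_subsingleton] at h
  exact LieAlgebra.IsSimple.non_abelian (R := k) (L := 𝔤) ⟨fun x y => Subsingleton.elim _ _⟩

namespace LoopModel

variable {k 𝔤 V : Type*} [Field k] [LieRing 𝔤] [LieAlgebra k 𝔤] [LieRing V]
    [LieAlgebra k V] [LieAlgebra k[T;T⁻¹] V] [IsScalarTower k k[T;T⁻¹] V] (M : LoopModel k 𝔤 V)

/-- The derivation `d + ad Y`. -/
def Dg (Y : V) : Module.End k V := M.d + LieAlgebra.ad k V Y

theorem Dg_apply (Y v : V) : M.Dg Y v = M.d v + ⁅Y, v⁆ := rfl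

theorem Dg_lie (Y v w : V) : M.Dg Y ⁅v, w⁆ = ⁅M.Dg Y v, w⁆ + ⁅v, M.Dg Y w⁆ := by
  simp only [Dg_apply, M.d_lie, add_lie, lie_add, leibniz_lie Y v w]; abel

theorem Dg_T (Y : V) (n : ℤ) (v : V) : M.Dg Y ((T n : k[T;T⁻¹]) • v) =
    (T n : k[T;T⁻¹]) • M.Dg Y v + (n : k) • (T n : k[T;T⁻¹]) • v := by
  simp only [Dg_apply, M.d_T_smul, lie_smul, smul_add]; abel

theorem Dg_T_eigen {Y v : V} {α : k} (h : M.Dg Y v = α • v) (n : ℤ) :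
    M.Dg Y ((T n : k[T;T⁻¹]) • v) = (α + n) • (T n : k[T;T⁻¹]) • v := by
  rw [Dg_T, h, smul_comm, add_smul]

theorem Dg_κ (Y v w : V) : M.κ (M.Dg Y v) w + M.κ v (M.Dg Y w) = dS (M.κ v w) := by
  rw [M.dS_κ, Dg_apply, Dg_apply, map_add, map_add, LinearMap.add_apply, ← lie_skew Y v, map_neg,
    LinearMap.neg_apply, M.κ_lie]
  abel

/-- Evaluation at `s = 1`. -/
def ev : V →ₗ[k] 𝔤 := M.lift fun _ => LinearMap.id

theorem ev_mon (p : ℤ) (y : 𝔤) : M.ev (M.mon p y) = y := M.lift_mon _ _ _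

theorem ev_lie (v w : V) : M.ev ⁅v, w⁆ = ⁅M.ev v, M.ev w⁆ := by
  induction v using M.ind with
  | hmon p x =>
    induction w using M.ind with
    | hmon q y => simp only [M.mon_lie, ev_mon]
    | hadd v w hv hw => simp only [lie_add, map_add, hv, hw]
  | hadd v w hv hw => simp only [add_lie, map_add, hv, hw]

theorem killing_ev (v w : V) :
    killingForm k 𝔤 (M.ev v) (M.ev w) = liftS (fun _ => (1 : k)) (M.κ v w) := by
  induction v using M.ind with
  | hmon p x =>
    induction w using M.ind with
    | hmon q y => simp [ev_mon, M.κ_mon, liftS_T]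
    | hadd v w hv hw => simp only [map_add, hv, hw]
  | hadd v w hv hw => simp only [map_add, LinearMap.add_apply, hv, hw]

theorem ev_pow (y : V) (n : ℕ) (v : V) :
    M.ev ((LieAlgebra.ad k V y ^ n) v) = (LieAlgebra.ad k 𝔤 (M.ev y) ^ n) (M.ev v) := by
  induction n with
  | zero => rfl
  | succ n ih =>
    rw [pow_succ', pow_succ', Module.End.mul_apply, Module.End.mul_apply, ← ih, LieAlgebra.ad_apply,
      LieAlgebra.ad_apply, ev_lie]

end LoopModel

namespace Twist

variable {k 𝔤 V : Type*} [Field k] [LieRing 𝔤] [LieAlgebra k 𝔤] [LieRing V]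
    [LieAlgebra k V] [LieAlgebra k[T;T⁻¹] V] [IsScalarTower k k[T;T⁻¹] V] (τ : Twist k 𝔤)
    (M : LoopModel k 𝔤 V)

theorem Dg_Sg {Y : V} (hY : Y ∈ τ.L M) (v : V) : M.Dg Y (τ.Sg M v) = τ.Sg M (M.Dg Y v) := by
  rw [M.Dg_apply, M.Dg_apply, map_add, τ.Sg_d, τ.Sg_lie, (τ.mem_L M).1 hY]

theorem ad_Sg {Y : V} (hY : Y ∈ τ.L M) (v : V) : ⁅Y, τ.Sg M v⁆ = τ.Sg M ⁅Y, v⁆ := by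
  rw [τ.Sg_lie, (τ.mem_L M).1 hY]

theorem Dg_mem_L {Y : V} (hY : Y ∈ τ.L M) {v : V} (hv : v ∈ τ.L M) : M.Dg Y v ∈ τ.L M :=
  add_mem (τ.d_mem_L M hv) (τ.lie_mem_L M hY hv)

variable [CharZero k]

theorem diag_of_le {f : Module.End k V} (h : τ.L M ≤ ⨆ α, τ.L M ⊓ f.eigenspace α) (ε : k)
    (hf : ∀ (n : ℤ) (v : V), f ((T n : k[T;T⁻¹]) • v) =
      (T n : k[T;T⁻¹]) • f v + (n * ε) • (T n : k[T;T⁻¹]) • v) :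
    ⨆ α, f.eigenspace α = ⊤ := by
  rw [eq_top_iff]
  rintro v -
  induction v using τ.ind_L M with
  | hT n v hv =>
    have := h hv
    clear hv
    induction this using Submodule.iSup_induction' with
    | mem α v hv =>
      refine Submodule.mem_iSup_of_mem (α + n * ε) (Module.End.mem_eigenspace_iff.2 ?_)
      rw [hf, Module.End.mem_eigenspace_iff.1 hv.2, smul_comm, add_smul]
    | zero => simp
    | add v w _ _ hv hw => rw [smul_add]; exact add_mem hv hw
  | hadd v w hv hw => exact add_mem hv hw

theorem L_le_span_lie [LieAlgebra.IsSimple k 𝔤] :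
    τ.L M ≤ Submodule.span k {z | ∃ x ∈ τ.L M, ∃ y ∈ τ.L M, ⁅x, y⁆ = z} := by
  intro v hv
  rw [← τ.av_of_mem M hv]
  clear hv
  induction v using M.ind with
  | hmon p y =>
    have : y ∈ Submodule.span k {z : 𝔤 | ∃ x y : 𝔤, ⁅x, y⁆ = z} := by
      rw [span_lie_eq_top]; trivial
    induction this using Submodule.span_induction with
    | mem z h =>
      obtain ⟨x, y, rfl⟩ := h
      have h1 : M.mon p ⁅x, y⁆ = ⁅M.mon p x, M.mon 0 y⁆ := by rw [M.mon_lie, add_zero]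
      rw [h1]
      generalize M.mon p x = v
      generalize M.mon 0 y = w
      induction v using τ.ind_L M with
      | hT a v hv =>
        induction w using τ.ind_L M with
        | hT b w hw =>
          rw [smul_lie, lie_smul, smul_smul, ← T_add, τ.av_T M (τ.lie_mem_L M hv hw)]
          split_ifs with h
          · exact Submodule.subset_span ⟨_, τ.T_mem_L M hv _ h, w, hw, by rw [smul_lie]⟩
          · exact zero_mem _
        | hadd v w hv hw => simp only [lie_add, map_add]; exact add_mem hv hw
      | hadd v w hv hw => simp only [add_lie, map_add]; exact add_mem hv hw
    | zero => simp
    | add x y _ _ hx hy => simp only [map_add]; exact add_mem hx hy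
    | smul a x _ hx => simp only [map_smul]; exact Submodule.smul_mem _ _ hx
  | hadd v w hv hw => simp only [map_add]; exact add_mem hv hw

theorem L_ne_bot [Nontrivial 𝔤] : τ.L M ≠ ⊥ := by
  intro h
  obtain ⟨y, hy⟩ := exists_ne (0 : 𝔤)
  apply hy
  have h1 : M.mon 0 y = 0 := by
    generalize M.mon 0 y = v
    induction v using τ.ind_L M with
    | hT n v hv => rw [h, Submodule.mem_bot] at hv; rw [hv, smul_zero]
    | hadd v w hv hw => rw [hv, hw, add_zero]
  rw [← M.ev_mon 0 y, h1, map_zero]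

end Twist

theorem toIcoMod_sub_of_lt {p a b : ℝ} (hp : 0 < p) (h : toIcoMod hp 0 a < toIcoMod hp 0 b) :
    toIcoMod hp 0 (a - b) = toIcoMod hp 0 a - toIcoMod hp 0 b + p := by
  rw [toIcoMod_eq_iff]
  have h1 := toIcoMod_mem_Ico' hp a
  have h2 := toIcoMod_mem_Ico' hp b
  refine ⟨⟨by linarith [h1.1, h2.2], by linarith⟩, toIcoDiv hp 0 a - toIcoDiv hp 0 b - 1, ?_⟩
  have h3 := toIcoMod_add_toIcoDiv_zsmul hp 0 a
  have h4 := toIcoMod_add_toIcoDiv_zsmul hp 0 b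
  simp only [zsmul_eq_mul] at h3 h4 ⊢
  push_cast
  linear_combination h4 - h3

namespace Twist

variable {k 𝔤 V : Type*} [Field k] [LieRing 𝔤] [LieAlgebra k 𝔤] [LieRing V]
    [LieAlgebra k V] [LieAlgebra k[T;T⁻¹] V] [IsScalarTower k k[T;T⁻¹] V] (τ : Twist k 𝔤)
    (M : LoopModel k 𝔤 V)

theorem eigenspace_le {Y : V} (hD : ⨆ α, (M.Dg Y).eigenspace α = ⊤) {J : Type*} (x : J → V)
    (γ : J → k) (hx : ∀ j, M.Dg Y (x j) = γ j • x j)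
    (hspan : Submodule.span k (Set.range x) = ⊤) (α : k) :
    (M.Dg Y).eigenspace α ≤ Submodule.span k (x '' {j | γ j = α}) := by
  obtain ⟨P, hP⟩ := exists_isProj (M.Dg Y).eigenspaces_iSupIndep hD
  exact hP.le_span x γ (fun j => Module.End.mem_eigenspace_iff.2 (hx j)) hspan α

variable [CharZero k]

theorem exists_generators {Y : V} (hY : Y ∈ τ.L M) (hD : ⨆ α, (M.Dg Y).eigenspace α = ⊤) :
    ∃ (s : Finset V) (β : V → k), (∀ v ∈ s, v ∈ τ.L M ∧ M.Dg Y v = β v • v) ∧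
      Submodule.span k (Set.range fun x : s × ℤ => (T x.2 : k[T;T⁻¹]) • (x.1 : V)) = ⊤ := by
  classical
  have h1 : Submodule.span k[T;T⁻¹] {v : V | v ∈ τ.L M ∧ ∃ β : k, M.Dg Y v = β • v} = ⊤ := by
    rw [eq_top_iff]
    rintro v -
    induction v using τ.ind_L M with
    | hT n v hv =>
      refine Submodule.smul_mem _ _ ?_
      have := le_iSup_inf_eigenspace (M.Dg Y) hD (τ.L M) (fun v hv => τ.Dg_mem_L M hY hv) hv
      clear hv
      induction this using Submodule.iSup_induction' with
      | mem α v hv =>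
        exact Submodule.subset_span ⟨hv.1, α, Module.End.mem_eigenspace_iff.1 hv.2⟩
      | zero => exact zero_mem _
      | add v w _ _ hv hw => exact add_mem hv hw
    | hadd v w hv hw => exact add_mem hv hw
  have := M.finite
  have h2 : (Submodule.span k[T;T⁻¹] {v : V | v ∈ τ.L M ∧ ∃ β : k, M.Dg Y v = β • v}).FG := by
    rw [h1]; exact Module.Finite.fg_top
  obtain ⟨s, hs, hs'⟩ := (Submodule.fg_span_iff_fg_span_finset_subset _).1 h2
  have h3 : ∀ v, ∃ β : k, v ∈ s → M.Dg Y v = β • v := by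
    intro v
    by_cases h : v ∈ s
    · obtain ⟨β, hβ⟩ := (hs h).2
      exact ⟨β, fun _ => hβ⟩
    · exact ⟨0, fun h' => absurd h' h⟩
  choose β hβ using h3
  refine ⟨s, β, fun v hv => ⟨(hs hv).1, hβ v hv⟩, ?_⟩
  rw [eq_top_iff]
  rintro v -
  have h4 : v ∈ Submodule.span k[T;T⁻¹] (s : Set V) := by rw [← hs', h1]; trivial
  induction h4 using Submodule.span_induction with
  | mem v hv =>
    exact Submodule.subset_span ⟨(⟨v, hv⟩, 0), by simp⟩
  | zero => exact zero_mem _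
  | add v w _ _ hv hw => exact add_mem hv hw
  | smul f v h0 hv =>
    clear h0
    induction f using laurent_ind with
    | hT a n =>
      rw [smul_assoc]
      refine Submodule.smul_mem _ _ ?_
      induction hv using Submodule.span_induction with
      | mem v hv =>
        obtain ⟨x, rfl⟩ := hv
        exact Submodule.subset_span ⟨(x.1, n + x.2), by simp only [T_add, mul_smul]⟩
      | zero => rw [smul_zero]; exact zero_mem _
      | add v w _ _ hv hw => rw [smul_add]; exact add_mem hv hw
      | smul a v _ hv => rw [smul_comm]; exact Submodule.smul_mem _ _ hv
    | hadd f g hf hg => rw [add_smul]; exact add_mem hf hg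

theorem eigenspace_finite {Y : V} (hY : Y ∈ τ.L M) (hD : ⨆ α, (M.Dg Y).eigenspace α = ⊤) (α : k) :
    FiniteDimensional k ((M.Dg Y).eigenspace α) := by
  obtain ⟨s, β, hs, hspan⟩ := τ.exists_generators M hY hD
  have h := eigenspace_le M hD _ (fun x : s × ℤ => β x.1 + x.2)
    (fun x => M.Dg_T_eigen (hs _ x.1.2).2 _) hspan α
  have hfin : {x : s × ℤ | β x.1 + x.2 = α}.Finite := by
    refine Set.Finite.of_finite_image (f := Prod.fst) (Set.toFinite _) ?_
    rintro ⟨v, n⟩ hv ⟨w, p⟩ hw (rfl : v = w)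
    have : (n : k) = p := add_left_cancel (a := β v) (hv.trans hw.symm)
    rw [Int.cast_injective this]
  have := FiniteDimensional.span_of_finite k (hfin.image
    (fun x : s × ℤ => (T x.2 : k[T;T⁻¹]) • (x.1 : V)))
  exact Submodule.finiteDimensional_of_le h

/-- The derivation `d + ad Y` has nonzero invariants on the twisted loop algebra. -/
theorem exists_invariant [LieAlgebra.IsSimple k 𝔤] {Y : V} (hY : Y ∈ τ.L M)
    (hD : ⨆ α, (M.Dg Y).eigenspace α = ⊤) :
    ∃ y ∈ τ.L M, y ≠ 0 ∧ M.Dg Y y = 0 := by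
  classical
  by_contra hno
  push Not at hno
  have := nontrivial_of_isSimple k 𝔤
  obtain ⟨s, β, hs, hspan⟩ := τ.exists_generators M hY hD
  have hle := eigenspace_le M hD _ (fun x : s × ℤ => β x.1 + x.2)
    (fun x => M.Dg_T_eigen (hs _ x.1.2).2 _) hspan
  set A : k → Submodule k V := fun α => τ.L M ⊓ (M.Dg Y).eigenspace α with hA
  have hmem : ∀ α v, v ∈ A α ↔ v ∈ τ.L M ∧ M.Dg Y v = α • v := fun α v => by
    rw [hA, Submodule.mem_inf, Module.End.mem_eigenspace_iff]
  have hsup : iSup A = τ.L M := le_antisymm (iSup_le fun _ => inf_le_left)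
    (le_iSup_inf_eigenspace _ hD _ fun v hv => τ.Dg_mem_L M hY hv)
  have hA_zero : ∀ z : ℤ, A ((z * (τ.m : ℤ) : ℤ) : k) = ⊥ := by
    intro z
    rw [eq_bot_iff]
    intro v hv
    rw [hmem] at hv
    by_contra hv0
    refine hno ((T (-(z * (τ.m : ℤ))) : k[T;T⁻¹]) • v) (τ.T_mem_L M hv.1 _ (by simp)) ?_ ?_
    · intro h
      apply hv0
      have := congrArg (fun w => (T (z * (τ.m : ℤ)) : k[T;T⁻¹]) • w) h
      simpa only [smul_smul, ← T_add, add_neg_cancel, T_zero, one_smul, smul_zero,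
        Submodule.mem_bot] using this
    · rw [M.Dg_T_eigen hv.2]
      push_cast
      rw [add_neg_cancel, zero_smul]
  have hne : ∀ α, A α ≠ ⊥ → ∃ v ∈ s, ∃ n : ℤ, α = β v + n := by
    intro α hα
    by_contra hcon
    push Not at hcon
    apply hα
    have h1 : {x : s × ℤ | β x.1 + x.2 = α} = ∅ := by
      ext x
      simpa using fun h => hcon _ x.1.2 x.2 h.symm
    have h2 := hle α
    rw [h1, Set.image_empty, Submodule.span_empty] at h2
    rw [eq_bot_iff]
    exact inf_le_right.trans h2
  obtain ⟨φ, hφ1, hφ⟩ := exists_real_functional k (s.image β)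
  have hφn : ∀ n : ℤ, φ n = n := fun n => by
    have : (n : k) = (n : ℚ) • (1 : k) := by rw [Rat.smul_def]; simp
    rw [this, map_smul, hφ1, Rat.smul_def]; simp
  have hspan1 : ∀ α, A α ≠ ⊥ → α ∈ Submodule.span ℚ
    (insert 1 ((s.image β : Finset k) : Set k)) := by
    intro α hα
    obtain ⟨v, hv, n, rfl⟩ := hne α hα
    refine add_mem (Submodule.subset_span (Set.mem_insert_of_mem _ ?_)) ?_
    · exact Finset.mem_coe.2 (Finset.mem_image_of_mem β hv)
    · have : (n : k) = (n : ℚ) • (1 : k) := by rw [Rat.smul_def]; simp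
      rw [this]
      exact Submodule.smul_mem _ _ (Submodule.subset_span (Set.mem_insert _ _))
  have hm : (0 : ℝ) < τ.m := Nat.cast_pos.2 τ.hm
  have hfin : iSup A = ⊥ := by
    refine graded_eq_bot A ?_ ?_ ?_ (fun α => toIcoMod hm 0 (φ α))
      ((s ×ˢ Finset.range τ.m).image fun x => toIcoMod hm 0 (φ (β x.1 + x.2))) ?_ ?_ ?_
    · exact (M.Dg Y).eigenspaces_iSupIndep.mono fun _ => inf_le_right
    · intro α α' x hx y hy
      rw [hmem] at hx hy ⊢
      refine ⟨τ.lie_mem_L M hx.1 hy.1, ?_⟩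
      rw [M.Dg_lie, hx.2, hy.2, smul_lie, lie_smul, add_smul]
    · rw [hsup]; exact τ.L_le_span_lie M
    · intro α hα
      obtain ⟨v, hv, n, rfl⟩ := hne α hα
      refine Finset.mem_image.2 ⟨(v, (n % τ.m).toNat), ?_, ?_⟩
      · have h0 : (τ.m : ℤ) ≠ 0 := by exact_mod_cast τ.hm.ne'
        have h1 := Int.emod_nonneg n h0
        have h2 := Int.emod_lt_of_pos n (b := τ.m) (by exact_mod_cast τ.hm)
        simp only [Finset.mem_product, Finset.mem_range]
        exact ⟨hv, by omega⟩
      · have h0 : (τ.m : ℤ) ≠ 0 := by exact_mod_cast τ.hm.ne'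
        have h1 := Int.emod_nonneg n h0
        have h2 : (((n % τ.m).toNat : ℕ) : k) = ((n % τ.m : ℤ) : k) := by
          rw [← Int.cast_natCast, Int.toNat_of_nonneg h1]
        simp only
        rw [h2, map_add, map_add, hφn, hφn]
        have h3 : ((n : ℤ) : ℝ) = ((n % τ.m : ℤ) : ℝ) + (n / τ.m : ℤ) • (τ.m : ℝ) := by
          have := Int.emod_add_mul_ediv n τ.m
          rw [zsmul_eq_mul]
          exact_mod_cast (by linarith : n = n % τ.m + n / τ.m * τ.m)
        rw [h3, ← add_assoc, toIcoMod_add_zsmul]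
    · intro α α' hα hα' h
      have h1 := toIcoMod_add_toIcoDiv_zsmul hm 0 (φ α)
      have h2 := toIcoMod_add_toIcoDiv_zsmul hm 0 (φ α')
      set z := toIcoDiv hm 0 (φ α) - toIcoDiv hm 0 (φ α') with hz
      have h3 : α - α' - ((z * (τ.m : ℤ) : ℤ) : k) = 0 := by
        refine hφ _ (sub_mem (sub_mem (hspan1 _ hα) (hspan1 _ hα')) ?_) ?_
        · have : ((z * (τ.m : ℤ) : ℤ) : k) = ((z * (τ.m : ℤ) : ℤ) : ℚ) • (1 : k) := by
            rw [Rat.smul_def]; simp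
          rw [this]
          exact Submodule.smul_mem _ _ (Submodule.subset_span (Set.mem_insert _ _))
        · rw [map_sub, map_sub, hφn, hz]
          push_cast
          simp only [zsmul_eq_mul] at h1 h2 h
          linear_combination -h1 + h2 + h
      rw [sub_eq_zero.1 h3]
      exact hA_zero z
    · intro α α' hα hα' h
      rw [map_sub, toIcoMod_sub_of_lt hm h]
      linarith [(toIcoMod_mem_Ico' hm (φ α')).2]
  exact τ.L_ne_bot M (hsup ▸ hfin)

end Twist

section

variable {k 𝔤 V : Type*} [Field k] [LieRing 𝔤] [LieAlgebra k 𝔤] [LieRing V]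
    [LieAlgebra k V] [LieAlgebra k[T;T⁻¹] V] [IsScalarTower k k[T;T⁻¹] V]

theorem smul_of_commute_T (g : Module.End k V)
    (h : ∀ (n : ℤ) (v : V), g ((T n : k[T;T⁻¹]) • v) = (T n : k[T;T⁻¹]) • g v)
    (f : k[T;T⁻¹]) (v : V) : g (f • v) = f • g v := by
  induction f using laurent_ind with
  | hT a n => rw [smul_assoc, map_smul, h, smul_assoc]
  | hadd f g hf hg => rw [add_smul, map_add, hf, hg, add_smul]

/-- Every derivation commuting with the action of the monomials is inner. -/
theorem exists_eq_lie (M : LoopModel k 𝔤 V) (g : Module.End k V)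
  (hg : ∀ v w : V, g ⁅v, w⁆ = ⁅g v, w⁆ + ⁅v, g w⁆)
    (h : ∀ (n : ℤ) (v : V), g ((T n : k[T;T⁻¹]) • v) = (T n : k[T;T⁻¹]) • g v) :
    ∃ l : V, ∀ v, g v = ⁅l, v⁆ :=
  ⟨M.pr { g with map_smul' := smul_of_commute_T g h },
    fun v => M.eq_ad_pr { g with map_smul' := smul_of_commute_T g h } hg v⟩

end

namespace Twist

variable {k 𝔤 V : Type*} [Field k] [LieRing 𝔤] [LieAlgebra k 𝔤] [LieRing V]
    [LieAlgebra k V] [LieAlgebra k[T;T⁻¹] V] [IsScalarTower k k[T;T⁻¹] V] (τ : Twist k 𝔤)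
    (M : LoopModel k 𝔤 V)

theorem mem_L_of_commute {l : V} (h : ∀ v, ⁅l, τ.Sg M v⁆ = τ.Sg M ⁅l, v⁆) : l ∈ τ.L M := by
  rw [mem_L, ← sub_eq_zero]
  refine M.center_eq fun w => ?_
  have hw : τ.Sg M ((τ.Sg M ^ (τ.m - 1)) w) = w := by
    rw [← Module.End.mul_apply, ← pow_succ', Nat.sub_add_cancel τ.hm, Sg_pow_m]
  rw [← hw, sub_lie, ← τ.Sg_lie, ← h, sub_self]

variable [CharZero k]

theorem exists_pairing {Y : V} (hY : Y ∈ τ.L M) (hD : ⨆ α, (M.Dg Y).eigenspace α = ⊤)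
    {y : V} (hy : y ∈ τ.L M) (hDy : M.Dg Y y = 0) (hy0 : y ≠ 0) :
    ∃ w ∈ τ.L M, M.Dg Y w = 0 ∧ killingForm k 𝔤 (M.ev y) (M.ev w) ≠ 0 := by
  obtain ⟨w, hw, α, hwα, hne⟩ : ∃ w ∈ τ.L M, ∃ α : k, M.Dg Y w = α • w ∧ M.κ y w ≠ 0 := by
    by_contra hcon
    push Not at hcon
    refine hy0 (M.κ_nondeg fun v => ?_)
    induction v using τ.ind_L M with
    | hT n v hv =>
      have := le_iSup_inf_eigenspace (M.Dg Y) hD (τ.L M) (fun v hv => τ.Dg_mem_L M hY hv) hv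
      clear hv
      rw [map_smul]
      induction this using Submodule.iSup_induction' with
      | mem α v hv => rw [hcon v hv.1 α (Module.End.mem_eigenspace_iff.1 hv.2), smul_zero]
      | zero => simp
      | add v w _ _ hv hw => rw [map_add, smul_add, hv, hw, add_zero]
    | hadd v w hv hw => rw [map_add, hv, hw, add_zero]
  set f := M.κ y w with hf
  have h1 : ∀ n : ℤ, (n : k) * cf n f = α * cf n f := by
    intro n
    have := M.Dg_κ Y y w
    rw [hDy, hwα, map_zero, LinearMap.zero_apply, zero_add, M.κ_ksmul_right, ← hf] at this
    rw [← cf_dS, ← this, map_smul, smul_eq_mul]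
  obtain ⟨n, hn⟩ : ∃ n, cf n f ≠ 0 := by
    by_contra hcon
    push Not at hcon
    exact hne (laurent_ext fun n => by rw [hcon, map_zero])
  have hα : α = n := (mul_right_cancel₀ hn (h1 n)).symm
  have hfT : f = cf n f • T n := by
    refine laurent_ext fun p => ?_
    rw [map_smul, cf_T, smul_eq_mul]
    split_ifs with h
    · rw [h, mul_one]
    · rw [mul_zero]
      by_contra h'
      have := mul_right_cancel₀ h' (h1 p)
      rw [hα] at this
      exact h (Int.cast_injective this).symm
  have hdvd : (τ.m : ℤ) ∣ n := by
    have h2 := τ.κ_Sg M y w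
    rw [(τ.mem_L M).1 hy, (τ.mem_L M).1 hw, ← hf] at h2
    have h3 := congrArg (cf n) h2
    rw [cf_SgS] at h3
    have h4 : τ.ζ ^ (-n) = 1 := by
      refine mul_right_cancel₀ hn ?_
      rw [one_mul]; exact h3.symm
    simpa using (τ.hζ.zpow_eq_one_iff_dvd _).1 h4
  refine ⟨(T (-n) : k[T;T⁻¹]) • w, τ.T_mem_L M hw _ (by simpa using hdvd), ?_, ?_⟩
  · rw [M.Dg_T_eigen hwα, hα]; simp
  · rw [M.killing_ev, map_smul, ← hf, hfT, smul_comm, smul_eq_mul, ← T_add, map_smul, liftS_T]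
    simpa using hn

theorem exists_not_nilpotent [LieAlgebra.IsSimple k 𝔤] {Y : V} (hY : Y ∈ τ.L M)
    (hD : ⨆ α, (M.Dg Y).eigenspace α = ⊤) :
    ∃ y ∈ τ.L M, M.Dg Y y = 0 ∧ ¬ ∀ v, ∃ n : ℕ, (LieAlgebra.ad k V y ^ n) v = 0 := by
  by_contra hcon
  push Not at hcon
  obtain ⟨y, hy, hy0, hDy⟩ := τ.exists_invariant M hY hD
  obtain ⟨w, hw, hDw, hne⟩ := τ.exists_pairing M hY hD hy hDy hy0
  have : FiniteDimensional k 𝔤 := Module.Finite.of_basis M.b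
  let K : LieSubalgebra k 𝔤 :=
    { (τ.L M ⊓ LinearMap.ker (M.Dg Y)).map M.ev with
      lie_mem' := by
        rintro _ _ ⟨x, ⟨hx, hx'⟩, rfl⟩ ⟨z, ⟨hz, hz'⟩, rfl⟩
        refine ⟨⁅x, z⁆, ⟨τ.lie_mem_L M hx hz, ?_⟩, M.ev_lie x z⟩
        change M.Dg Y ⁅x, z⁆ = 0
        rw [M.Dg_lie, LinearMap.mem_ker.1 hx', LinearMap.mem_ker.1 hz']
        simp }
  have hyK : M.ev y ∈ K := ⟨y, ⟨hy, hDy⟩, rfl⟩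
  have hwK : M.ev w ∈ K := ⟨w, ⟨hw, hDw⟩, rfl⟩
  have hnil : LieModule.IsNilpotent K 𝔤 := by
    rw [LieModule.isNilpotent_iff_forall (R := k)]
    rintro ⟨_, z, ⟨hz, hz'⟩, rfl⟩
    change IsNilpotent (LieAlgebra.ad k 𝔤 (M.ev z))
    rw [Module.End.isNilpotent_iff_of_finite]
    intro x
    obtain ⟨n, hn⟩ := hcon z hz hz' (M.mon 0 x)
    refine ⟨n, ?_⟩
    have := M.ev_pow z n (M.mon 0 x)
    rw [hn, M.ev_mon, map_zero] at this
    exact this.symm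
  apply hne
  have h := LieModule.traceForm_eq_zero_of_isNilpotent k K 𝔤
  have h2 := LinearMap.congr_fun (LinearMap.congr_fun h ⟨_, hyK⟩) ⟨_, hwK⟩
  exact h2

/-- For diagonalizable `d + ad Y`, there is a nonzero ad-diagonalizable invariant element. -/
theorem exists_diag_invariant [IsAlgClosed k] [LieAlgebra.IsSimple k 𝔤] {Y : V} (hY : Y ∈ τ.L M)
    (hD : ⨆ α, (M.Dg Y).eigenspace α = ⊤) :
    ∃ l ∈ τ.L M, l ≠ 0 ∧ M.Dg Y l = 0 ∧ ⨆ α, (LieAlgebra.ad k V l).eigenspace α = ⊤ := by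
  obtain ⟨y, hy, hDy, hnil⟩ := τ.exists_not_nilpotent M hY hD
  have hstab : ∀ α, ∀ v ∈ (M.Dg Y).eigenspace α, LieAlgebra.ad k V y v ∈ (M.Dg Y).eigenspace α := by
    intro α v hv
    rw [Module.End.mem_eigenspace_iff] at hv ⊢
    rw [LieAlgebra.ad_apply, M.Dg_lie, hDy, hv]
    simp
  have hlf : LocallyFinite (LieAlgebra.ad k V y) := by
    intro v
    obtain ⟨P, hP⟩ := exists_isProj (M.Dg Y).eigenspaces_iSupIndep hD
    obtain ⟨s, -, hs⟩ := hP.sum v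
    have := fun α => τ.eigenspace_finite M hY hD α
    refine ⟨⨆ α : s, (M.Dg Y).eigenspace α, inferInstance, ?_, ?_⟩
    · rw [← hs]
      exact sum_mem fun α hα => Submodule.mem_iSup_of_mem (⟨α, hα⟩ : s) (hP.mem α v)
    · intro w hw
      have : (⨆ α : s, (M.Dg Y).eigenspace α) ≤
          (⨆ α : s, (M.Dg Y).eigenspace α).comap (LieAlgebra.ad k V y) := by
        refine iSup_le fun α v hv => ?_
        exact Submodule.mem_iSup_of_mem α (hstab α v hv)
      exact this hw
  obtain ⟨g, hg, hgt, hgc, -, hg0⟩ := exists_semisimple_part (LieAlgebra.ad k V y)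
    (fun v w => leibniz_lie y v w) hlf
  have hgT : ∀ (n : ℤ) (v : V), g ((T n : k[T;T⁻¹]) • v) = (T n : k[T;T⁻¹]) • g v := by
    intro n v
    let G : Module.End k V := (LinearMap.lsmul k[T;T⁻¹] V (T n)).restrictScalars k
    simpa [G] using hgc G 0 (fun v => by simp [G]) v
  obtain ⟨l, hl⟩ := exists_eq_lie M g hg hgT
  have hadl : LieAlgebra.ad k V l = g := by ext v; exact (hl v).symm
  refine ⟨l, τ.mem_L_of_commute M fun v => ?_, ?_, ?_, hadl ▸ hgt⟩
  · rw [← hl, ← hl]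
    simpa using hgc (τ.Sg M) 0 (fun v => by simp [τ.ad_Sg M hy]) v
  · rintro rfl
    apply hnil
    exact hg0 (by rw [← hadl]; simp)
  · refine M.center_eq fun v => ?_
    have h1 := hgc (M.Dg Y) 0 (fun v => by simp [M.Dg_lie, hDy]) v
    have h2 := M.Dg_lie Y l v
    rw [← hl, ← hl] at h2
    rw [h1] at h2
    simpa using h2

end Twist

section

variable {k : Type*} [Field k]

theorem exists_cf_eq_zero (f : k[T;T⁻¹]) : ∃ s : Finset ℤ, ∀ n ∉ s, cf n f = 0 :=
  ⟨f.coeff.support, fun n hn => by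
    have : f.coeff n = 0 := Finsupp.notMem_support_iff.1 hn
    exact this⟩

theorem sum_cf {f : k[T;T⁻¹]} {s : Finset ℤ} (hs : ∀ n ∉ s, cf n f = 0) :
    ∑ n ∈ s, cf n f • (T n : k[T;T⁻¹]) = f := by
  refine laurent_ext fun n => ?_
  simp only [map_sum, map_smul, cf_T, smul_eq_mul, mul_ite, mul_one, mul_zero, Finset.sum_ite_eq']
  split_ifs with h
  · rfl
  · exact (hs n h).symm

/-- The Laurent polynomials all of whose exponents `q` satisfy `ε q ≤ p`. -/
def SLe (ε p : ℤ) : Submodule k k[T;T⁻¹] where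
  carrier := {f | ∀ q : ℤ, p < ε * q → cf q f = 0}
  add_mem' hf hg q hq := by rw [map_add, hf q hq, hg q hq, add_zero]
  zero_mem' q _ := map_zero _
  smul_mem' a f hf q hq := by rw [map_smul, hf q hq, smul_zero]

theorem T_mem_SLe {ε p n : ℤ} (h : ε * n ≤ p) : (T n : k[T;T⁻¹]) ∈ SLe ε p := by
  intro q hq
  rw [cf_T, if_neg]
  rintro rfl
  omega

theorem SLe_ind {ε p : ℤ} {f : k[T;T⁻¹]} (hf : f ∈ SLe ε p) {P : k[T;T⁻¹] → Prop}
    (hT : ∀ (a : k) (n : ℤ), ε * n ≤ p → P (a • T n))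
    (h0 : P 0) (hadd : ∀ f g, P f → P g → P (f + g)) : P f := by
  obtain ⟨s, hs⟩ := exists_cf_eq_zero f
  rw [← sum_cf hs]
  refine Finset.sum_induction _ P hadd h0 fun n _ => ?_
  by_cases h : ε * n ≤ p
  · exact hT _ n h
  · rw [hf n (not_le.1 h), zero_smul]; exact h0

theorem SLe_mono (ε : ℤ) {p q : ℤ} (h : p ≤ q) : SLe (k := k) ε p ≤ SLe ε q :=
  fun _ hf r hr => hf r (h.trans_lt hr)

theorem mul_mem_SLe {ε p q : ℤ} {f g : k[T;T⁻¹]} (hf : f ∈ SLe ε p) (hg : g ∈ SLe ε q) :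
    f * g ∈ SLe ε (p + q) := by
  refine SLe_ind (P := fun f => f * g ∈ SLe ε (p + q)) hf (fun a n hn => ?_)
    ?_ fun f f' hf hf' => ?_
  · refine SLe_ind (P := fun g => (a • T n : k[T;T⁻¹]) * g ∈ SLe ε (p + q)) hg (fun b n' hn' => ?_)
      ?_ fun f f' hf hf' => ?_
    · rw [smul_mul_smul_comm, ← T_add]
      exact Submodule.smul_mem _ _ (T_mem_SLe (by rw [mul_add]; omega))
    · rw [mul_zero]; exact zero_mem _
    · rw [mul_add]; exact add_mem hf hf'
  · rw [zero_mul]; exact zero_mem _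
  · rw [add_mul]; exact add_mem hf hf'

theorem dS_mem_SLe {ε p : ℤ} {f : k[T;T⁻¹]} (hf : f ∈ SLe ε p) : dS f ∈ SLe ε p :=
  fun q hq => by rw [cf_dS, hf q hq, mul_zero]

end

namespace LoopModel

variable {k 𝔤 V : Type*} [Field k] [LieRing 𝔤] [LieAlgebra k 𝔤] [LieRing V]
    [LieAlgebra k V] [LieAlgebra k[T;T⁻¹] V] [IsScalarTower k k[T;T⁻¹] V] (M : LoopModel k 𝔤 V)

/-- The elements all of whose exponents `q` satisfy `ε q ≤ p`. -/
def VLe (ε p : ℤ) : Submodule k V where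
  carrier := {v | ∀ q : ℤ, p < ε * q → M.coef q v = 0}
  add_mem' hf hg q hq := by rw [map_add, hf q hq, hg q hq, add_zero]
  zero_mem' q _ := map_zero _
  smul_mem' a f hf q hq := by rw [map_smul, hf q hq, smul_zero]

theorem mon_mem_VLe {ε p n : ℤ} (h : ε * n ≤ p) (y : 𝔤) : M.mon n y ∈ M.VLe ε p := by
  intro q hq
  rw [M.coef_mon, if_neg]
  rintro rfl
  omega

theorem j_mem_VLe (ε : ℤ) (y : 𝔤) : M.j y ∈ M.VLe ε 0 := by
  have := M.mon_mem_VLe (ε := ε) (p := 0) (n := 0) (by simp) y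
  simpa [M.mon_apply] using this

theorem sum_coef {v : V} {s : Finset ℤ} (hs : ∀ n ∉ s, M.coef n v = 0) :
    ∑ n ∈ s, M.mon n (M.coef n v) = v := by
  refine M.coef_ext fun n => ?_
  simp only [map_sum, M.coef_mon, Finset.sum_ite_eq']
  split_ifs with h
  · rfl
  · exact (hs n h).symm

theorem VLe_ind {ε p : ℤ} {v : V} (hv : v ∈ M.VLe ε p) {P : V → Prop}
    (hmon : ∀ (n : ℤ) (y : 𝔤), ε * n ≤ p → P (M.mon n y))
    (h0 : P 0) (hadd : ∀ v w, P v → P w → P (v + w)) : P v := by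
  obtain ⟨s, hs⟩ := M.coef_finite v
  rw [← M.sum_coef hs]
  refine Finset.sum_induction _ P hadd h0 fun n _ => ?_
  by_cases h : ε * n ≤ p
  · exact hmon n _ h
  · rw [hv n (not_le.1 h), map_zero]; exact h0

theorem VLe_mono (ε : ℤ) {p q : ℤ} (h : p ≤ q) : M.VLe ε p ≤ M.VLe ε q :=
  fun _ hf r hr => hf r (h.trans_lt hr)

theorem exists_mem_VLe (ε : ℤ) (v : V) : ∃ p, v ∈ M.VLe ε p := by
  obtain ⟨s, hs⟩ := M.coef_finite v
  refine ⟨∑ n ∈ s, |ε * n|, fun q hq => hs q fun hqs => ?_⟩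
  have : |ε * q| ≤ ∑ n ∈ s, |ε * n| :=
    Finset.single_le_sum (f := fun n => |ε * n|) (fun i _ => abs_nonneg _) hqs
  exact absurd hq (not_lt.2 ((le_abs_self _).trans this))

theorem smul_mem_VLe {ε p q : ℤ} {f : k[T;T⁻¹]} {v : V} (hf : f ∈ SLe ε p) (hv : v ∈ M.VLe ε q) :
    f • v ∈ M.VLe ε (p + q) := by
  refine SLe_ind (P := fun f => f • v ∈ M.VLe ε (p + q)) hf (fun a n hn => ?_)
    ?_ fun f f' hf hf' => ?_
  · refine M.VLe_ind (P := fun v => (a • T n : k[T;T⁻¹]) • v ∈ M.VLe ε (p + q)) hv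
      (fun n' y hn' => ?_)
      ?_ fun f f' hf hf' => ?_
    · rw [smul_assoc, M.T_smul_mon]
      exact Submodule.smul_mem _ _ (M.mon_mem_VLe (by rw [mul_add]; omega) _)
    · rw [smul_zero]; exact zero_mem _
    · rw [smul_add]; exact add_mem hf hf'
  · rw [zero_smul]; exact zero_mem _
  · rw [add_smul]; exact add_mem hf hf'

theorem lie_mem_VLe {ε p q : ℤ} {v w : V} (hv : v ∈ M.VLe ε p) (hw : w ∈ M.VLe ε q) :
    ⁅v, w⁆ ∈ M.VLe ε (p + q) := by
  refine M.VLe_ind (P := fun v => ⁅v, w⁆ ∈ M.VLe ε (p + q)) hv (fun n y hn => ?_)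
    ?_ fun f f' hf hf' => ?_
  · refine M.VLe_ind (P := fun w => ⁅M.mon n y, w⁆ ∈ M.VLe ε (p + q)) hw (fun n' y' hn' => ?_)
      ?_ fun f f' hf hf' => ?_
    · rw [M.mon_lie]
      exact M.mon_mem_VLe (by rw [mul_add]; omega) _
    · rw [lie_zero]; exact zero_mem _
    · rw [lie_add]; exact add_mem hf hf'
  · rw [zero_lie]; exact zero_mem _
  · rw [add_lie]; exact add_mem hf hf'

theorem κ_mem_SLe {ε p q : ℤ} {v w : V} (hv : v ∈ M.VLe ε p) (hw : w ∈ M.VLe ε q) :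
    M.κ v w ∈ SLe ε (p + q) := by
  refine M.VLe_ind (P := fun v => M.κ v w ∈ SLe ε (p + q)) hv (fun n y hn => ?_)
    ?_ fun f f' hf hf' => ?_
  · refine M.VLe_ind (P := fun w => M.κ (M.mon n y) w ∈ SLe ε (p + q)) hw (fun n' y' hn' => ?_)
      ?_ fun f f' hf hf' => ?_
    · rw [M.κ_mon]
      exact Submodule.smul_mem _ _ (T_mem_SLe (by rw [mul_add]; omega))
    · rw [map_zero]; exact zero_mem _
    · rw [map_add]; exact add_mem hf hf'
  · rw [map_zero]; exact zero_mem _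
  · rw [map_add]; exact add_mem hf hf'

theorem d_mem_VLe {ε p : ℤ} {v : V} (hv : v ∈ M.VLe ε p) : M.d v ∈ M.VLe ε p :=
  fun q hq => by rw [M.coef_d, hv q hq, smul_zero]

theorem Sg_mem_VLe (τ : Twist k 𝔤) {ε p : ℤ} {v : V} (hv : v ∈ M.VLe ε p) :
    τ.Sg M v ∈ M.VLe ε p := by
  refine M.VLe_ind (P := fun v => τ.Sg M v ∈ M.VLe ε p) hv (fun n y hn => ?_)
    ?_ fun f f' hf hf' => ?_
  · rw [τ.Sg_mon]; exact Submodule.smul_mem _ _ (M.mon_mem_VLe hn _)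
  · rw [map_zero]; exact zero_mem _
  · rw [map_add]; exact add_mem hf hf'

theorem exists_bound (ε : ℤ) (ρ : Module.End k[T;T⁻¹] V) :
    ∃ K : ℤ, ∀ p, ∀ v ∈ M.VLe ε p, ρ v ∈ M.VLe ε (p + K) := by
  have h1 : ∀ i, ∃ K, ρ (M.j (M.b i)) ∈ M.VLe ε K := fun i => M.exists_mem_VLe ε _
  choose K hK using h1
  refine ⟨∑ i, |K i|, fun p v hv => ?_⟩
  rw [← M.sum_eq v, map_sum]
  refine sum_mem fun i _ => ?_
  rw [map_smul]
  have h2 := Finset.single_le_sum (f := fun n => |K n|) (fun i _ => abs_nonneg _)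
    (Finset.mem_univ i)
  have h3 := M.smul_mem_VLe (M.κ_mem_SLe hv (M.j_mem_VLe ε (M.b' i))) (hK i)
  rw [add_zero] at h3
  exact M.VLe_mono ε (by linarith [le_abs_self (K i)]) h3

theorem finiteDimensional_inf (p q : ℤ) :
    FiniteDimensional k (M.VLe 1 p ⊓ M.VLe (-1) q : Submodule k V) := by
  have : FiniteDimensional k 𝔤 := Module.Finite.of_basis M.b
  have h : M.VLe 1 p ⊓ M.VLe (-1) q ≤ ⨆ n : Finset.Icc (-q) p, LinearMap.range (M.mon n) := by
    rintro v ⟨h1, h2⟩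
    have hs : ∀ n ∉ Finset.Icc (-q) p, M.coef n v = 0 := by
      intro n hn
      rw [Finset.mem_Icc, not_and_or, not_le, not_le] at hn
      rcases hn with hn | hn
      · exact h2 n (by omega)
      · exact h1 n (by omega)
    rw [← M.sum_coef hs]
    exact sum_mem fun n hn => Submodule.mem_iSup_of_mem (⟨n, hn⟩ : Finset.Icc (-q) p) ⟨_, rfl⟩
  exact Submodule.finiteDimensional_of_le h

theorem inf_eq_zero {p q : ℤ} (h : p + q < 0) {v : V} (h1 : v ∈ M.VLe 1 p)
    (h2 : v ∈ M.VLe (-1) q) : v = 0 := by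
  refine M.coef_ext fun n => ?_
  rw [map_zero]
  by_cases hn : n ≤ p
  · exact h2 n (by omega)
  · exact h1 n (by omega)

theorem tr_mem_SLe {ε : ℤ} {ρ : Module.End k[T;T⁻¹] V} (h : ∀ p, ∀ v ∈ M.VLe ε p, ρ v ∈ M.VLe ε p) :
    M.tr ρ ∈ SLe ε 0 := by
  rw [M.tr_eq]
  refine sum_mem fun i _ => ?_
  simpa using M.κ_mem_SLe (h 0 _ (M.j_mem_VLe ε _)) (M.j_mem_VLe ε (M.b' i))

theorem pr_mem_VLe {ε : ℤ} {ρ : Module.End k[T;T⁻¹] V} (h : ∀ p, ∀ v ∈ M.VLe ε p, ρ v ∈ M.VLe ε p) :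
    M.pr ρ ∈ M.VLe ε 0 := by
  refine sum_mem fun i _ => ?_
  have h1 : M.tr (ρ * M.ad (M.j (M.b i))) ∈ SLe ε 0 := by
    refine M.tr_mem_SLe fun p v hv => h p _ ?_
    simpa using M.lie_mem_VLe (M.j_mem_VLe ε (M.b i)) hv
  simpa using M.smul_mem_VLe h1 (M.j_mem_VLe ε (M.b' i))

end LoopModel

/-- A finite real grading by submodules, given by the eigenspaces of `ad l`. -/
structure Gr {k 𝔤 V : Type*} [Field k] [LieRing 𝔤] [LieAlgebra k 𝔤] [LieRing V]
    [LieAlgebra k V] [LieAlgebra k[T;T⁻¹] V] [IsScalarTower k k[T;T⁻¹] V]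
    (M : LoopModel k 𝔤 V) (l : V) where
  X : Finset ℝ
  Q : ℝ → Module.End k[T;T⁻¹] V
  c : ℝ → k
  Q_Q : ∀ x y v, Q x (Q y v) = if x = y then Q x v else 0
  sum_Q : ∀ v, ∑ x ∈ X, Q x v = v
  Q_eq_zero : ∀ x ∉ X, ∀ v, Q x v = 0
  lie_mem : ∀ {x y u v}, Q x u = u → Q y v = v → Q (x + y) ⁅u, v⁆ = ⁅u, v⁆
  κ_eq_zero : ∀ {x y u v}, Q x u = u → Q y v = v → x + y ≠ 0 → M.κ u v = 0
  lie_l : ∀ x v, ⁅l, Q x v⁆ = c x • Q x v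
  mem_of : ∀ x ∈ X, ∀ v, ⁅l, v⁆ = c x • v → Q x v = v

section

variable {k 𝔤 V : Type*} [Field k] [CharZero k] [LieRing 𝔤] [LieAlgebra k 𝔤] [LieRing V]
    [LieAlgebra k V] [LieAlgebra k[T;T⁻¹] V] [IsScalarTower k k[T;T⁻¹] V]

theorem exists_gr (M : LoopModel k 𝔤 V) {l : V}
    (hl : ⨆ α, (LieAlgebra.ad k V l).eigenspace α = ⊤) : Nonempty (Gr M l) := by
  classical
  have mem : ∀ α v, v ∈ (LieAlgebra.ad k V l).eigenspace α ↔ ⁅l, v⁆ = α • v := fun α v => by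
    rw [Module.End.mem_eigenspace_iff, LieAlgebra.ad_apply]
  obtain ⟨P, hP⟩ := exists_isProj (LieAlgebra.ad k V l).eigenspaces_iSupIndep hl
  have hPT : ∀ α (n : ℤ) (v : V), P α ((T n : k[T;T⁻¹]) • v) = (T n : k[T;T⁻¹]) • P α v := by
    intro α n
    have hstab : ∀ β, ∀ v ∈ (LieAlgebra.ad k V l).eigenspace β,
        (T n : k[T;T⁻¹]) • v ∈ (LieAlgebra.ad k V l).eigenspace β := by
      intro β v hv
      rw [mem] at hv ⊢
      rw [lie_smul, hv, smul_comm]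
    let G : Module.End k V := (LinearMap.lsmul k[T;T⁻¹] V (T n)).restrictScalars k
    refine hom_eq_of_iSup_eq_top hl (P α ∘ₗ G) (G ∘ₗ P α) fun β v hv => ?_
    change P α ((T n : k[T;T⁻¹]) • v) = (T n : k[T;T⁻¹]) • P α v
    by_cases h : α = β
    · subst h
      rw [hP.same _ _ (hstab _ _ hv), hP.same _ _ hv]
    · rw [hP.ne _ _ h _ (hstab _ _ hv), hP.ne _ _ h _ hv, smul_zero]
  let P' : k → Module.End k[T;T⁻¹] V := fun α =>
    { P α with map_smul' := smul_of_commute_T (P α) (hPT α) }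
  have hP' : ∀ α v, P' α v = P α v := fun _ _ => rfl
  choose s hs hs' using fun i => hP.sum (M.e i)
  let Λ : Finset k := Finset.univ.biUnion s
  have hΛ : ∀ α ∉ Λ, ∀ v, P α v = 0 := by
    intro α hα v
    have h : P' α = 0 := M.e.ext fun i => by
      rw [hP', LinearMap.zero_apply]
      exact hs i α fun h => hα (Finset.mem_biUnion.2 ⟨i, Finset.mem_univ _, h⟩)
    rw [← hP', h, LinearMap.zero_apply]
  have hsum : ∀ v, ∑ α ∈ Λ, P α v = v := by
    intro v
    obtain ⟨t, ht, ht'⟩ := hP.sum v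
    conv_rhs => rw [← ht']
    rw [← Finset.sum_subset (Finset.inter_subset_left (s₁ := Λ) (s₂ := t)) fun α h h' => ht α
        fun h'' =>
        h' (Finset.mem_inter.2 ⟨h, h''⟩)]
    exact Finset.sum_subset Finset.inter_subset_right fun α h h' => hΛ α (fun h'' =>
        h' (Finset.mem_inter.2 ⟨h'', h⟩)) v
  obtain ⟨φ, -, hφ⟩ := exists_real_functional k Λ
  have hinj : Set.InjOn φ (Λ : Set k) := by
    intro α hα β hβ h
    rw [← sub_eq_zero]
    refine hφ _ (Submodule.sub_mem _ (Submodule.subset_span (Or.inr hα))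
      (Submodule.subset_span (Or.inr hβ))) ?_
    rw [map_sub, h, sub_self]
  let X : Finset ℝ := Λ.image φ
  let c : ℝ → k := Function.invFunOn φ (Λ : Set k)
  have hcφ : ∀ α ∈ Λ, c (φ α) = α := fun α hα => hinj.leftInvOn_invFunOn hα
  have hc : ∀ x ∈ X, c x ∈ Λ ∧ φ (c x) = x := by
    intro x hx
    obtain ⟨α, hα, rfl⟩ := Finset.mem_image.1 hx
    rw [hcφ α hα]; exact ⟨hα, rfl⟩
  let Q : ℝ → Module.End k[T;T⁻¹] V := fun x => if x ∈ X then P' (c x) else 0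
  have hQ : ∀ x ∈ X, ∀ v, Q x v = P (c x) v := fun x hx v => by
    simp only [Q, if_pos hx]; rfl
  have hQ0 : ∀ x ∉ X, ∀ v, Q x v = 0 := fun x hx v => by
    simp only [Q, if_neg hx]; rfl
  have hQeig : ∀ x v, Q x v = v → v = 0 ∨ (x ∈ X ∧ ⁅l, v⁆ = c x • v) := by
    intro x v hv
    by_cases hx : x ∈ X
    · right
      refine ⟨hx, ?_⟩
      rw [← mem, ← hv, hQ x hx]
      exact hP.mem _ _
    · left; rw [← hv, hQ0 x hx]
  have hsame : ∀ x ∈ X, ∀ v, ⁅l, v⁆ = c x • v → Q x v = v := by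
    intro x hx v hv
    rw [hQ x hx, hP.same _ _ ((mem _ _).2 hv)]
  refine ⟨⟨X, Q, c, ?_, ?_, hQ0, ?_, ?_, ?_, hsame⟩⟩
  · intro x y v
    by_cases hx : x ∈ X
    · by_cases hy : y ∈ X
      · split_ifs with h
        · subst h
          rw [hQ x hx, hQ x hx, hP.same _ _ (hP.mem _ _)]
        · rw [hQ x hx, hQ y hy]
          refine hP.ne _ _ (fun h' => h ?_) _ (hP.mem _ _)
          rw [← (hc x hx).2, h', (hc y hy).2]
      · rw [hQ0 y hy, map_zero]
        split_ifs with h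
        · exact absurd (h ▸ hx) hy
        · rfl
    · rw [hQ0 x hx, hQ0 x hx]; simp
  · intro v
    rw [Finset.sum_image hinj]
    conv_rhs => rw [← hsum v]
    refine Finset.sum_congr rfl fun α hα => ?_
    rw [hQ _ (Finset.mem_image_of_mem _ hα), hcφ α hα]
  · intro x y u v hu hv
    rcases hQeig x u hu with rfl | ⟨hx, hu'⟩
    · simp
    rcases hQeig y v hv with rfl | ⟨hy, hv'⟩
    · simp
    have h1 : ⁅l, ⁅u, v⁆⁆ = (c x + c y) • ⁅u, v⁆ := by
      rw [leibniz_lie, hu', hv', smul_lie, lie_smul, add_smul]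
    by_cases h : c x + c y ∈ Λ
    · have h2 : x + y = φ (c x + c y) := by rw [map_add, (hc x hx).2, (hc y hy).2]
      refine hsame _ (h2 ▸ Finset.mem_image_of_mem _ h) _ ?_
      rw [h1, h2, hcφ _ h]
    · have := hΛ _ h ⁅u, v⁆
      rw [hP.same _ _ ((mem _ _).2 h1)] at this
      rw [this, map_zero]
  · intro x y u v hu hv hxy
    rcases hQeig x u hu with rfl | ⟨hx, hu'⟩
    · simp
    rcases hQeig y v hv with rfl | ⟨hy, hv'⟩
    · simp
    have h1 := M.κ_lie u l v
    rw [← lie_skew, hu', hv', map_neg, LinearMap.neg_apply, M.κ_ksmul_left, M.κ_ksmul_right] at h1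
    have h2 : (c x + c y) • M.κ u v = 0 := by rw [add_smul, ← h1, add_neg_cancel]
    refine (smul_eq_zero.1 h2).resolve_left fun h => hxy ?_
    rw [← (hc x hx).2, ← (hc y hy).2, ← map_add, h, map_zero]
  · intro x v
    by_cases hx : x ∈ X
    · rw [hQ x hx]; exact (mem _ _).1 (hP.mem _ _)
    · rw [hQ0 x hx]; simp

end

namespace Gr

variable {k 𝔤 V : Type*} [Field k] [LieRing 𝔤] [LieAlgebra k 𝔤] [LieRing V]
    [LieAlgebra k V] [LieAlgebra k[T;T⁻¹] V] [IsScalarTower k k[T;T⁻¹] V]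
    {M : LoopModel k 𝔤 V} {l : V} (G : Gr M l)

/-- The elements with components of degree at least `x`. -/
def Fge (x : ℝ) : Submodule k[T;T⁻¹] V where
  carrier := {v | ∀ y < x, G.Q y v = 0}
  add_mem' hv hw y hy := by rw [map_add, hv y hy, hw y hy, add_zero]
  zero_mem' _ _ := map_zero _
  smul_mem' a v hv y hy := by rw [map_smul, hv y hy, smul_zero]

/-- The elements with components of degree greater than `x`. -/
def Fgt (x : ℝ) : Submodule k[T;T⁻¹] V where
  carrier := {v | ∀ y ≤ x, G.Q y v = 0}
  add_mem' hv hw y hy := by rw [map_add, hv y hy, hw y hy, add_zero]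
  zero_mem' _ _ := map_zero _
  smul_mem' a v hv y hy := by rw [map_smul, hv y hy, smul_zero]

theorem Fgt_le (x : ℝ) : G.Fgt x ≤ G.Fge x := fun _ hv y hy => hv y hy.le

theorem Q_same (x : ℝ) (v : V) : G.Q x (G.Q x v) = G.Q x v := by rw [G.Q_Q, if_pos rfl]

theorem mem_Fge {x y : ℝ} {v : V} (hv : G.Q y v = v) (h : x ≤ y) : v ∈ G.Fge x := by
  intro z hz
  rw [← hv, G.Q_Q, if_neg (hz.trans_le h).ne]

theorem lie_mem_Fgt {x y : ℝ} {v w : V} (hv : v ∈ G.Fgt x) (hw : w ∈ G.Fge y) :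
    ⁅v, w⁆ ∈ G.Fgt (x + y) := by
  intro z hz
  conv_lhs => rw [← G.sum_Q v, ← G.sum_Q w]
  rw [sum_lie_sum, map_sum]
  refine Finset.sum_eq_zero fun a _ => ?_
  rw [map_sum]
  refine Finset.sum_eq_zero fun b _ => ?_
  by_cases ha : a ≤ x
  · rw [hv a ha, zero_lie, map_zero]
  by_cases hb : b < y
  · rw [hw b hb, lie_zero, map_zero]
  rw [← G.lie_mem (G.Q_same a v) (G.Q_same b w), G.Q_Q, if_neg]
  intro h
  linarith

/-- A semilinear endomorphism commuting with `ad l` commutes with the projections. -/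
theorem commute_Q {D : V →+ V} (hD : ∀ (a : k) v, D (a • v) = a • D v)
    (h : ∀ v, D ⁅l, v⁆ = ⁅l, D v⁆) (x : ℝ) (v : V) : D (G.Q x v) = G.Q x (D v) := by
  have h1 : ∀ y v, G.Q y (D (G.Q y v)) = D (G.Q y v) := by
    intro y v
    by_cases hy : y ∈ G.X
    · refine G.mem_of y hy _ ?_
      rw [← h, G.lie_l, hD]
    · rw [G.Q_eq_zero y hy v, map_zero, map_zero]
  have h2 : ∀ y, x ≠ y → G.Q x (D (G.Q y v)) = 0 := by
    intro y hy
    rw [← h1, G.Q_Q, if_neg hy]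
  conv_rhs => rw [← G.sum_Q v, map_sum, map_sum]
  by_cases hx : x ∈ G.X
  · rw [Finset.sum_eq_single_of_mem x hx fun y _ hy => h2 y hy.symm, h1]
  · rw [G.Q_eq_zero x hx, map_zero]
    exact (Finset.sum_eq_zero fun y hy => h2 y fun h => hx (h ▸ hy)).symm

theorem κ_Q (x : ℝ) (v w : V) : M.κ (G.Q x v) w = M.κ v (G.Q (-x) w) := by
  have h1 : M.κ (G.Q x v) w = M.κ (G.Q x v) (G.Q (-x) w) := by
    conv_lhs => rw [← G.sum_Q w]
    rw [map_sum]
    by_cases hx : -x ∈ G.X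
    · exact Finset.sum_eq_single_of_mem _ hx fun y _ hy =>
        G.κ_eq_zero (G.Q_same _ _) (G.Q_same _ _) fun h => hy (by linarith)
    · rw [G.Q_eq_zero _ hx, map_zero]
      exact Finset.sum_eq_zero fun y hy =>
        G.κ_eq_zero (G.Q_same _ _) (G.Q_same _ _) fun h => hx (by
          rwa [show -x = y by linarith])
  rw [h1]
  conv_rhs => rw [← G.sum_Q v]
  rw [map_sum, LinearMap.sum_apply]
  by_cases hx : x ∈ G.X
  · exact (Finset.sum_eq_single_of_mem _ hx fun y _ hy =>
        G.κ_eq_zero (x := y) (y := -x) (G.Q_same _ _) (G.Q_same _ _) fun h => hy (by linarith)).symm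
  · rw [G.Q_eq_zero _ hx, map_zero, LinearMap.zero_apply]
    exact (Finset.sum_eq_zero fun y hy =>
        G.κ_eq_zero (x := y) (y := -x) (G.Q_same _ _) (G.Q_same _ _) fun h => hx (by
          rwa [show x = y by linarith])).symm

end Gr

section Flag

variable {k W : Type*} [Field k] [AddCommGroup W] [Module k W]

theorem exists_adapted_set (A : ℤ → Submodule k W) (hA : Monotone A) (n0 : ℤ) (h0 : A n0 = ⊥)
    (i : ℕ) : ∃ (b : Set W) (a : W → ℤ), LinearIndepOn k id b ∧
      (∀ x ∈ b, x ∈ A (a x) ∧ a x ≤ n0 + i) ∧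
      ∀ n ≤ n0 + i, A n ≤ Submodule.span k (id '' (b ∩ {x | a x ≤ n})) := by
  classical
  induction i with
  | zero =>
    refine ⟨∅, 0, linearIndepOn_empty _ _, by simp, fun n hn => ?_⟩
    have : A n ≤ ⊥ := h0 ▸ hA (by simpa using hn)
    exact this.trans bot_le
  | succ i ih =>
    obtain ⟨b, a, hb, h1, h2⟩ := ih
    set N : ℤ := n0 + (i + 1 : ℕ) with hN
    have hN' : N = n0 + i + 1 := by rw [hN]; push_cast; ring
    have hbA : b ⊆ A N := fun x hx => hA (by rw [hN']; linarith [(h1 x hx).2]) (h1 x hx).1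
    obtain ⟨b', hb'A, hbb', hspan, hb'⟩ := exists_linearIndepOn_extension hb hbA
    refine ⟨b', fun x => if x ∈ b then a x else N, hb', fun x hx => ?_, fun n hn => ?_⟩
    · dsimp only
      split_ifs with h
      · exact ⟨(h1 x h).1, by linarith [(h1 x h).2]⟩
      · exact ⟨hb'A hx, le_rfl⟩
    · rcases hn.lt_or_eq with hn | rfl
      · refine (h2 n (by omega)).trans (Submodule.span_mono (Set.image_mono fun x hx => ?_))
        exact ⟨hbb' hx.1, by simpa [hx.1] using hx.2⟩
      · have : b' ∩ {x | (if x ∈ b then a x else N) ≤ N} = b' := by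
          refine Set.inter_eq_left.2 fun x hx => ?_
          simp only [Set.mem_ofPred_eq]
          split_ifs with h
          · linarith [(h1 x h).2]
          · exact le_rfl
        rw [this]
        simpa using hspan

/-- A bounded filtration of a finite-dimensional space has an adapted basis. -/
theorem exists_adapted_basis (A : ℤ → Submodule k W) (hA : Monotone A) (n0 : ℤ) (h0 : A n0 = ⊥)
    (F : Submodule k W) [FiniteDimensional k F] (hF : ∀ n, A n ≤ F) :
    ∃ (b : Set W) (_ : Fintype b) (a : b → ℤ), LinearIndependent k ((↑) : b → W) ∧
      (∀ j : b, (j : W) ∈ A (a j)) ∧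
      ∀ n, ∀ w ∈ A n, ∃ γ : b → k, (∀ j, n < a j → γ j = 0) ∧ ∑ j, γ j • (j : W) = w := by
  classical
  obtain ⟨i, hi⟩ : ∃ i : ℕ, ∀ n, A n ≤ A (n0 + i) := by
    let f : ℕ →o Submodule k F :=
      ⟨fun i => (A (n0 + i)).comap F.subtype, fun i i' h =>
        Submodule.comap_mono (hA (by simpa using h))⟩
    obtain ⟨i, hi⟩ := monotone_stabilizes_iff_noetherian.2 (inferInstance : IsNoetherian k F) f
    refine ⟨i, fun n x hx => ?_⟩
    have h1 := hi (i + (n - n0 - i).toNat) (Nat.le_add_right _ _)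
    have h2 : (⟨x, hF n hx⟩ : F) ∈ f (i + (n - n0 - i).toNat) := by
      refine hA ?_ hx
      push_cast
      linarith [Int.self_le_toNat (n - n0 - i)]
    rw [← h1] at h2
    exact h2
  obtain ⟨b, a, hb, h1, h2⟩ := exists_adapted_set A hA n0 h0 i
  have hbF : ∀ x ∈ b, x ∈ F := fun x hx => hF _ (h1 x hx).1
  have hLI : LinearIndependent k ((↑) : b → W) := hb
  have : LinearIndependent k (fun x : b => (⟨x, hbF x x.2⟩ : F)) :=
    LinearIndependent.of_comp F.subtype hLI
  have := this.finite
  have hft : Fintype b := Fintype.ofFinite _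
  refine ⟨b, hft, fun x => a x, hLI, fun x => (h1 x x.2).1, fun n w hw => ?_⟩
  have h3 : w ∈ Submodule.span k (((↑) : b → W) '' {j | a j ≤ n}) := by
    have h4 : w ∈ Submodule.span k (id '' (b ∩ {x | a x ≤ n})) := by
      by_cases hn : n ≤ n0 + i
      · exact h2 n hn hw
      · have h5 : b ∩ {x | a x ≤ n0 + i} ⊆ b ∩ {x | a x ≤ n} := fun x hx =>
          ⟨hx.1, le_trans (show a x ≤ n0 + i from hx.2) (not_le.1 hn).le⟩
        exact Submodule.span_mono (Set.image_mono h5) (h2 _ le_rfl (hi n hw))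
    refine Submodule.span_mono ?_ h4
    rintro _ ⟨x, ⟨hx, hx'⟩, rfl⟩
    exact ⟨⟨x, hx⟩, hx', rfl⟩
  obtain ⟨γ, hγ, hγ'⟩ := (Finsupp.mem_span_image_iff_linearCombination k).1 h3
  refine ⟨γ, fun j hj => ?_, ?_⟩
  · by_contra h
    have := hγ (Finsupp.mem_support_iff.2 h)
    simp only [Set.mem_ofPred_eq] at this
    exact absurd hj (not_lt.2 this)
  · rw [← hγ', Finsupp.linearCombination_apply, Finsupp.sum_fintype _ _ (by simp)]

/-- If `g` has finite-dimensional target, then `U` is, modulo its intersection with the kernel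
of `g`, finite-dimensional. -/
theorem exists_finiteDimensional_sup {Z : Type*} [AddCommGroup Z] [Module k Z]
    [FiniteDimensional k Z] (U : Submodule k W) (g : W →ₗ[k] Z) :
    ∃ F : Submodule k W, FiniteDimensional k F ∧ U ≤ F ⊔ (U ⊓ LinearMap.ker g) := by
  obtain ⟨C, hC⟩ := (U ⊓ LinearMap.ker g).exists_isCompl
  refine ⟨C ⊓ U, ?_, ?_⟩
  · refine Module.Finite.of_injective (g ∘ₗ (C ⊓ U).subtype) ?_
    rw [← LinearMap.ker_eq_bot, Submodule.eq_bot_iff]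
    rintro ⟨x, hx1, hx2⟩ hx
    have : x ∈ (U ⊓ LinearMap.ker g) ⊓ C := ⟨⟨hx2, hx⟩, hx1⟩
    rw [hC.inf_eq_bot] at this
    exact Subtype.ext this
  · intro x hx
    have : x ∈ (U ⊓ LinearMap.ker g) ⊔ C := by rw [hC.sup_eq_top]; trivial
    obtain ⟨y, hy, z, hz, rfl⟩ := Submodule.mem_sup.1 this
    rw [add_comm]
    refine Submodule.add_mem_sup ⟨hz, ?_⟩ hy
    simpa using U.sub_mem hx hy.1

end Flag

section Lattice

universe u

variable {k : Type*} {V : Type u} [Field k] [AddCommGroup V] [Module k V] [Module k[T;T⁻¹] V]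
    [IsScalarTower k k[T;T⁻¹] V]

theorem exists_mem_SLe (ε : ℤ) (f : k[T;T⁻¹]) : ∃ p, f ∈ SLe ε p := by
  obtain ⟨s, hs⟩ := exists_cf_eq_zero f
  refine ⟨∑ n ∈ s, |ε * n|, fun q hq => hs q fun hqs => ?_⟩
  have : |ε * q| ≤ ∑ n ∈ s, |ε * n| :=
    Finset.single_le_sum (f := fun n => |ε * n|) (fun i _ => abs_nonneg _) hqs
  exact absurd hq (not_lt.2 ((le_abs_self _).trans this))

/-- Simultaneous splitting of a vector bundle on the projective line given by lattices at the two
points `0` and `∞`. -/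
theorem exists_splitting (A : ℤ → Submodule k V) (B : Submodule k V)
    (hA : ∀ p q, ∀ c ∈ SLe (k := k) 1 q, ∀ v ∈ A p, c • v ∈ A (q + p))
    (hB : ∀ c ∈ SLe (k := k) (-1) 0, ∀ v ∈ B, c • v ∈ B)
    (n0 : ℤ) (hn0 : A n0 ⊓ B = ⊥) (F : Submodule k V) [FiniteDimensional k F]
    (hF : A 0 ≤ F ⊔ A (-1)) (N : Submodule k[T;T⁻¹] V) (hNA : ∀ x ∈ N, ∃ p, x ∈ A p)
    (hNB : ∀ x ∈ N, ∃ n : ℤ, (T n : k[T;T⁻¹]) • x ∈ B) :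
    ∃ (J : Type u) (_ : Fintype J) (v : J → V) (a : J → ℤ), (∀ j, v j ∈ A (a j)) ∧ (∀ j, v j ∈ B) ∧
      LinearIndependent k[T;T⁻¹] v ∧ N ≤ Submodule.span k[T;T⁻¹] (Set.range v) ∧
      (∀ (c : J → k[T;T⁻¹]) (p : ℤ), ∑ j, c j • v j ∈ A p → ∀ j, c j ∈ SLe 1 (p - a j)) ∧
      ∀ c : J → k[T;T⁻¹], ∑ j, c j • v j ∈ B → ∀ j, c j ∈ SLe (-1) 0 := by
  have hAm : Monotone A := fun p q h v hv => by
    have := hA p (q - p) 1 (by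
      rw [← T_zero]; exact T_mem_SLe (by linarith)) v hv
    rwa [one_smul, sub_add_cancel] at this
  have hAT : ∀ (n p : ℤ) (v : V), v ∈ A p → (T n : k[T;T⁻¹]) • v ∈ A (n + p) := fun n p v hv =>
    hA p n _ (T_mem_SLe (by simp)) v hv
  have hTT : ∀ (n : ℤ) (v : V), (T n : k[T;T⁻¹]) • (T (-n) : k[T;T⁻¹]) • v = v := fun n v => by
    rw [smul_smul, ← T_add, add_neg_cancel, T_zero, one_smul]
  let t : ℤ → V →ₗ[k] V := fun n => (LinearMap.lsmul k[T;T⁻¹] V (T n)).restrictScalars k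
  have ht : ∀ n v, t n v = (T n : k[T;T⁻¹]) • v := fun _ _ => rfl
  let π := (A (-1)).mkQ
  have hπ : ∀ v, π v = 0 ↔ v ∈ A (-1) := fun v => by simp [π]
  let W : ℤ → Submodule k (V ⧸ A (-1)) := fun n => ((A n ⊓ B).map (t (-n))).map π
  have hWm : Monotone W := by
    rintro n n' h _ ⟨_, ⟨v, ⟨hv, hv'⟩, rfl⟩, rfl⟩
    refine ⟨t (-n) v, ⟨(T (n' - n) : k[T;T⁻¹]) • v, ⟨?_, ?_⟩, ?_⟩, rfl⟩
    · have := hAT (n' - n) n v hv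
      rwa [sub_add_cancel] at this
    · exact hB _ (T_mem_SLe (by linarith)) v hv'
    · rw [ht, ht, smul_smul, ← T_add]
      congr 2
      ring
  have hWF : ∀ n, W n ≤ F.map π := by
    rintro n _ ⟨_, ⟨v, ⟨hv, hv'⟩, rfl⟩, rfl⟩
    have h1 := hAT (-n) n v hv
    rw [neg_add_cancel] at h1
    obtain ⟨f, hf, g, hg, h⟩ := Submodule.mem_sup.1 (hF h1)
    refine ⟨f, hf, ?_⟩
    rw [ht, ← h, map_add, (hπ g).2 hg, add_zero]
  have hW0 : W n0 = ⊥ := by simp [W, hn0]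
  obtain ⟨J, hJ, a, hu, hua, hspan⟩ := exists_adapted_basis W hWm n0 hW0 (F.map π) hWF
  have h1 : ∀ j : J, ∃ v, v ∈ A (a j) ∧ v ∈ B ∧ π ((T (-a j) : k[T;T⁻¹]) • v) = j := by
    intro j
    obtain ⟨_, ⟨v, ⟨hv, hv'⟩, rfl⟩, h⟩ := hua j
    exact ⟨v, hv, hv', h⟩
  choose v hvA hvB hvu using h1
  have key : ∀ i : ℕ, ∀ x ∈ A (n0 + i), x ∈ B → ∃ c : J → k[T;T⁻¹],
      (∀ j, c j ∈ SLe (-1) 0) ∧ ∑ j, c j • v j = x := by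
    intro i
    induction i with
    | zero =>
      intro x hx hx'
      have : x ∈ A n0 ⊓ B := ⟨by simpa using hx, hx'⟩
      rw [hn0] at this
      exact ⟨0, fun _ => zero_mem _, by simpa using this.symm⟩
    | succ i ih =>
      intro x hx hx'
      set n : ℤ := n0 + (i + 1 : ℕ) with hn
      have hn' : n - 1 = n0 + i := by rw [hn]; push_cast; ring
      obtain ⟨γ, hγ, hγ'⟩ := hspan n (π ((T (-n) : k[T;T⁻¹]) • x)) ⟨_, ⟨x, ⟨hx, hx'⟩, rfl⟩, rfl⟩
      have hcB : ∀ j, γ j • (T (n - a j) : k[T;T⁻¹]) ∈ SLe (k := k) (-1) 0 := by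
        intro j
        by_cases h : n < a j
        · rw [hγ j h, zero_smul]; exact zero_mem _
        · exact Submodule.smul_mem _ _ (T_mem_SLe (by linarith))
      set x' := x - ∑ j, (γ j • (T (n - a j) : k[T;T⁻¹])) • v j with hx'def
      have hx'B : x' ∈ B := sub_mem hx' (sum_mem fun j _ => hB _ (hcB j) _ (hvB j))
      have hx'A : x' ∈ A (n0 + i) := by
        have h2 : (T (-n) : k[T;T⁻¹]) • x' ∈ A (-1) := by
          rw [← hπ, hx'def, smul_sub, map_sub, Finset.smul_sum, map_sum, ← hγ', sub_eq_zero]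
          refine Finset.sum_congr rfl fun j _ => ?_
          rw [← hvu, ← map_smul, smul_smul, mul_smul_comm, ← T_add, smul_assoc]
          congr 4
          ring
        have := hAT n _ _ h2
        rwa [hTT, ← sub_eq_add_neg, hn'] at this
      obtain ⟨c, hc, hc'⟩ := ih x' hx'A hx'B
      refine ⟨fun j => γ j • T (n - a j) + c j, fun j => add_mem (hcB j) (hc j), ?_⟩
      simp only [add_smul, Finset.sum_add_distrib]
      rw [hc', hx'def]
      abel
  have key' : ∀ p, ∀ x ∈ A p, x ∈ B → ∃ c : J → k[T;T⁻¹],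
      (∀ j, c j ∈ SLe (-1) 0) ∧ ∑ j, c j • v j = x := by
    intro p x hx hx'
    refine key (p - n0).toNat x (hAm ?_ hx) hx'
    linarith [Int.self_le_toNat (p - n0)]
  have hadA : ∀ (c : J → k[T;T⁻¹]) (p : ℤ), ∑ j, c j • v j ∈ A p → ∀ j, c j ∈ SLe 1 (p - a j) := by
    intro c p hc
    have step : ∀ i : ℕ, (∀ j, c j ∈ SLe 1 (p + i - a j)) → ∀ j, c j ∈ SLe 1 (p - a j) := by
      intro i
      induction i with
      | zero => intro h; simpa using h
      | succ i ih =>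
        intro h
        apply ih
        set n : ℤ := p + (i + 1 : ℕ) with hn
        have hn' : n - 1 = p + i := by rw [hn]; push_cast; ring
        rw [← hn']
        set γ : J → k := fun j => cf (n - a j) (c j) with hγ
        have hlow : ∀ j, c j - γ j • (T (n - a j) : k[T;T⁻¹]) ∈ SLe 1 (n - 1 - a j) := by
          intro j q hq
          rw [map_sub, map_smul, cf_T]
          split_ifs with hq'
          · rw [← hq', hγ]; simp
          · rw [h j q (by omega)]; simp
        have h2 : ∑ j, γ j • (j : V ⧸ A (-1)) = 0 := by
          have h3 : ∑ j, (γ j • (T (n - a j) : k[T;T⁻¹])) • v j ∈ A (n - 1) := by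
            have h4 : ∑ j, (c j - γ j • (T (n - a j) : k[T;T⁻¹])) • v j ∈ A (n - 1) :=
              sum_mem fun j _ => by
                have := hA _ _ _ (hlow j) _ (hvA j)
                rwa [sub_add_cancel] at this
            simp only [sub_smul, Finset.sum_sub_distrib] at h4
            have h5 := hAm (show p ≤ n - 1 by rw [hn']; simp) hc
            simpa using sub_mem h5 h4
          have h6 := hAT (-n) _ _ h3
          rw [show -n + (n - 1) = -1 by ring, ← hπ, Finset.smul_sum, map_sum] at h6
          rw [← h6]
          refine Finset.sum_congr rfl fun j _ => ?_
          rw [← hvu, ← map_smul, smul_smul, mul_smul_comm, ← T_add, smul_assoc]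
          congr 4
          ring
        intro j
        have h7 := Fintype.linearIndependent_iff.1 hu γ h2 j
        have h8 := hlow j
        rwa [h7, zero_smul, sub_zero] at h8
    choose q hq using fun j => exists_mem_SLe 1 (c j)
    refine step (∑ j, |q j + a j - p|).toNat fun j => SLe_mono 1 ?_ (hq j)
    have h1 : |q j + a j - p| ≤ ∑ j, |q j + a j - p| :=
      Finset.single_le_sum (f := fun j => |q j + a j - p|) (fun i _ => abs_nonneg _)
        (Finset.mem_univ j)
    have h2 := Int.self_le_toNat (∑ j, |q j + a j - p|)
    have h3 := le_abs_self (q j + a j - p)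
    linarith
  have hLI : LinearIndependent k[T;T⁻¹] v := by
    rw [Fintype.linearIndependent_iff]
    intro c hc j
    refine laurent_ext fun n => ?_
    rw [map_zero]
    exact hadA c (n - 1 + a j) (by rw [hc]; exact zero_mem _) j n (by linarith)
  refine ⟨J, hJ, v, a, hvA, hvB, hLI, fun x hx => ?_, hadA, fun c hc => ?_⟩
  · obtain ⟨n, hn⟩ := hNB x hx
    obtain ⟨p, hp⟩ := hNA _ (N.smul_mem (T n : k[T;T⁻¹]) hx)
    obtain ⟨c, -, hc⟩ := key' p _ hp hn
    have h2 : x = (T (-n) : k[T;T⁻¹]) • ∑ j, c j • v j := by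
      rw [hc, smul_smul, ← T_add, neg_add_cancel, T_zero, one_smul]
    rw [h2]
    exact Submodule.smul_mem _ _ (sum_mem fun j _ =>
      Submodule.smul_mem _ _ (Submodule.subset_span ⟨j, rfl⟩))
  · choose q hq using fun j => exists_mem_SLe 1 (c j)
    have h1 : ∑ j, c j • v j ∈ A (∑ j, |q j + a j|) := by
      refine sum_mem fun j _ => hAm ?_ (hA _ _ _ (hq j) _ (hvA j))
      exact (le_abs_self _).trans (Finset.single_le_sum (f := fun j => |q j + a j|)
        (fun i _ => abs_nonneg _) (Finset.mem_univ j))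
    obtain ⟨c', hc', h2⟩ := key' _ _ h1 hc
    intro j
    have h3 := Fintype.linearIndependent_iff.1 hLI (fun j => c j - c' j)
      (by simp only [sub_smul, Finset.sum_sub_distrib]; rw [h2, sub_self]) j
    rw [sub_eq_zero.1 h3]
    exact hc' j

end Lattice

namespace Gr

universe u

variable {k 𝔤 : Type*} {V : Type u} [Field k] [LieRing 𝔤] [LieAlgebra k 𝔤] [LieRing V]
    [LieAlgebra k V] [LieAlgebra k[T;T⁻¹] V] [IsScalarTower k k[T;T⁻¹] V]
    {M : LoopModel k 𝔤 V} {l : V} (G : Gr M l)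

/-- The lattice filtration induced on a graded piece. -/
def Gs (ε p : ℤ) (x : ℝ) : Submodule k V :=
  (M.VLe ε p ⊓ (G.Fge x).restrictScalars k).map ((G.Q x).restrictScalars k)

theorem mem_Gs {ε p : ℤ} {x : ℝ} {w : V} (hw : w ∈ M.VLe ε p) (hw' : w ∈ G.Fge x) :
    G.Q x w ∈ G.Gs ε p x := ⟨w, ⟨hw, hw'⟩, rfl⟩

theorem mem_Gs_of_mem {ε p : ℤ} {x : ℝ} {w : V} (hw : w ∈ M.VLe ε p) (hw' : G.Q x w = w) :
    w ∈ G.Gs ε p x := by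
  rw [← hw']; exact G.mem_Gs hw (G.mem_Fge hw' le_rfl)

theorem Q_of_mem_Gs {ε p : ℤ} {x : ℝ} {w : V} (hw : w ∈ G.Gs ε p x) : G.Q x w = w := by
  obtain ⟨w, -, rfl⟩ := hw
  exact G.Q_same x w

theorem smul_mem_Gs {ε p q : ℤ} {x : ℝ} {c : k[T;T⁻¹]} {w : V} (hc : c ∈ SLe ε p)
    (hw : w ∈ G.Gs ε q x) : c • w ∈ G.Gs ε (p + q) x := by
  obtain ⟨w, ⟨h1, h2⟩, rfl⟩ := hw
  have := G.mem_Gs (M.smul_mem_VLe hc h1) ((G.Fge x).smul_mem c h2)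
  rwa [map_smul] at this

theorem exists_Gs_bound (ε : ℤ) (x : ℝ) : ∃ K : ℤ, ∀ p, G.Gs ε p x ≤ M.VLe ε (p + K) := by
  obtain ⟨K, hK⟩ := M.exists_bound ε (G.Q x)
  refine ⟨K, ?_⟩
  rintro p _ ⟨w, ⟨h1, -⟩, rfl⟩
  exact hK p w h1

theorem finiteDimensional_Gs (p q : ℤ) (x : ℝ) :
    FiniteDimensional k (G.Gs 1 p x ⊓ G.Gs (-1) q x : Submodule k V) := by
  obtain ⟨K, hK⟩ := G.exists_Gs_bound 1 x
  obtain ⟨K', hK'⟩ := G.exists_Gs_bound (-1) x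
  have := M.finiteDimensional_inf (p + K) (q + K')
  exact Submodule.finiteDimensional_of_le (inf_le_inf (hK p) (hK' q))

theorem exists_splitting (x : ℝ) : ∃ (J : Type u) (_ : Fintype J) (v : J → V) (a : J → ℤ),
    (∀ j, v j ∈ G.Gs 1 (a j) x) ∧ (∀ j, v j ∈ G.Gs (-1) 0 x) ∧
    LinearIndependent k[T;T⁻¹] v ∧ LinearMap.range (G.Q x) ≤ Submodule.span k[T;T⁻¹] (Set.range v) ∧
    (∀ (c : J → k[T;T⁻¹]) (p : ℤ), ∑ j, c j • v j ∈ G.Gs 1 p x → ∀ j, c j ∈ SLe 1 (p - a j)) ∧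
    ∀ c : J → k[T;T⁻¹], ∑ j, c j • v j ∈ G.Gs (-1) 0 x → ∀ j, c j ∈ SLe (-1) 0 := by
  obtain ⟨K, hK⟩ := G.exists_Gs_bound 1 x
  obtain ⟨K', hK'⟩ := G.exists_Gs_bound (-1) x
  have : FiniteDimensional k 𝔤 := Module.Finite.of_basis M.b
  obtain ⟨F, hF, hF'⟩ := exists_finiteDimensional_sup (G.Gs 1 0 x)
    (LinearMap.pi fun n : Finset.Icc 0 K => M.coef n)
  refine LoopMAD.exists_splitting (fun p => G.Gs 1 p x) (G.Gs (-1) 0 x)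
    (fun p q c hc v hv => G.smul_mem_Gs hc hv) (fun c hc v hv => ?_) (-1 - K - K') ?_ F ?_ _ ?_ ?_
  · simpa using G.smul_mem_Gs hc hv
  · rw [Submodule.eq_bot_iff]
    rintro v ⟨h1, h2⟩
    exact M.inf_eq_zero (by linarith) (hK _ h1) (hK' _ h2)
  · refine hF'.trans (sup_le_sup_left ?_ F)
    rintro v ⟨h1, h2⟩
    have h3 : ∀ n ∈ Finset.Icc 0 K, M.coef n v = 0 := fun n hn =>
      congrFun (LinearMap.mem_ker.1 h2) ⟨n, hn⟩
    refine G.mem_Gs_of_mem (fun q hq => ?_) (G.Q_of_mem_Gs h1)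
    by_cases hqK : q ≤ K
    · exact h3 q (Finset.mem_Icc.2 ⟨by omega, hqK⟩)
    · exact hK 0 h1 q (by omega)
  · rintro _ ⟨v, rfl⟩
    obtain ⟨p, hp⟩ := M.exists_mem_VLe 1 (G.Q x v)
    exact ⟨p, G.mem_Gs_of_mem hp (G.Q_same x v)⟩
  · rintro _ ⟨v, rfl⟩
    obtain ⟨p, hp⟩ := M.exists_mem_VLe (-1) (G.Q x v)
    refine ⟨p, ?_⟩
    have := G.smul_mem_Gs (T_mem_SLe (ε := -1) (p := -p) (n := p) (by linarith))
      (G.mem_Gs_of_mem hp (G.Q_same x v))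
    rwa [neg_add_cancel] at this

/-- A homogeneous basis compatible with the lattice at `0` (`ε = -1`) or `∞` (`ε = 1`). -/
structure IsAdapted {I : Type*} (v : Module.Basis I k[T;T⁻¹] V) (x : I → ℝ) (a : I → ℤ)
    (ε : ℤ) : Prop where
  lift : ∀ i, ∃ w ∈ M.VLe ε (a i), w ∈ G.Fge (x i) ∧ G.Q (x i) w = v i
  coord : ∀ p, ∀ w ∈ M.VLe ε p, ∀ i, w ∈ G.Fge (x i) → v.repr w i ∈ SLe ε (p - a i)

theorem exists_isAdapted : ∃ (I : Type u) (_ : Fintype I) (v : Module.Basis I k[T;T⁻¹] V)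
    (x : I → ℝ) (a : I → ℤ), (∀ i, G.Q (x i) (v i) = v i) ∧ (∀ i, x i ∈ G.X) ∧
      G.IsAdapted v x a 1 ∧ G.IsAdapted v x 0 (-1) := by
  choose J hJ v a hvA hvB hLI hspan hadA hadB using G.exists_splitting
  have hQv : ∀ x j, G.Q x (v x j) = v x j := fun x j => G.Q_of_mem_Gs (hvA x j)
  let v' : (Σ x : G.X, J x) → V := fun i => v i.1 i.2
  have hQsum : ∀ (c : (Σ x : G.X, J x) → k[T;T⁻¹]) (x : G.X),
      G.Q x (∑ i, c i • v' i) = ∑ j, c ⟨x, j⟩ • v x j := by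
    intro c x
    rw [map_sum, Fintype.sum_sigma, Finset.sum_eq_single_of_mem x (Finset.mem_univ _)]
    · exact Finset.sum_congr rfl fun j _ => by rw [map_smul, hQv]
    · intro y _ hy
      refine Finset.sum_eq_zero fun j _ => ?_
      change G.Q x (c ⟨y, j⟩ • v y j) = 0
      rw [map_smul, ← hQv y j, G.Q_Q, if_neg, smul_zero]
      exact fun h => hy (Subtype.ext h.symm)
  have hLI' : LinearIndependent k[T;T⁻¹] v' := by
    rw [Fintype.linearIndependent_iff]
    rintro c hc ⟨x, j⟩
    have := hQsum c x
    rw [hc, map_zero] at this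
    exact Fintype.linearIndependent_iff.1 (hLI x) (fun j => c ⟨x, j⟩) this.symm j
  have hspan' : ⊤ ≤ Submodule.span k[T;T⁻¹] (Set.range v') := by
    intro w _
    rw [← G.sum_Q w]
    refine sum_mem fun x hx => ?_
    refine Submodule.span_mono ?_ (hspan x ⟨w, rfl⟩)
    rintro _ ⟨j, rfl⟩
    exact ⟨⟨⟨x, hx⟩, j⟩, rfl⟩
  let b := Module.Basis.mk hLI' hspan'
  have hb : ∀ i, b i = v' i := fun i => Module.Basis.mk_apply _ _ _
  have hrepr : ∀ (x : G.X) (w : V), ∑ j, b.repr w ⟨x, j⟩ • v x j = G.Q x w := by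
    intro x w
    rw [← hQsum]
    congr 1
    conv_rhs => rw [← b.sum_repr w]
    exact Finset.sum_congr rfl fun i _ => by rw [hb]
  refine ⟨_, inferInstance, b, fun i => i.1, fun i => a i.1 i.2, fun i => ?_, fun i => i.1.2,
    ⟨fun i => ?_, ?_⟩, ⟨fun i => ?_, ?_⟩⟩
  · rw [hb]; exact hQv _ _
  · rw [hb]
    obtain ⟨w, ⟨h1, h2⟩, h3⟩ := hvA i.1 i.2
    exact ⟨w, h1, h2, h3⟩
  · rintro p w hw ⟨x, j⟩ hwx
    refine hadA x (fun j => b.repr w ⟨x, j⟩) p ?_ j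
    rw [hrepr]
    exact G.mem_Gs hw hwx
  · rw [hb]
    obtain ⟨w, ⟨h1, h2⟩, h3⟩ := hvB i.1 i.2
    exact ⟨w, h1, h2, h3⟩
  · rintro p w hw ⟨x, j⟩ hwx
    have h1 : (T p : k[T;T⁻¹]) • w ∈ M.VLe (-1) 0 := by
      have := M.smul_mem_VLe (T_mem_SLe (ε := -1) (p := -p) (n := p) (by linarith)) hw
      rwa [neg_add_cancel] at this
    have h2 := hadB x (fun j => b.repr ((T p : k[T;T⁻¹]) • w) ⟨x, j⟩) (by
      rw [hrepr]
      exact G.mem_Gs h1 ((G.Fge x).smul_mem _ hwx)) j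
    have h3 := mul_mem_SLe (T_mem_SLe (k := k) (ε := -1) (p := p) (n := -p) (by linarith)) h2
    rw [map_smul, Finsupp.smul_apply, smul_eq_mul, ← mul_assoc, ← T_add, neg_add_cancel, T_zero,
      one_mul] at h3
    simpa using h3

end Gr

namespace LoopModel

variable {k 𝔤 V : Type*} [Field k] [LieRing 𝔤] [LieAlgebra k 𝔤] [LieRing V]
    [LieAlgebra k V] [LieAlgebra k[T;T⁻¹] V] [IsScalarTower k k[T;T⁻¹] V]
    (M : LoopModel k 𝔤 V)

/-- The difference between the flat connection with horizontal basis `v` and `d`. -/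
def conn {I : Type*} (v : Module.Basis I k[T;T⁻¹] V) : Module.End k[T;T⁻¹] V :=
  v.constr k[T;T⁻¹] fun i => -M.d (v i)

theorem conn_basis {I : Type*} (v : Module.Basis I k[T;T⁻¹] V) (i : I) :
    M.conn v (v i) = -M.d (v i) := v.constr_basis _ _ _

theorem d_add_conn {I : Type*} [Fintype I] (v : Module.Basis I k[T;T⁻¹] V) (w : V) :
    M.d w + M.conn v w = ∑ i, dS (v.repr w i) • v i := by
  conv_lhs => rw [← v.sum_repr w]
  simp only [map_sum, d_smul, map_smul, conn_basis, Finset.sum_add_distrib, smul_neg,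
    Finset.sum_neg_distrib, add_neg_cancel_right]

end LoopModel

namespace Gr

variable {k 𝔤 V : Type*} [Field k] [LieRing 𝔤] [LieAlgebra k 𝔤] [LieRing V]
    [LieAlgebra k V] [LieAlgebra k[T;T⁻¹] V] [IsScalarTower k k[T;T⁻¹] V]
    {M : LoopModel k 𝔤 V} {l : V} (G : Gr M l)

section

variable {I : Type*} {v : Module.Basis I k[T;T⁻¹] V} {x : I → ℝ}

theorem lie_eq_sum (w : V) : ⁅l, w⁆ = ∑ z ∈ G.X, G.c z • G.Q z w := by
  conv_lhs => rw [← G.sum_Q w]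
  rw [lie_sum]
  exact Finset.sum_congr rfl fun z _ => G.lie_l z w

theorem Q_basis (hv : ∀ i, G.Q (x i) (v i) = v i) (y : ℝ) (i : I) :
    G.Q y (v i) = if x i = y then v i else 0 := by
  rw [← hv i, G.Q_Q]
  split_ifs with h h' h'
  · rw [h]
  · exact absurd h.symm h'
  · exact absurd h'.symm h
  · rfl

variable [Fintype I]

theorem repr_Q (hv : ∀ i, G.Q (x i) (v i) = v i) (y : ℝ) (w : V) (i : I) :
    v.repr (G.Q y w) i = if x i = y then v.repr w i else 0 := by
  classical
  conv_lhs => rw [← v.sum_repr w]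
  simp only [map_sum, map_smul, G.Q_basis hv, Finsupp.coe_finsetSum, Finset.sum_apply,
    Finsupp.smul_apply]
  rw [Finset.sum_eq_single i]
  · split_ifs <;> simp
  · intro j _ hj
    split_ifs <;> simp [hj]
  · simp

theorem repr_eq_zero (hv : ∀ i, G.Q (x i) (v i) = v i) {y : ℝ} {w : V} {i : I}
    (hw : G.Q y w = 0) (h : x i = y) :
    v.repr w i = 0 := by
  have := G.repr_Q hv y w i
  rwa [hw, if_pos h, map_zero, Finsupp.zero_apply, eq_comm] at this

theorem conn_Q (hv : ∀ i, G.Q (x i) (v i) = v i) (y : ℝ) (w : V) :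
    M.d (G.Q y w) + M.conn v (G.Q y w) = G.Q y (M.d w + M.conn v w) := by
  rw [M.d_add_conn, M.d_add_conn, map_sum]
  refine Finset.sum_congr rfl fun i _ => ?_
  rw [map_smul, G.Q_basis hv, G.repr_Q hv]
  split_ifs <;> simp

/-- Flat connections preserving the grading commute with `ad l`. -/
theorem conn_lie (hv : ∀ i, G.Q (x i) (v i) = v i) (w : V) :
    ⁅M.d l, w⁆ = ⁅l, M.conn v w⁆ - M.conn v ⁅l, w⁆ := by
  have h : M.d ⁅l, w⁆ + M.conn v ⁅l, w⁆ = ⁅l, M.d w + M.conn v w⁆ := by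
    have hk : ∀ (a : k) (w : V), M.conn v (a • w) = a • M.conn v w := fun a w =>
      (M.conn v).map_smul_of_tower a w
    rw [G.lie_eq_sum, G.lie_eq_sum, map_sum, map_sum, ← Finset.sum_add_distrib]
    refine Finset.sum_congr rfl fun z _ => ?_
    rw [map_smul, hk, ← smul_add, G.conn_Q hv]
  rw [M.d_lie, lie_add] at h
  linear_combination (norm := abel) h

theorem d_add_lie_pr (hv : ∀ i, G.Q (x i) (v i) = v i) : M.d l + ⁅M.pr (M.conn v), l⁆ = 0 := by
  refine M.κ_nondeg fun u => ?_
  have h1 : M.ad (M.d l) = M.ad l * M.conn v - M.conn v * M.ad l := by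
    ext w
    exact G.conn_lie hv w
  have h2 : M.ad ⁅l, u⁆ = M.ad l * M.ad u - M.ad u * M.ad l := by
    ext w; simp
  rw [map_add, LinearMap.add_apply, M.κ_lie, M.κ_pr, M.κ_eq, h1, h2, sub_mul, mul_sub, map_sub,
    map_sub, mul_assoc, LinearMap.trace_mul_comm, mul_assoc, mul_assoc]
  abel

end

variable {I : Type*} [Fintype I] {v : Module.Basis I k[T;T⁻¹] V} {x : I → ℝ} {a : I → ℤ} {ε : ℤ}

theorem exists_lift_expansion (hv : ∀ i, G.Q (x i) (v i) = v i)
    (hcoord : ∀ p, ∀ w ∈ M.VLe ε p, ∀ i, w ∈ G.Fge (x i) → v.repr w i ∈ SLe ε (p - a i))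
    {w : I → V} (hw : ∀ i, w i ∈ M.VLe ε (a i)) (hw' : ∀ i, w i ∈ G.Fge (x i))
    (hQ : ∀ i, G.Q (x i) (w i) = v i) (p : ℤ) (s : Finset ℝ) :
    (∀ y ∈ G.X, y ∉ s → ∀ z ∈ s, y < z) → ∀ u ∈ M.VLe ε p, (∀ y ∉ s, G.Q y u = 0) →
      ∃ c : I → k[T;T⁻¹], (∀ i, c i ∈ SLe ε (p - a i)) ∧ (∀ i, x i ∉ s → c i = 0) ∧
        ∑ i, c i • w i = u := by
  classical
  induction s using Finset.induction_on_min with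
  | empty =>
    intro _ u _ hu
    refine ⟨0, fun i => zero_mem _, fun _ _ => rfl, ?_⟩
    rw [← G.sum_Q u]
    simp [hu]
  | insert z s hz ih =>
    intro hs u hu hQu
    have hzs : z ∉ s := fun h => lt_irrefl _ (hz z h)
    have hge : u ∈ G.Fge z := fun y hy => hQu y fun h => by
      rcases Finset.mem_insert.1 h with rfl | h
      · exact lt_irrefl _ hy
      · exact lt_asymm hy (hz y h)
    let c₀ : I → k[T;T⁻¹] := fun i => if x i = z then v.repr u i else 0
    have hc₀ : ∀ i, c₀ i ∈ SLe ε (p - a i) := by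
      intro i
      by_cases h : x i = z
      · rw [show c₀ i = v.repr u i from if_pos h]
        exact hcoord p u hu i (h ▸ hge)
      · rw [show c₀ i = 0 from if_neg h]
        exact zero_mem _
    have hQw : ∀ y ≤ z, ∀ i, c₀ i • G.Q y (w i) = if x i = y then c₀ i • v i else 0 := by
      intro y hy i
      by_cases h : x i = z
      · split_ifs with h'
        · rw [← h', hQ]
        · rw [hw' i y (lt_of_le_of_ne (hy.trans h.ge) (Ne.symm h')), smul_zero]
      · rw [show c₀ i = 0 from if_neg h]; simp
    obtain ⟨c, hc1, hc2, hc3⟩ := ih (fun y hy hys t ht => by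
        by_cases h : y = z
        · exact h ▸ hz t ht
        · exact hs y hy (by simp [h, hys]) t (Finset.mem_insert_of_mem ht))
      (u - ∑ i, c₀ i • w i)
      (sub_mem hu (sum_mem fun i _ => by
        simpa using M.smul_mem_VLe (hc₀ i) (hw i)))
      (fun y hys => by
        by_cases hyX : y ∈ G.X
        · have hyz : y ≤ z := by
            by_cases h : y = z
            · exact h.le
            · exact (hs y hyX (by simp [h, hys]) z (Finset.mem_insert_self _ _)).le
          simp only [map_sub, map_sum, map_smul, hQw y hyz]
          rcases hyz.lt_or_eq with h | rfl
          · rw [hge y h, Finset.sum_eq_zero, sub_zero]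
            intro i _
            split_ifs with h'
            · rw [show c₀ i = 0 from if_neg fun h'' => h.ne (h'.symm.trans h''), zero_smul]
            · rfl
          · rw [sub_eq_zero]
            conv_lhs => rw [← v.sum_repr u]
            simp only [map_sum, map_smul, G.Q_basis hv]
            refine Finset.sum_congr rfl fun i _ => ?_
            by_cases h : x i = y
            · simp [c₀, h]
            · simp [h]
        · exact G.Q_eq_zero y hyX _)
    refine ⟨fun i => c i + c₀ i, fun i => add_mem (hc1 i) (hc₀ i), fun i hi => ?_, ?_⟩
    · change c i + c₀ i = 0
      rw [hc2 i fun h => hi (Finset.mem_insert_of_mem h),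
          show c₀ i = 0 from if_neg fun h : x i = z =>
        hi (h.symm ▸ Finset.mem_insert_self _ _), add_zero]
    · simp only [add_smul, Finset.sum_add_distrib, hc3, sub_add_cancel]

/-- A lift of an adapted homogeneous basis is a basis adapted to the lattice and the filtration. -/
theorem exists_lift_basis (hv : ∀ i, G.Q (x i) (v i) = v i) (h : G.IsAdapted v x a ε) :
    ∃ w : Module.Basis I k[T;T⁻¹] V, (∀ i, w i ∈ M.VLe ε (a i)) ∧ (∀ i, w i ∈ G.Fge (x i)) ∧
      (∀ i, G.Q (x i) (w i) = v i) ∧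
      (∀ p, ∀ u ∈ M.VLe ε p, ∀ i, w.repr u i ∈ SLe ε (p - a i)) ∧
      ∀ z, ∀ u ∈ G.Fge z, ∀ i, x i < z → w.repr u i = 0 := by
  classical
  choose w hw1 hw2 hw3 using h.lift
  have key := G.exists_lift_expansion hv h.coord hw1 hw2 hw3
  let W := v.constr k[T;T⁻¹] w
  have hsurj : Function.Surjective W := by
    intro u
    obtain ⟨p, hp⟩ := M.exists_mem_VLe ε u
    obtain ⟨c, -, -, rfl⟩ := key p G.X (fun y hy hy' => absurd hy hy') u hp
      (fun y hy => G.Q_eq_zero y hy u)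
    exact ⟨∑ i, c i • v i, by simp [W]⟩
  have := M.finite
  let b := v.map (LinearEquiv.ofBijective W
    ⟨OrzechProperty.injective_of_surjective_endomorphism W hsurj, hsurj⟩)
  have hb : ∀ i, b i = w i := fun i => by
    rw [Module.Basis.map_apply]
    exact v.constr_basis k[T;T⁻¹] _ _
  have hrepr : ∀ (c : I → k[T;T⁻¹]) i, b.repr (∑ i, c i • w i) i = c i := by
    intro c i
    simp_rw [← hb, b.repr_sum_self]
  refine ⟨b, fun i => hb i ▸ hw1 i, fun i => hb i ▸ hw2 i, fun i => hb i ▸ hw3 i, ?_, ?_⟩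
  · intro p u hu i
    obtain ⟨c, hc, -, rfl⟩ := key p G.X (fun y hy hy' => absurd hy hy') u hu
      (fun y hy => G.Q_eq_zero y hy u)
    rw [hrepr]
    exact hc i
  · intro z u hu i hi
    obtain ⟨p, hp⟩ := M.exists_mem_VLe ε u
    obtain ⟨c, -, hc, rfl⟩ := key p (G.X.filter (z ≤ ·)) (fun y hy hy' t ht => by
      simp only [Finset.mem_filter, not_and, not_le] at hy' ht
      exact (hy' hy).trans_le ht.2) u hp (fun y hy => by
        by_cases hyX : y ∈ G.X
        · simp only [Finset.mem_filter, not_and, not_le] at hy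
          exact hu y (hy hyX)
        · exact G.Q_eq_zero y hyX _)
    rw [hrepr]
    exact hc i (by simp [hi])

theorem trace_eq_zero (hv : ∀ i, G.Q (x i) (v i) = v i) {R : Module.End k[T;T⁻¹] V}
    (hR : ∀ i, R (v i) ∈ G.Fgt (x i)) : M.tr R = 0 := by
  classical
  rw [LoopModel.tr, LinearMap.trace_eq_matrix_trace _ v, Matrix.trace]
  refine Finset.sum_eq_zero fun i _ => ?_
  rw [Matrix.diag_apply, LinearMap.toMatrix_apply]
  exact G.repr_eq_zero hv (hR i _ le_rfl) rfl

/-- The inner part of a homogeneous adapted connection preserves the lattice up to a strictly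
positive term. -/
theorem exists_pr_conn_eq (hv : ∀ i, G.Q (x i) (v i) = v i) (h : G.IsAdapted v x a ε) :
    ∃ y₀ ∈ M.VLe ε 0, ∃ y₁ ∈ G.Fgt 0, M.pr (M.conn v) = y₀ + y₁ := by
  classical
  obtain ⟨w, hw1, hw2, hw3, hw4, hw5⟩ := G.exists_lift_basis hv h
  set R := M.conn v - M.conn w with hR
  have hRw : ∀ i, R (w i) ∈ G.Fgt (x i) := by
    intro i y hy
    have h1 : R (w i) = M.d (w i) + M.conn v (w i) := by
      rw [hR, LinearMap.sub_apply, M.conn_basis]; abel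
    rw [h1, ← G.conn_Q hv]
    rcases hy.lt_or_eq with hy | rfl
    · rw [hw2 i y hy]; simp
    · rw [hw3, M.conn_basis, add_neg_cancel]
  have hRF : ∀ z, ∀ u ∈ G.Fge z, R u ∈ G.Fgt z := by
    intro z u hu
    rw [← w.sum_repr u, map_sum]
    refine sum_mem fun i _ => ?_
    rw [map_smul]
    by_cases hi : x i < z
    · rw [hw5 z u hu i hi, zero_smul]; exact zero_mem _
    · exact (G.Fgt z).smul_mem _ fun y hy => hRw i y (hy.trans (not_lt.1 hi))
  refine ⟨M.pr (M.conn w), M.pr_mem_VLe fun p u hu => ?_, M.pr R, fun z hz => ?_, ?_⟩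
  · have : M.conn w u = ∑ i, dS (w.repr u i) • w i - M.d u := by
      rw [← M.d_add_conn]; abel
    rw [this]
    refine sub_mem (sum_mem fun i _ => ?_) (M.d_mem_VLe hu)
    simpa using M.smul_mem_VLe (dS_mem_SLe (hw4 p u hu i)) (hw1 i)
  · refine M.κ_nondeg fun u => ?_
    rw [G.κ_Q, M.κ_pr]
    refine G.trace_eq_zero hv fun i => ?_
    refine hRF _ _ (G.mem_Fge (G.lie_mem (G.Q_same (-z) u) (hv i)) (by linarith))
  · rw [← M.pr_add, hR, add_sub_cancel]

end Gr

namespace Twist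

section

variable {k 𝔤 V : Type*} [Field k] [LieRing 𝔤] [LieAlgebra k 𝔤] [LieRing V]
    [LieAlgebra k V] [LieAlgebra k[T;T⁻¹] V] [IsScalarTower k k[T;T⁻¹] V] (τ : Twist k 𝔤)
    {M : LoopModel k 𝔤 V} {l : V}

theorem av_mem_VLe {ε p : ℤ} {v : V} (hv : v ∈ M.VLe ε p) : τ.av M v ∈ M.VLe ε p := by
  rw [av_apply]
  refine Submodule.smul_mem _ _ (sum_mem fun i hi => ?_)
  clear hi
  induction i with
  | zero => simpa using hv
  | succ i ih =>
    rw [pow_succ', Module.End.mul_apply]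
    exact M.Sg_mem_VLe τ ih

theorem av_mem_Fgt (G : Gr M l) (hl : l ∈ τ.L M) {x : ℝ} {v : V} (hv : v ∈ G.Fgt x) :
    τ.av M v ∈ G.Fgt x := by
  intro y hy
  have h := τ.av_commute M (f := (G.Q y).restrictScalars k) (fun v =>
    (G.commute_Q (D := (τ.Sg M).toAddMonoidHom) (fun a v => map_smul (τ.Sg M) a v)
      (fun v => (τ.ad_Sg M hl v).symm) y v).symm) v
  simpa [hv y hy] using h

end

theorem Gr.locallyFinite {k 𝔤 V : Type*} [Field k] [LieRing 𝔤] [LieAlgebra k 𝔤] [LieRing V]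
    [LieAlgebra k V] [LieAlgebra k[T;T⁻¹] V] [IsScalarTower k k[T;T⁻¹] V]
    {M : LoopModel k 𝔤 V} {l : V} (G : Gr M l) {Y : V} (hYl : M.Dg Y l = 0)
    (hY : ∀ ε : ℤ, ε = 1 ∨ ε = -1 → ∃ y₀ ∈ M.VLe ε 0, ∃ y₁ ∈ G.Fgt 0, Y = y₀ + y₁) :
    LocallyFinite (M.Dg Y) := by
  have hQ : ∀ x v, M.Dg Y (G.Q x v) = G.Q x (M.Dg Y v) :=
    G.commute_Q (D := (M.Dg Y).toAddMonoidHom) (fun a v => map_smul (M.Dg Y) a v)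
      (fun v => by simp [M.Dg_lie, hYl])
  have hstab : ∀ ε : ℤ, ε = 1 ∨ ε = -1 → ∀ p x, ∀ v ∈ G.Gs ε p x, M.Dg Y v ∈ G.Gs ε p x := by
    rintro ε hε p x _ ⟨w, ⟨h1, h2⟩, rfl⟩
    obtain ⟨y₀, hy₀, y₁, hy₁, hYe⟩ := hY ε hε
    have h3 : M.d w + ⁅y₀, w⁆ ∈ M.VLe ε p := by
      refine add_mem (M.d_mem_VLe h1) ?_
      simpa using M.lie_mem_VLe hy₀ h1
    have h4 : ⁅y₁, w⁆ ∈ G.Fgt x := by simpa using G.lie_mem_Fgt hy₁ h2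
    have h5 : M.d w + ⁅y₀, w⁆ = M.Dg Y w - ⁅y₁, w⁆ := by
      rw [M.Dg_apply, hYe, add_lie]; abel
    have h6 : M.d w + ⁅y₀, w⁆ ∈ G.Fge x := by
      rw [h5]
      refine sub_mem (fun y hy => ?_) (G.Fgt_le x h4)
      rw [← hQ, h2 y hy, map_zero]
    have h7 := G.mem_Gs h3 h6
    rw [h5, map_sub, h4 x le_rfl, sub_zero, ← hQ] at h7
    exact h7
  intro v
  choose n hn using fun x : G.X => M.exists_mem_VLe 1 (G.Q x v)
  choose n' hn' using fun x : G.X => M.exists_mem_VLe (-1) (G.Q x v)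
  have := fun x : G.X => G.finiteDimensional_Gs (n x) (n' x) x
  refine ⟨⨆ x : G.X, G.Gs 1 (n x) x ⊓ G.Gs (-1) (n' x) x, inferInstance, ?_, ?_⟩
  · rw [← G.sum_Q v]
    exact sum_mem fun x hx => Submodule.mem_iSup_of_mem (⟨x, hx⟩ : G.X)
      ⟨G.mem_Gs_of_mem (hn ⟨x, hx⟩) (G.Q_same x v), G.mem_Gs_of_mem (hn' ⟨x, hx⟩) (G.Q_same x v)⟩
  · intro w hw
    have : (⨆ x : G.X, G.Gs 1 (n x) x ⊓ G.Gs (-1) (n' x) x) ≤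
        (⨆ x : G.X, G.Gs 1 (n x) x ⊓ G.Gs (-1) (n' x) x).comap (M.Dg Y) :=
      iSup_le fun x u hu => Submodule.mem_iSup_of_mem x
        ⟨hstab 1 (Or.inl rfl) _ _ u hu.1, hstab (-1) (Or.inr rfl) _ _ u hu.2⟩
    exact this hw

universe u

variable {k 𝔤 : Type*} {V : Type u} [Field k] [CharZero k] [LieRing 𝔤] [LieAlgebra k 𝔤] [LieRing V]
    [LieAlgebra k V] [LieAlgebra k[T;T⁻¹] V] [IsScalarTower k k[T;T⁻¹] V] (τ : Twist k 𝔤)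
    (M : LoopModel k 𝔤 V)

theorem exists_locallyFinite {l : V} (hl : l ∈ τ.L M)
    (hdiag : ⨆ α, (LieAlgebra.ad k V l).eigenspace α = ⊤) :
    ∃ Y ∈ τ.L M, M.Dg Y l = 0 ∧ LocallyFinite (M.Dg Y) := by
  obtain ⟨G⟩ := exists_gr M hdiag
  obtain ⟨I, _, v, x, a, hv, -, h1, h2⟩ := G.exists_isAdapted
  have h3 : M.Dg (τ.av M (M.pr (M.conn v))) l = 0 := by
    have h4 := G.d_add_lie_pr hv
    have h5 := τ.av_commute M (f := LieAlgebra.ad k V l) (fun v => τ.ad_Sg M hl v)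
      (M.pr (M.conn v))
    rw [← lie_skew, add_neg_eq_zero] at h4
    rw [LieAlgebra.ad_apply, LieAlgebra.ad_apply, ← h4, τ.av_of_mem M (τ.d_mem_L M hl)] at h5
    rw [M.Dg_apply, ← lie_skew, h5, add_neg_cancel]
  refine ⟨τ.av M (M.pr (M.conn v)), τ.av_mem M _, h3, Gr.locallyFinite G h3 ?_⟩
  intro ε hε
  obtain ⟨y₀, hy₀, y₁, hy₁, h⟩ :
      ∃ y₀ ∈ M.VLe ε 0, ∃ y₁ ∈ G.Fgt 0, M.pr (M.conn v) = y₀ + y₁ := by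
    rcases hε with rfl | rfl
    · exact G.exists_pr_conn_eq hv h1
    · exact G.exists_pr_conn_eq hv h2
  exact ⟨_, τ.av_mem_VLe hy₀, _, τ.av_mem_Fgt G hl hy₁, by rw [h, map_add]⟩

/-- An ad-diagonalizable invariant element commutes with some diagonalizable `d + ad Y`. -/
theorem exists_diag_Dg [IsAlgClosed k] {l : V} (hl : l ∈ τ.L M)
    (hdiag : ⨆ α, (LieAlgebra.ad k V l).eigenspace α = ⊤) :
    ∃ Y ∈ τ.L M, M.Dg Y l = 0 ∧ ⨆ α, (M.Dg Y).eigenspace α = ⊤ := by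
  obtain ⟨Y, hY, hYl, hlf⟩ := τ.exists_locallyFinite M hl hdiag
  obtain ⟨g, hg, hgt, hgc, hg0, -⟩ := exists_semisimple_part (M.Dg Y) (M.Dg_lie Y) hlf
  have hgT : ∀ (n : ℤ) (v : V), g ((T n : k[T;T⁻¹]) • v) =
      (T n : k[T;T⁻¹]) • g v + (n : k) • (T n : k[T;T⁻¹]) • v := by
    intro n v
    let F : Module.End k V := (LinearMap.lsmul k[T;T⁻¹] V (T n)).restrictScalars k
    exact hgc F n (fun v => by simp [F, M.Dg_T]) v
  obtain ⟨Z, hZ⟩ := exists_eq_lie M (g - M.d)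
    (fun v w => by
      simp only [LinearMap.sub_apply, hg, M.d_lie, sub_lie, lie_sub]; abel)
    (fun n v => by
      simp only [LinearMap.sub_apply, hgT, M.d_T_smul, smul_sub]; abel)
  have hgZ : M.Dg Z = g := by
    ext v
    rw [M.Dg_apply, ← hZ, LinearMap.sub_apply, add_sub_cancel]
  refine ⟨Z, τ.mem_L_of_commute M fun v => ?_, ?_, hgZ ▸ hgt⟩
  · have h1 := hgc (τ.Sg M) 0 (fun v => by simp [τ.Dg_Sg M hY]) v
    rw [zero_smul, add_zero] at h1
    rw [← hZ, ← hZ, LinearMap.sub_apply, LinearMap.sub_apply, map_sub, h1, τ.Sg_d]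
  · rw [hgZ]; exact hg0 l hYl

end Twist

theorem LoopModel.sum_mon {k 𝔤 V : Type*} [Field k] [LieRing 𝔤] [LieAlgebra k 𝔤] [LieRing V]
    [LieAlgebra k V] [LieAlgebra k[T;T⁻¹] V] [IsScalarTower k k[T;T⁻¹] V]
    (M : LoopModel k 𝔤 V) (v : V) : ((M.E.symm v).sum fun p y => M.mon p y) = v := by
  apply M.E.symm.injective
  simp only [Finsupp.sum, map_sum, M.E_symm_mon]
  exact (M.E.symm v).sum_single

variable (k 𝔤 : Type*) [Field k] [LieRing 𝔤] [LieAlgebra k 𝔤]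

theorem killingForm_one_tmul [FiniteDimensional k 𝔤] (A : Type*) [CommRing A] [Algebra k A]
    (x y : 𝔤) : killingForm A (A ⊗[k] 𝔤) (1 ⊗ₜ x) (1 ⊗ₜ y) =
      algebraMap k A (killingForm k 𝔤 x y) := by
  have h : ∀ x : 𝔤, LieAlgebra.ad A (A ⊗[k] 𝔤) (1 ⊗ₜ x) = (LieAlgebra.ad k 𝔤 x).baseChange A := by
    intro x
    ext y
    simp
  rw [killingForm_apply_apply, killingForm_apply_apply, h, h, ← LinearMap.baseChange_comp,
    LinearMap.trace_baseChange]

/-- The base change `k[T;T⁻¹] ⊗ 𝔤` as a model of the loop algebra. -/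
def loopModel [FiniteDimensional k 𝔤] [CharZero k] [LieAlgebra.IsSimple k 𝔤] :
    LoopModel k 𝔤 (k[T;T⁻¹] ⊗[k] 𝔤) where
  j := TensorProduct.mk k k[T;T⁻¹] 𝔤 1
  j_lie x y := by simp
  E := (LieAlgebra.LoopAlgebra.toFinsupp k ℤ 𝔤).symm
  E_single p y := by
    rw [TensorProduct.mk_apply, TensorProduct.smul_tmul', smul_eq_mul, mul_one]
    exact LieAlgebra.LoopAlgebra.toFinsupp_symm_single k ℤ 𝔤 p y
  I := Fin (Module.finrank k 𝔤)
  b := Module.finBasis k 𝔤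
  b' := (killingForm k 𝔤).dualBasis (LieAlgebra.IsKilling.killingForm_nondegenerate k 𝔤)
    (Module.finBasis k 𝔤)
  dual i i' := by
    rw [LieModule.traceForm_comm, LinearMap.BilinForm.apply_dualBasis_left]
  e := (Module.finBasis k 𝔤).baseChange k[T;T⁻¹]
  he i := by simp
  killing x y := killingForm_one_tmul k 𝔤 k[T;T⁻¹] x y

section

variable {k H : Type} [Field k] [LieRing H] [LieAlgebra k H]

theorem three_le_rank {W : Submodule k H} {f : Fin 3 → H} (hf : LinearIndependent k f)
    (hW : ∀ i, f i ∈ W) : 3 ≤ Module.rank k W := by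
  have : LinearIndependent k (fun i => (⟨f i, hW i⟩ : W)) :=
    LinearIndependent.of_comp W.subtype hf
  simpa using this.cardinal_le_rank

theorem le_span_pair {W : Submodule k H} (h : ¬ 3 ≤ Module.rank k W) {x y : H} (hx : x ∈ W)
    (hy : y ∈ W) (hli : LinearIndependent k ![x, y]) : W ≤ Submodule.span k {x, y} := by
  intro z hz
  by_contra hzs
  refine h (three_le_rank (f := Fin.cons z ![x, y]) ?_ ?_)
  · rw [linearIndependent_finCons]
    refine ⟨hli, ?_⟩
    simpa [Set.pair_comm] using hzs
  · intro i
    fin_cases i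
    · exact hz
    · exact hx
    · exact hy

/-- The elements having `z` as an eigenvector. -/
def stabilizer (k : Type) {H : Type} [Field k] [LieRing H] [LieAlgebra k H] (z : H) :
    Submodule k H where
  carrier := {y | ∃ a : k, ⁅y, z⁆ = a • z}
  zero_mem' := ⟨0, by simp⟩
  add_mem' := by
    rintro x y ⟨a, ha⟩ ⟨b, hb⟩
    exact ⟨a + b, by rw [add_lie, ha, hb, add_smul]⟩
  smul_mem' := by
    rintro t x ⟨a, ha⟩
    exact ⟨t * a, by rw [smul_lie, ha, mul_smul]⟩

theorem mem_adWeightSpace {𝔪 : LieSubalgebra k H} {α : Module.Dual k 𝔪} {z : H} :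
    z ∈ adWeightSpace 𝔪 α ↔ ∀ y : 𝔪, ⁅(y : H), z⁆ = α y • z := by
  simp [adWeightSpace, Submodule.mem_iInf, sub_eq_zero]

theorem exists_weight {𝔪 : LieSubalgebra k H} {z : H} (h : 𝔪.toSubmodule ≤ stabilizer k z) :
    ∃ α, z ∈ adWeightSpace 𝔪 α := by
  by_cases hz : z = 0
  · exact ⟨0, hz ▸ zero_mem _⟩
  choose f hf using fun y : 𝔪 => h y.2
  have hinj := smul_left_injective k hz
  refine ⟨{ toFun := f, map_add' := fun x y => hinj ?_, map_smul' := fun t x => hinj ?_ },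
    mem_adWeightSpace.2 hf⟩
  · change f (x + y) • z = (f x + f y) • z
    rw [add_smul, ← hf, ← hf, ← hf, ← add_lie]
    rfl
  · change f (t • x) • z = (t • f x) • z
    rw [smul_assoc, ← hf, ← hf, ← smul_lie]
    rfl

theorem isDiagonalizable_of_span {𝔪 : LieSubalgebra k H}
    (h : Submodule.span k {z | 𝔪.toSubmodule ≤ stabilizer k z} = ⊤) :
    IsDiagonalizableSubalgebra 𝔪 := by
  rw [IsDiagonalizableSubalgebra, ← top_le_iff, ← h, Submodule.span_le]
  intro z hz
  obtain ⟨α, hα⟩ := exists_weight hz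
  exact Submodule.mem_iSup_of_mem α hα

theorem span_of_isDiagonalizable {𝔪 : LieSubalgebra k H} (h : IsDiagonalizableSubalgebra 𝔪) :
    Submodule.span k {z | 𝔪.toSubmodule ≤ stabilizer k z} = ⊤ := by
  rw [← top_le_iff, ← h]
  refine iSup_le fun α z hz => Submodule.subset_span fun y hy => ?_
  exact ⟨α ⟨y, hy⟩, mem_adWeightSpace.1 hz ⟨y, hy⟩⟩

theorem diag_of_mem {𝔪 : LieSubalgebra k H} (h : IsDiagonalizableSubalgebra 𝔪) {y : H}
    (hy : y ∈ 𝔪) : ⨆ α, (LieAlgebra.ad k H y).eigenspace α = ⊤ := by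
  rw [← top_le_iff, ← span_of_isDiagonalizable h, Submodule.span_le]
  intro z hz
  obtain ⟨a, ha⟩ := hz hy
  exact Submodule.mem_iSup_of_mem a (Module.End.mem_eigenspace_iff.2 ha)

/-- The abelian subalgebra spanned by a set of commuting elements. -/
def abelianSpan (s : Set H) (hs : ∀ x ∈ s, ∀ y ∈ s, ⁅x, y⁆ = 0) : LieSubalgebra k H where
  toSubmodule := Submodule.span k s
  lie_mem' := by
    intro x y hx hy
    have : ⁅x, y⁆ = 0 := by
      induction hx, hy using Submodule.span_induction₂ with
      | mem_mem x y hx hy => exact hs x hx y hy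
      | zero_left => simp
      | zero_right => simp
      | add_left x y z _ _ _ h1 h2 => rw [add_lie, h1, h2, add_zero]
      | add_right x y z _ _ _ h1 h2 => rw [lie_add, h1, h2, add_zero]
      | smul_left r x y _ _ h => rw [smul_lie, h, smul_zero]
      | smul_right r x y _ _ h => rw [lie_smul, h, smul_zero]
    rw [this]
    exact (Submodule.span k s).zero_mem

/-- A maximal diagonalizable subalgebra contains the center. -/
theorem mem_of_isMAD {𝔪 : LieSubalgebra k H} (h : IsMAD 𝔪) {c : H} (hc : ∀ z : H, ⁅c, z⁆ = 0) :
    c ∈ 𝔪 := by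
  let 𝔪' : LieSubalgebra k H :=
    { toSubmodule := 𝔪.toSubmodule ⊔ Submodule.span k {c}
      lie_mem' := by
        intro x y hxs hys
        obtain ⟨x, hx, x', hx', rfl⟩ := Submodule.mem_sup.1 hxs
        obtain ⟨y, hy, y', hy', rfl⟩ := Submodule.mem_sup.1 hys
        obtain ⟨a, rfl⟩ := Submodule.mem_span_singleton.1 hx'
        obtain ⟨b, rfl⟩ := Submodule.mem_span_singleton.1 hy'
        have : ⁅x, c⁆ = 0 := by rw [← lie_skew, hc, neg_zero]
        rw [add_lie, lie_add, smul_lie, hc, smul_zero,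
            add_zero, lie_smul, this, smul_zero, add_zero]
        exact Submodule.mem_sup_left (S := 𝔪.toSubmodule) (𝔪.lie_mem' hx hy) }
  have h1 : IsDiagonalizableSubalgebra 𝔪' := by
    refine isDiagonalizable_of_span ?_
    rw [← top_le_iff, ← span_of_isDiagonalizable h.1]
    refine Submodule.span_mono fun z hz => ?_
    change 𝔪.toSubmodule ⊔ Submodule.span k {c} ≤ stabilizer k z
    refine sup_le hz ?_
    rw [Submodule.span_singleton_le_iff_mem]
    exact ⟨0, by rw [hc, zero_smul]⟩
  have h2 : 𝔪' = 𝔪 := h.2 𝔪' h1 fun x hx => Submodule.mem_sup_left (S := 𝔪.toSubmodule) hx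
  rw [← h2]
  exact Submodule.mem_sup_right (S := 𝔪.toSubmodule) (Submodule.mem_span_singleton_self c)

end

/-- The affine Lie algebra attached to a twisted loop algebra. -/
structure AffineModel {k 𝔤 : Type} {V : Type*} [Field k] [LieRing 𝔤] [LieAlgebra k 𝔤] [LieRing V]
    [LieAlgebra k V] [LieAlgebra k[T;T⁻¹] V] [IsScalarTower k k[T;T⁻¹] V]
    (M : LoopModel k 𝔤 V) (τ : Twist k 𝔤) (H : Type) [LieRing H] [LieAlgebra k H] where
  J : V →ₗ[k] H
  c : H
  d : H
  lie_c : ∀ z : H, ⁅c, z⁆ = 0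
  d_lie : ∀ v ∈ τ.L M, ⁅d, J v⁆ = J (M.d v)
  J_lie : ∀ v ∈ τ.L M, ∀ w ∈ τ.L M, ⁅J v, J w⁆ = J ⁅v, w⁆ + cf 0 (M.κ (M.d v) w) • c
  exists_eq : ∀ z : H, ∃ v ∈ τ.L M, ∃ a b : k, z = J v + a • c + b • d
  eq_zero : ∀ v ∈ τ.L M, ∀ a b : k, J v + a • c + b • d = 0 → v = 0 ∧ a = 0 ∧ b = 0

namespace AffineModel

variable {k 𝔤 H : Type} {V : Type*} [Field k] [LieRing 𝔤] [LieAlgebra k 𝔤] [LieRing V]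
    [LieAlgebra k V] [LieAlgebra k[T;T⁻¹] V] [IsScalarTower k k[T;T⁻¹] V]
    {M : LoopModel k 𝔤 V} {τ : Twist k 𝔤} [LieRing H] [LieAlgebra k H]
    (A : AffineModel M τ H)

theorem lie_c' (z : H) : ⁅z, A.c⁆ = 0 := by rw [← lie_skew, A.lie_c, neg_zero]

theorem d_add_lie {Y v : V} (hY : Y ∈ τ.L M) (hv : v ∈ τ.L M) :
    ⁅A.d + A.J Y, A.J v⁆ = A.J (M.Dg Y v) + cf 0 (M.κ (M.d Y) v) • A.c := by
  rw [add_lie, A.d_lie v hv, A.J_lie Y hY v hv, M.Dg_apply, map_add, add_assoc]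

theorem d_add_lie_weight {Y v : V} (hY : Y ∈ τ.L M) (hv : v ∈ τ.L M) {α : k}
    (h : M.Dg Y v = α • v) :
    ⁅A.d + A.J Y, A.J v - cf 0 (M.κ Y v) • A.c⁆ = α • (A.J v - cf 0 (M.κ Y v) • A.c) := by
  have h1 : M.κ (M.d Y) v = dS (M.κ Y v) - α • M.κ Y v := by
    have h2 : M.κ Y (M.Dg Y v) = M.κ Y (M.d v) := by
      rw [M.Dg_apply, map_add, ← M.κ_lie, lie_self, map_zero, LinearMap.zero_apply, add_zero]
    rw [M.dS_κ, ← h2, h, M.κ_ksmul_right, add_sub_cancel_right]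
  rw [lie_sub, lie_smul, A.lie_c', smul_zero, sub_zero, A.d_add_lie hY hv, h, h1, map_sub, cf_dS,
    map_smul, map_smul, smul_sub, smul_smul, Int.cast_zero, zero_mul, zero_sub, neg_smul,
    ← sub_eq_add_neg, smul_eq_mul]

theorem lie_weight {Y l v : V} (hl : l ∈ τ.L M) (hv : v ∈ τ.L M)
    (hYl : M.Dg Y l = 0) {β : k} (h : ⁅l, v⁆ = β • v) :
    ⁅A.J l, A.J v - cf 0 (M.κ Y v) • A.c⁆ = β • (A.J v - cf 0 (M.κ Y v) • A.c) := by
  have h1 : M.κ (M.d l) v = -(β • M.κ Y v) := by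
    rw [M.Dg_apply] at hYl
    rw [eq_neg_of_add_eq_zero_left hYl, map_neg, LinearMap.neg_apply, M.κ_lie, h, M.κ_ksmul_right]
  rw [lie_sub, lie_smul, A.lie_c', smul_zero, sub_zero, A.J_lie l hl v hv, h, h1, map_neg,
    map_smul, map_smul, smul_sub, smul_smul, neg_smul, ← sub_eq_add_neg, smul_eq_mul]

theorem linearIndependent {Y l : V} (hY : Y ∈ τ.L M) (hl : l ∈ τ.L M) (hl0 : l ≠ 0) {t : k} :
    LinearIndependent k ![A.c, A.d + A.J Y, A.J l - t • A.c] := by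
  rw [Fintype.linearIndependent_iff]
  intro g hg
  simp only [Fin.sum_univ_three, Matrix.cons_val_zero, Matrix.cons_val_one, Matrix.cons_val] at hg
  have h := A.eq_zero (g 1 • Y + g 2 • l)
    (add_mem (Submodule.smul_mem _ _ hY) (Submodule.smul_mem _ _ hl)) (g 0 - g 2 * t) (g 1) (by
      rw [← hg]; simp only [map_add, map_smul]; module)
  obtain ⟨h1, h2, h3⟩ := h
  rw [h3, zero_smul, zero_add, smul_eq_zero, or_iff_left hl0] at h1
  rw [h1, zero_mul, sub_zero] at h2
  intro i
  fin_cases i <;> assumption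

theorem exists_diagonalizable {Y l : V} (hY : Y ∈ τ.L M) (hl : l ∈ τ.L M) (hl0 : l ≠ 0)
    (hYl : M.Dg Y l = 0) (hD : ⨆ α, (M.Dg Y).eigenspace α = ⊤)
    (hdiag : ⨆ α, (LieAlgebra.ad k V l).eigenspace α = ⊤) :
    ∃ 𝔪 : LieSubalgebra k H, IsDiagonalizableSubalgebra 𝔪 ∧ A.c ∈ 𝔪 ∧ A.d + A.J Y ∈ 𝔪 ∧
      A.J l ∈ 𝔪 ∧ 3 ≤ Module.rank k 𝔪 := by
  set t := cf 0 (M.κ Y l)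
  set X := A.d + A.J Y with hX
  set h := A.J l - t • A.c with hh
  have hXh : ⁅X, h⁆ = 0 := by
    rw [A.d_add_lie_weight hY hl (α := 0) (by rw [hYl, zero_smul]), zero_smul]
  have hhX : ⁅h, X⁆ = 0 := by rw [← lie_skew, hXh, neg_zero]
  let 𝔪 : LieSubalgebra k H := abelianSpan {A.c, X, h} (by
    rintro x (rfl | rfl | rfl) y (rfl | rfl | rfl) <;>
      simp only [A.lie_c, A.lie_c', lie_self, hXh, hhX])
  have hmem : ∀ z ∈ ({A.c, X, h} : Set H), z ∈ 𝔪 := fun z hz => Submodule.subset_span hz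
  have hc : A.c ∈ 𝔪 := hmem _ (by simp)
  have hX' : X ∈ 𝔪 := hmem _ (by simp)
  have hh' : h ∈ 𝔪 := hmem _ (by simp)
  have hstab : ∀ (z : H) (a b : k), ⁅X, z⁆ = a • z → ⁅h, z⁆ = b • z →
    𝔪.toSubmodule ≤ stabilizer k z := by
    intro z a b ha hb
    change Submodule.span k {A.c, X, h} ≤ _
    rw [Submodule.span_le]
    rintro x (rfl | rfl | rfl)
    · exact ⟨0, by rw [A.lie_c, zero_smul]⟩
    · exact ⟨a, ha⟩
    · exact ⟨b, hb⟩
  refine ⟨𝔪, isDiagonalizable_of_span ?_, hc, hX', ?_, ?_⟩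
  · set S := Submodule.span k {z | 𝔪.toSubmodule ≤ stabilizer k z}
    have hcS : A.c ∈ S := Submodule.subset_span
      (hstab _ 0 0 (by rw [A.lie_c', zero_smul]) (by rw [A.lie_c', zero_smul]))
    have hXS : X ∈ S := Submodule.subset_span
      (hstab _ 0 0 (by rw [lie_self, zero_smul]) (by rw [hhX, zero_smul]))
    have hLS : τ.L M ≤ S.comap A.J := by
      refine (le_iSup_inf_eigenspace _ hD _ fun v hv => τ.Dg_mem_L M hY hv).trans
        (iSup_le fun α => ?_)
      refine (le_iSup_inf_eigenspace _ hdiag _ fun v hv => ?_).trans (iSup_le fun β v hv => ?_)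
      · refine ⟨τ.lie_mem_L M hl hv.1, Module.End.mem_eigenspace_iff.2 ?_⟩
        rw [LieAlgebra.ad_apply, M.Dg_lie, hYl, zero_lie, zero_add,
          Module.End.mem_eigenspace_iff.1 hv.2, lie_smul]
      · obtain ⟨⟨hvL, hα⟩, hβ⟩ := hv
        have h1 := A.d_add_lie_weight hY hvL (Module.End.mem_eigenspace_iff.1 hα)
        have h2 := A.lie_weight hl hvL hYl (Module.End.mem_eigenspace_iff.1 hβ)
        have h3 : A.J v - cf 0 (M.κ Y v) • A.c ∈ S := Submodule.subset_span
          (hstab _ α β h1 (by rw [hh, sub_lie, smul_lie, A.lie_c, smul_zero, sub_zero, h2]))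
        rw [Submodule.mem_comap, ← sub_add_cancel (A.J v) (cf 0 (M.κ Y v) • A.c)]
        exact add_mem h3 (S.smul_mem _ hcS)
    rw [eq_top_iff]
    rintro z -
    obtain ⟨v, hv, a, b, rfl⟩ := A.exists_eq z
    have hdS : A.d ∈ S := by
      rw [← add_sub_cancel_right A.d (A.J Y)]
      exact sub_mem hXS (hLS hY)
    exact add_mem (add_mem (hLS hv) (S.smul_mem _ hcS)) (S.smul_mem _ hdS)
  · rw [← sub_add_cancel (A.J l) (t • A.c)]
    exact add_mem hh' (𝔪.smul_mem _ hc)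
  · refine three_le_rank (W := 𝔪.toSubmodule) (A.linearIndependent hY hl hl0 (t := t)) ?_
    intro i
    fin_cases i
    · exact hc
    · exact hX'
    · exact hh'

theorem le_iSup_of_diag {f : Module.End k H} (hf : ⨆ α, f.eigenspace α = ⊤) (hfc : f A.c = 0)
    {g : Module.End k V} (hgL : ∀ v ∈ τ.L M, g v ∈ τ.L M)
    (hfg : ∀ v ∈ τ.L M, ∃ γ : k, f (A.J v) = A.J (g v) + γ • A.c) :
    τ.L M ≤ ⨆ α, τ.L M ⊓ g.eigenspace α := by
  set N := ⨆ α, τ.L M ⊓ g.eigenspace α with hN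
  have hNL : N ≤ τ.L M := iSup_le fun α => inf_le_left
  have key : (τ.L M).map A.J ⊔ Submodule.span k {A.c} ≤ N.map A.J ⊔ Submodule.span k {A.c} := by
    refine (le_iSup_inf_eigenspace f hf _ ?_).trans (iSup_le ?_)
    · intro z hz
      obtain ⟨_, ⟨v, hv, rfl⟩, w, hw, rfl⟩ := Submodule.mem_sup.1 hz
      obtain ⟨a, rfl⟩ := Submodule.mem_span_singleton.1 hw
      obtain ⟨γ, hγ⟩ := hfg v hv
      rw [map_add, map_smul, hfc, smul_zero, add_zero, hγ]
      exact add_mem (Submodule.mem_sup_left ⟨_, hgL v hv, rfl⟩)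
        (Submodule.mem_sup_right (Submodule.mem_span_singleton.2 ⟨γ, rfl⟩))
    · rintro α z ⟨hz, hα⟩
      obtain ⟨_, ⟨v, hv, rfl⟩, w, hw, rfl⟩ := Submodule.mem_sup.1 hz
      refine add_mem (Submodule.mem_sup_left ⟨v, ?_, rfl⟩) (Submodule.mem_sup_right hw)
      obtain ⟨a, rfl⟩ := Submodule.mem_span_singleton.1 hw
      obtain ⟨γ, hγ⟩ := hfg v hv
      have hα' := Module.End.mem_eigenspace_iff.1 hα
      rw [map_add, map_smul, hfc, smul_zero, add_zero, hγ] at hα'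
      have h := A.eq_zero (g v - α • v) (sub_mem (hgL v hv) (Submodule.smul_mem _ _ hv))
        (γ - α * a) 0 (by
          rw [map_sub, map_smul, zero_smul, add_zero, sub_smul, mul_smul, ← sub_eq_zero.2 hα',
            smul_add]
          abel)
      exact Submodule.mem_iSup_of_mem α ⟨hv, Module.End.mem_eigenspace_iff.2 (sub_eq_zero.1 h.1)⟩
  intro v hv
  obtain ⟨_, ⟨w, hw, rfl⟩, z, hz, h⟩ :=
    Submodule.mem_sup.1 (key (Submodule.mem_sup_left ⟨v, hv, rfl⟩))
  obtain ⟨a, rfl⟩ := Submodule.mem_span_singleton.1 hz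
  have h0 := A.eq_zero (w - v) (sub_mem (hNL hw) hv) a 0 (by
    rw [map_sub, ← h]; simp)
  rwa [← sub_eq_zero.1 h0.1]

theorem d_diag (M : LoopModel k 𝔤 V) : ⨆ α, (M.Dg 0).eigenspace α = ⊤ := by
  rw [eq_top_iff]
  rintro v -
  induction v using M.ind with
  | hmon p y =>
    refine Submodule.mem_iSup_of_mem (p : k) (Module.End.mem_eigenspace_iff.2 ?_)
    rw [M.Dg_apply, zero_lie, add_zero, M.d_mon]
  | hadd v w hv hw => exact add_mem hv hw

variable [CharZero k]

theorem Dg_diag {Y : V} (hY : Y ∈ τ.L M)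
    (h : ⨆ α, (LieAlgebra.ad k H (A.d + A.J Y)).eigenspace α = ⊤) :
    ⨆ α, (M.Dg Y).eigenspace α = ⊤ := by
  refine τ.diag_of_le M (A.le_iSup_of_diag h ?_ (fun v hv => τ.Dg_mem_L M hY hv)
    fun v hv => ⟨_, A.d_add_lie hY hv⟩) 1 fun n v => ?_
  · rw [LieAlgebra.ad_apply, A.lie_c']
  · rw [M.Dg_T, mul_one]

theorem ad_diag {l : V} (hl : l ∈ τ.L M)
    (h : ⨆ α, (LieAlgebra.ad k H (A.J l)).eigenspace α = ⊤) :
    ⨆ α, (LieAlgebra.ad k V l).eigenspace α = ⊤ := by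
  refine τ.diag_of_le M (A.le_iSup_of_diag h ?_ (fun v hv => τ.lie_mem_L M hl hv)
    fun v hv => ⟨_, A.J_lie l hl v hv⟩) 0 fun n v => ?_
  · rw [LieAlgebra.ad_apply, A.lie_c']
  · rw [mul_zero, zero_smul, add_zero, LieAlgebra.ad_apply, lie_smul, LieAlgebra.ad_apply]

/-- A maximal diagonalizable subalgebra has dimension at least three. -/
theorem three_le_rank_of_isMAD [IsAlgClosed k] [LieAlgebra.IsSimple k 𝔤]
    (A : AffineModel M τ H) {𝔪 : LieSubalgebra k H} (h𝔪 : IsMAD 𝔪) :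
    3 ≤ Module.rank k 𝔪 := by
  by_contra hrank
  have hc : A.c ∈ 𝔪 := mem_of_isMAD h𝔪 A.lie_c
  have key : ∀ Y ∈ τ.L M, ∀ l ∈ τ.L M, l ≠ 0 → M.Dg Y l = 0 →
      ⨆ α, (M.Dg Y).eigenspace α = ⊤ → ⨆ α, (LieAlgebra.ad k V l).eigenspace α = ⊤ →
      𝔪.toSubmodule ≤ Submodule.span k {A.c, A.d + A.J Y, A.J l} → False := by
    intro Y hY l hl hl0 hYl hD hdiag hle
    obtain ⟨𝔪', h1, h2, h3, h4, h5⟩ := A.exists_diagonalizable hY hl hl0 hYl hD hdiag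
    have h6 : 𝔪 ≤ 𝔪' := by
      refine hle.trans (Submodule.span_le.2 ?_)
      rintro x (rfl | rfl | rfl)
      · exact h2
      · exact h3
      · exact h4
    rw [h𝔪.2 𝔪' h1 h6] at h5
    exact hrank h5
  by_cases hd : ∃ v ∈ τ.L M, ∃ a b : k, b ≠ 0 ∧ A.J v + a • A.c + b • A.d ∈ 𝔪
  · obtain ⟨v, hv, a, b, hb, hz⟩ := hd
    have hY : b⁻¹ • v ∈ τ.L M := Submodule.smul_mem _ _ hv
    have hX : A.d + A.J (b⁻¹ • v) ∈ 𝔪 := by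
      have h : A.d + A.J (b⁻¹ • v) =
          b⁻¹ • (A.J v + a • A.c + b • A.d) - (b⁻¹ * a) • A.c := by
        rw [map_smul, smul_add, smul_add, smul_smul, smul_smul, inv_mul_cancel₀ hb, one_smul]
        abel
      rw [h]
      exact sub_mem (𝔪.smul_mem _ hz) (𝔪.smul_mem _ hc)
    have hD := A.Dg_diag hY (diag_of_mem h𝔪.1 hX)
    obtain ⟨l, hl, hl0, hYl, hdiag⟩ := τ.exists_diag_invariant M hY hD
    have hli := A.linearIndependent hY hl hl0 (t := 0)
    have hli2 : LinearIndependent k ![A.c, A.d + A.J (b⁻¹ • v)] := by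
      rw [LinearIndependent.pair_iff]
      intro s t hst
      have := Fintype.linearIndependent_iff.1 hli ![s, t, 0] (by
        simpa [Fin.sum_univ_three] using hst)
      exact ⟨this 0, this 1⟩
    exact key _ hY l hl hl0 hYl hD hdiag
      ((le_span_pair hrank hc hX hli2).trans (Submodule.span_mono (by
        rintro x (rfl | rfl) <;> simp)))
  · by_cases hJ : ∃ v ∈ τ.L M, v ≠ 0 ∧ ∃ a : k, A.J v + a • A.c ∈ 𝔪
    · obtain ⟨l, hl, hl0, a, hz⟩ := hJ
      have hJl : A.J l ∈ 𝔪 := by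
        rw [← add_sub_cancel_right (A.J l) (a • A.c)]
        exact sub_mem hz (𝔪.smul_mem _ hc)
      have hdiag := A.ad_diag hl (diag_of_mem h𝔪.1 hJl)
      obtain ⟨Y, hY, hYl, hD⟩ := τ.exists_diag_Dg M hl hdiag
      have hli := A.linearIndependent hY hl hl0 (t := 0)
      have hli2 : LinearIndependent k ![A.c, A.J l] := by
        rw [LinearIndependent.pair_iff]
        intro s t hst
        have := Fintype.linearIndependent_iff.1 hli ![s, 0, t] (by
          simpa [Fin.sum_univ_three] using hst)
        exact ⟨this 0, this 2⟩
      exact key _ hY l hl hl0 hYl hD hdiag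
        ((le_span_pair hrank hc hJl hli2).trans (Submodule.span_mono (by
          rintro x (rfl | rfl) <;> simp)))
    · obtain ⟨l, hl, hl0, hYl, hdiag⟩ :=
        τ.exists_diag_invariant M (Submodule.zero_mem (τ.L M)) (d_diag M)
      refine key 0 (Submodule.zero_mem _) l hl hl0 hYl (d_diag M) hdiag fun z hz => ?_
      obtain ⟨v, hv, a, b, rfl⟩ := A.exists_eq z
      push Not at hd hJ
      have hb : b = 0 := by
        by_contra hb
        exact hd v hv a b hb hz
      subst hb
      rw [zero_smul, add_zero] at hz ⊢
      have hv0 : v = 0 := by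
        by_contra hv0
        exact hJ v hv hv0 a hz
      rw [hv0, map_zero, zero_add]
      exact Submodule.smul_mem _ _ (Submodule.subset_span (by simp))

end AffineModel

end LoopMAD

/-- Every MAD `𝔪` of the twisted affine Kac–Moody Lie algebra
`L̂(𝔤,σ)` satisfies `dim_k 𝔪 ≥ 3`. -/
theorem mad_dim_ge_three
    -- the base field
    (k : Type) [Field k] [IsAlgClosed k] [CharZero k]
    -- the simple finite-dimensional Lie algebra 𝔤
    (𝔤 : Type) [LieRing 𝔤] [LieAlgebra k 𝔤] [FiniteDimensional k 𝔤]
    [LieAlgebra.IsSimple k 𝔤]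
    -- the order m of σ and a primitive m-th root of unity ζ
    (m : ℕ) (hm : 0 < m)
    (σ : 𝔤 ≃ₗ⁅k⁆ 𝔤) (hσ : ∀ y : 𝔤, (⇑σ)^[m] y = y)
    (ζ : k) (hζ : IsPrimitiveRoot ζ m)
    -- the twisted loop algebra L(𝔤,σ) = ⊕_{i∈ℤ} 𝔤_ī ⊗ sⁱ, an R-Lie algebra for
    -- R = k[t^{±1}] = LaurentPolynomial k (with t = sᵐ);
    -- `u p y` represents `y ⊗ sᵖ` for `y ∈ 𝔤_p̄`, i.e. `σ y = ζ^p • y`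
    (Lg : Type) [LieRing Lg] [LieAlgebra (LaurentPolynomial k) Lg]
    [LieAlgebra k Lg] [IsScalarTower k (LaurentPolynomial k) Lg]
    (u : ℤ → 𝔤 →ₗ[k] Lg)
    (hu_bracket : ∀ (p q : ℤ) (y z : 𝔤), σ y = ζ ^ p • y → σ z = ζ ^ q • z →
      ⁅u p y, u q z⁆ = u (p + q) ⁅y, z⁆)
    (hu_t : ∀ (p : ℤ) (y : 𝔤), σ y = ζ ^ p • y →
      (T 1 : LaurentPolynomial k) • u p y = u (p + (m : ℤ)) y)
    (hu_span : ∀ l : Lg, ∃ f : ℤ →₀ 𝔤, (∀ i, σ (f i) = ζ ^ i • f i) ∧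
      l = f.sum fun i yi => u i yi)
    (hu_ind : ∀ f : ℤ →₀ 𝔤, (∀ i, σ (f i) = ζ ^ i • f i) →
      (f.sum fun i yi => u i yi) = 0 → f = 0)
    -- the twisted affine Kac–Moody algebra L̂(𝔤,σ) = L(𝔤,σ) ⊕ kc ⊕ kd
    (Lhat : Type) [LieRing Lhat] [LieAlgebra k Lhat]
    (c d : Lhat) (ι : Lg →ₗ[k] Lhat)
    (hc : ∀ z : Lhat, ⁅c, z⁆ = 0)
    (hd : ∀ (p : ℤ) (y : 𝔤), σ y = ζ ^ p • y →
      ⁅d, ι (u p y)⁆ = (p : k) • ι (u p y))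
    (hbr : ∀ (p q : ℤ) (y z : 𝔤), σ y = ζ ^ p • y → σ z = ζ ^ q • z →
      ⁅ι (u p y), ι (u q z)⁆ =
        ι (u (p + q) ⁅y, z⁆) +
          (if p + q = 0 then (p : k) * killingForm k 𝔤 y z else 0) • c)
    (hdec : ∀ z : Lhat, ∃ (l : Lg) (a b : k), z = ι l + a • c + b • d)
    (huniq : ∀ (l : Lg) (a b : k), ι l + a • c + b • d = 0 → l = 0 ∧ a = 0 ∧ b = 0)
    :
    ∀ 𝔪 : LieSubalgebra k Lhat, IsMAD 𝔪 → 3 ≤ Module.rank k ↥𝔪 := by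
  let M := LoopMAD.loopModel k 𝔤
  let τ : LoopMAD.Twist k 𝔤 := ⟨m, hm, σ, hσ, ζ, hζ⟩
  have hmem : ∀ v ∈ τ.L M, ∃ f : ℤ →₀ 𝔤, (∀ i, σ (f i) = ζ ^ i • f i) ∧
      v = f.sum fun i y => M.mon i y := fun v hv =>
    ⟨M.E.symm v, fun i => τ.σ_coef M hv i, (M.sum_mon v).symm⟩
  have hL : ∀ f : ℤ →₀ 𝔤, (∀ i, σ (f i) = ζ ^ i • f i) →
      (f.sum fun i y => M.mon i y) ∈ τ.L M := fun f hf =>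
    Submodule.sum_mem _ fun i _ => τ.mon_mem_L M (hf i)
  have hΨ : ∀ f : ℤ →₀ 𝔤, M.lift u (f.sum fun i y => M.mon i y) = f.sum fun i y => u i y := by
    intro f
    simp only [Finsupp.sum, map_sum, M.lift_mon]
  let A : LoopMAD.AffineModel M τ Lhat :=
    { J := ι ∘ₗ M.lift u
      c := c
      d := d
      lie_c := hc
      d_lie := by
        intro v hv
        obtain ⟨f, hf, rfl⟩ := hmem v hv
        simp only [Finsupp.sum, map_sum, lie_sum, LinearMap.comp_apply, M.d_mon, map_smul,
          M.lift_mon]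
        exact Finset.sum_congr rfl fun i _ => hd i _ (hf i)
      J_lie := by
        intro v hv w hw
        obtain ⟨f, hf, rfl⟩ := hmem v hv
        obtain ⟨g, hg, rfl⟩ := hmem w hw
        simp only [Finsupp.sum, map_sum, sum_lie, lie_sum, LinearMap.sum_apply,
          LinearMap.comp_apply, M.d_mon, M.lift_mon, M.mon_lie, M.κ_ksmul_left, M.κ_mon, map_smul,
          LoopMAD.cf_T, Finset.sum_smul, ← Finset.sum_add_distrib]
        refine Finset.sum_congr rfl fun i _ => Finset.sum_congr rfl fun j _ => ?_
        rw [hbr _ _ _ _ (hf _) (hg _)]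
        simp only [smul_eq_mul, mul_ite, mul_one, mul_zero]
      exists_eq := by
        intro z
        obtain ⟨l, a, b, rfl⟩ := hdec z
        obtain ⟨f, hf, rfl⟩ := hu_span l
        exact ⟨_, hL f hf, a, b, by rw [LinearMap.comp_apply, hΨ]⟩
      eq_zero := by
        intro v hv a b h
        obtain ⟨f, hf, rfl⟩ := hmem v hv
        rw [LinearMap.comp_apply, hΨ] at h
        obtain ⟨h1, h2⟩ := huniq _ _ _ h
        rw [hu_ind f hf h1, Finsupp.sum_zero_index]
        exact ⟨rfl, h2⟩ }
  exact fun 𝔪 h => A.three_le_rank_of_isMAD h
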